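/- arXiv:1810.07920 — 7 statements merged into one kernel-verified Lean document; each statement's English description precedes it below -/
import Mathlib

section
/- Let 𝔫 be the Lie algebra associated with a finite simple graph 𝒢, equipped with an inner product (·,·); set 𝔷 = [𝔫,𝔫], 𝔞 = 𝔷^⊥, and define J_Z ∈ so(𝔞) by (J_Z X, Y) = (Z,[X,Y]). Then the following are equivalent: (i) the GO condition holds: for every X ∈ 𝔞 and Z ∈ 𝔷 there exists a derivation D of 𝔫, skew-symmetric with respect to (·,·), with DZ = 0 and DX = J_Z X; (ii) the NR condition holds: 𝒥 = span{J_Z : Z ∈ 𝔷} is a Lie subalgebra of so(𝔞) and for every Z ∈ 𝔷 the operator J^{-1} ∘ ad_{J_Z} ∘ J ∈ End(𝔷) is skew-symmetric with respect to (·,·); (iii) the graph 𝒢 is a disjoint union of complete graphs and (·,·) is a semi-standard inner product. -/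
/-- `(e, zb)` is a standard basis of the Lie algebra `N` associated with the graph `G`. -/
def IsStandardBasis {n : ℕ} (G : SimpleGraph (Fin n)) {N : Type*} [LieRing N] [LieAlgebra ℝ N]
    (e : Fin n → N) (zb : G.edgeSet → N) : Prop :=
  (∀ (α : G.edgeSet) (x : N), ⁅zb α, x⁆ = 0) ∧
  (∀ (i j : Fin n), i < j → ∀ h : G.Adj i j, ⁅e i, e j⁆ = zb ⟨s(i, j), G.mem_edgeSet.mpr h⟩) ∧
  (∀ (i j : Fin n), i < j → ¬ G.Adj i j → ⁅e i, e j⁆ = 0) ∧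
  LinearIndependent ℝ (Sum.elim e zb) ∧
  Submodule.span ℝ (Set.range (Sum.elim e zb)) = ⊤

/-- `G` is a disjoint union of complete graphs: two vertices are adjacent iff they are distinct
and lie in the same class of some partition of the vertex set. -/
def IsDisjointUnionOfCompleteGraphs {n : ℕ} (G : SimpleGraph (Fin n)) : Prop :=
  ∃ col : Fin n → ℕ, ∀ i j : Fin n, G.Adj i j ↔ (i ≠ j ∧ col i = col j)

/-- The bilinear form `B(K₁,K₂) = -(1/2) Tr(K₁ K₂)` on operators. -/
noncomputable def traceForm {a : Type*} [AddCommGroup a] [Module ℝ a]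
    (K L : a →ₗ[ℝ] a) : ℝ :=
  -(1 / 2) * LinearMap.trace ℝ a (K ∘ₗ L)

/-- The inner product (bilinear form) `P` on the Lie algebra `N` associated with the graph `G`
is semi-standard. -/
def IsSemiStandard {n : ℕ} (G : SimpleGraph (Fin n)) {N : Type*} [LieRing N] [LieAlgebra ℝ N]
    (P : LinearMap.BilinForm ℝ N) : Prop :=
  ∃ (e : Fin n → N) (zb : G.edgeSet → N) (Pstd : LinearMap.BilinForm ℝ N),
    IsStandardBasis G e zb ∧
    -- `Pstd` is the standard inner product of the standard basis `(e, zb)`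
    (∀ s t : Fin n ⊕ G.edgeSet,
      Pstd (Sum.elim e zb s) (Sum.elim e zb t) = if s = t then 1 else 0) ∧
    -- `J⁰ : 𝔷 → so(𝔞)` is defined by `⟨J⁰_Z X, Y⟩ = ⟨Z, [X,Y]⟩`
    ∃ J0 : (Submodule.span ℝ (Set.range zb)) →ₗ[ℝ]
        ((Submodule.span ℝ (Set.range e)) →ₗ[ℝ] (Submodule.span ℝ (Set.range e))),
      (∀ (Z : Submodule.span ℝ (Set.range zb)) (X Y : Submodule.span ℝ (Set.range e)),
        Pstd (J0 Z X : N) (Y : N) = Pstd (Z : N) ⁅(X : N), (Y : N)⁆) ∧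
      -- a decomposition of `𝒥 = span{J⁰_Z}` into a `B`-orthogonal direct sum of ideals
      ∃ (k : ℕ)
        (I : Fin k → Submodule ℝ ((Submodule.span ℝ (Set.range e)) →ₗ[ℝ]
          (Submodule.span ℝ (Set.range e))))
        (lam : Fin k → ℝ)
        (Φ : ((Submodule.span ℝ (Set.range e)) →ₗ[ℝ] (Submodule.span ℝ (Set.range e))) →ₗ[ℝ]
          ((Submodule.span ℝ (Set.range e)) →ₗ[ℝ] (Submodule.span ℝ (Set.range e)))),
        (∀ μ, 0 < lam μ) ∧
        (⨆ μ, I μ) = Submodule.span ℝ (Set.range fun Z => J0 Z) ∧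
        (∀ μ, Disjoint (I μ) (⨆ ν ∈ {ν | ν ≠ μ}, I ν)) ∧
        -- each `I μ` is an ideal of `𝒥`
        (∀ μ K L, K ∈ Submodule.span ℝ (Set.range fun Z => J0 Z) → L ∈ I μ →
          K ∘ₗ L - L ∘ₗ K ∈ I μ) ∧
        -- the ideals are pairwise `B`-orthogonal
        (∀ μ ν, μ ≠ ν → ∀ K ∈ I μ, ∀ L ∈ I ν, traceForm K L = 0) ∧
        -- `Φ` is the linear combination of the projections with positive coefficients
        (∀ μ, ∀ K ∈ I μ, Φ K = lam μ • K) ∧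
        -- `(X+Z, Y+W) = ⟨X,Y⟩ + B(Φ J⁰_Z, J⁰_W)`
        (∀ (X Y : Submodule.span ℝ (Set.range e)) (Z W : Submodule.span ℝ (Set.range zb)),
          P ((X : N) + (Z : N)) ((Y : N) + (W : N)) =
            Pstd (X : N) (Y : N) + traceForm (Φ (J0 Z)) (J0 W))

theorem exists_forall_bilin_eq {V : Type*} [AddCommGroup V] [Module ℝ V] [FiniteDimensional ℝ V]
    {P : LinearMap.BilinForm ℝ V} (hPpos : ∀ x : V, x ≠ 0 → 0 < P x x) (φ : V →ₗ[ℝ] ℝ) :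
    ∃ v, ∀ x, P v x = φ x := by
  have hinj : Function.Injective P := by
    rw [← LinearMap.ker_eq_bot, LinearMap.ker_eq_bot']
    intro m hm
    by_contra h
    have := hPpos m h
    simp [hm] at this
  have hsurj : Function.Surjective P :=
    (LinearMap.injective_iff_surjective_of_finrank_eq_finrank
      (Subspace.dual_finrank_eq (K := ℝ) (V := V)).symm).1 hinj
  obtain ⟨v, hv⟩ := hsurj φ
  exact ⟨v, fun x => by rw [hv]⟩

theorem exists_mem_forall_bilin_eq {V : Type*} [AddCommGroup V] [Module ℝ V]
    [FiniteDimensional ℝ V] {P : LinearMap.BilinForm ℝ V} (hPpos : ∀ x : V, x ≠ 0 → 0 < P x x)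
    (z : Submodule ℝ V) (φ : V →ₗ[ℝ] ℝ) :
    ∃ v ∈ z, ∀ x ∈ z, P v x = φ x := by
  obtain ⟨v, hv⟩ := exists_forall_bilin_eq (P := P.restrict z)
    (fun x hx => hPpos x (by simpa using hx)) (φ ∘ₗ z.subtype)
  exact ⟨v, v.2, fun x hx => hv ⟨x, hx⟩⟩

theorem eq_of_bilin_eq_of_mem {V : Type*} [AddCommGroup V] [Module ℝ V]
    {P : LinearMap.BilinForm ℝ V} (hPpos : ∀ x : V, x ≠ 0 → 0 < P x x)
    {z : Submodule ℝ V} {v w : V} (hv : v ∈ z) (hw : w ∈ z) (h : ∀ x ∈ z, P v x = P w x) :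
    v = w := by
  by_contra hne
  have h1 := hPpos (v - w) (sub_ne_zero.2 hne)
  have h2 := h (v - w) (z.sub_mem hv hw)
  simp only [map_sub, LinearMap.sub_apply] at h1 h2
  linarith

namespace IsStandardBasis

variable {n : ℕ} {G : SimpleGraph (Fin n)} {N : Type*} [LieRing N] [LieAlgebra ℝ N]
  {e : Fin n → N} {zb : G.edgeSet → N}

theorem zb_lie (hb : IsStandardBasis G e zb) (α : G.edgeSet) (x : N) : ⁅zb α, x⁆ = 0 :=
  hb.1 α x

theorem lie_eq_zero_of_mem_left (hb : IsStandardBasis G e zb) {m : N}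
    (hm : m ∈ Submodule.span ℝ (Set.range zb)) (x : N) : ⁅m, x⁆ = 0 := by
  induction hm using Submodule.span_induction with
  | mem y hy => obtain ⟨α, rfl⟩ := hy; exact hb.zb_lie α x
  | zero => simp
  | add y w _ _ h1 h2 => simp [h1, h2]
  | smul c y _ h => simp [h]

theorem lie_eq_zero_of_mem_right (hb : IsStandardBasis G e zb) {m : N}
    (hm : m ∈ Submodule.span ℝ (Set.range zb)) (x : N) : ⁅x, m⁆ = 0 := by
  rw [← lie_skew, hb.lie_eq_zero_of_mem_left hm, neg_zero]

theorem lie_eq_zero_of_not_adj (hb : IsStandardBasis G e zb) {i j : Fin n} (h : ¬ G.Adj i j) :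
    ⁅e i, e j⁆ = 0 := by
  rcases lt_trichotomy i j with hij | rfl | hij
  · exact hb.2.2.1 i j hij h
  · exact lie_self _
  · rw [← lie_skew, hb.2.2.1 j i hij (fun h' => h h'.symm), neg_zero]

theorem zb_eq_lie (hb : IsStandardBasis G e zb) (α : G.edgeSet) :
    zb α = ⁅e (α : Sym2 (Fin n)).inf, e (α : Sym2 (Fin n)).sup⁆ := by
  obtain ⟨α, hα⟩ := α
  induction α using Sym2.ind with
  | _ i j =>
    have hadj : G.Adj i j := G.mem_edgeSet.1 hα
    rcases lt_or_gt_of_ne hadj.ne with hij | hij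
    · simp [inf_eq_left.2 hij.le, sup_eq_right.2 hij.le, hb.2.1 i j hij hadj]
    · simp only [Sym2.inf_mk, Sym2.sup_mk, inf_eq_right.2 hij.le, sup_eq_left.2 hij.le,
        hb.2.1 j i hij hadj.symm, Sym2.eq_swap]

/-- The standard basis as a bundled basis. -/
noncomputable def basis (hb : IsStandardBasis G e zb) : Module.Basis (Fin n ⊕ G.edgeSet) ℝ N :=
  Module.Basis.mk hb.2.2.2.1 hb.2.2.2.2.ge

theorem basis_inl (hb : IsStandardBasis G e zb) (i : Fin n) : hb.basis (Sum.inl i) = e i := by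
  simp [basis]

theorem basis_inr (hb : IsStandardBasis G e zb) (α : G.edgeSet) :
    hb.basis (Sum.inr α) = zb α := by
  simp [basis]

/-- The coordinate of a vector along the vertex `i`. -/
noncomputable def coord (hb : IsStandardBasis G e zb) (i : Fin n) : N →ₗ[ℝ] ℝ :=
  hb.basis.coord (Sum.inl i)

theorem coord_e (hb : IsStandardBasis G e zb) (i j : Fin n) :
    hb.coord i (e j) = if j = i then 1 else 0 := by
  rw [← hb.basis_inl, coord, Module.Basis.coord_apply, Module.Basis.repr_self,
    Finsupp.single_apply]
  simp

theorem coord_zb (hb : IsStandardBasis G e zb) (i : Fin n) (α : G.edgeSet) :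
    hb.coord i (zb α) = 0 := by
  rw [← hb.basis_inr, coord, Module.Basis.coord_apply, Module.Basis.repr_self,
    Finsupp.single_apply]
  simp

theorem coord_eq_zero_of_mem (hb : IsStandardBasis G e zb) (i : Fin n) {m : N}
    (hm : m ∈ Submodule.span ℝ (Set.range zb)) : hb.coord i m = 0 := by
  have : Submodule.span ℝ (Set.range zb) ≤ LinearMap.ker (hb.coord i) := by
    rw [Submodule.span_le]
    rintro _ ⟨α, rfl⟩
    exact hb.coord_zb i α
  exact this hm

theorem sub_sum_coord_mem (hb : IsStandardBasis G e zb) (x : N) :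
    x - ∑ i, hb.coord i x • e i ∈ Submodule.span ℝ (Set.range zb) := by
  classical
  have : Fintype G.edgeSet := Fintype.ofFinite _
  have h := hb.basis.sum_repr x
  rw [Fintype.sum_sum_type] at h
  have h2 : x - ∑ i, hb.coord i x • e i =
      ∑ α, hb.basis.repr x (Sum.inr α) • zb α := by
    rw [sub_eq_iff_eq_add, add_comm]
    conv_lhs => rw [← h]
    simp [basis_inl, basis_inr, coord]
  rw [h2]
  exact Submodule.sum_mem _ fun α _ =>
    Submodule.smul_mem _ _ (Submodule.subset_span ⟨α, rfl⟩)

theorem lie_eq_sum (hb : IsStandardBasis G e zb) (x y : N) :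
    ⁅x, y⁆ = ∑ i, ∑ j, (hb.coord i x * hb.coord j y) • ⁅e i, e j⁆ := by
  have hx := hb.lie_eq_zero_of_mem_left (hb.sub_sum_coord_mem x) y
  have hy := hb.lie_eq_zero_of_mem_right (hb.sub_sum_coord_mem y) (∑ i, hb.coord i x • e i)
  rw [sub_lie, sub_eq_zero] at hx
  rw [lie_sub, sub_eq_zero] at hy
  rw [hx, hy, sum_lie]
  refine Finset.sum_congr rfl fun i _ => ?_
  rw [lie_sum]
  refine Finset.sum_congr rfl fun j _ => ?_
  rw [smul_lie, lie_smul, smul_smul]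

theorem lie_eq_zero_of_coord (hb : IsStandardBasis G e zb) {x y : N}
    (h : ∀ u v, G.Adj u v → hb.coord u x * hb.coord v y = hb.coord v x * hb.coord u y) :
    ⁅x, y⁆ = 0 := by
  have h2 : ⁅x, y⁆ = ⁅y, x⁆ := by
    rw [hb.lie_eq_sum x y, hb.lie_eq_sum y x]
    refine Finset.sum_congr rfl fun i _ => Finset.sum_congr rfl fun j _ => ?_
    by_cases hij : G.Adj i j
    · rw [h i j hij, mul_comm]
    · rw [hb.lie_eq_zero_of_not_adj hij, smul_zero, smul_zero]
  have h3 : (2 : ℝ) • ⁅x, y⁆ = 0 := by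
    rw [two_smul]
    nth_rewrite 1 [h2]
    rw [← lie_skew x y, add_neg_cancel]
  simpa using h3

theorem exists_functional (hb : IsStandardBasis G e zb) (k : Fin n → Fin n → ℝ)
    (hskew : ∀ i j, k i j = - k j i) (hsupp : ∀ i j, ¬ G.Adj i j → k i j = 0) :
    ∃ φ : N →ₗ[ℝ] ℝ, ∀ x y, φ ⁅x, y⁆ = ∑ i, ∑ j, k i j * (hb.coord i x * hb.coord j y) := by
  let φ : N →ₗ[ℝ] ℝ := hb.basis.constr ℝ (Sum.elim (fun _ => 0) fun α : G.edgeSet =>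
    k (α : Sym2 (Fin n)).inf (α : Sym2 (Fin n)).sup)
  have hφ : ∀ α, φ (zb α) = k (α : Sym2 (Fin n)).inf (α : Sym2 (Fin n)).sup := by
    intro α
    rw [← hb.basis_inr, Module.Basis.constr_basis]
    rfl
  have hlt : ∀ i j, i < j → G.Adj i j → φ ⁅e i, e j⁆ = k i j := by
    intro i j hij h
    rw [hb.2.1 i j hij h, hφ]
    simp [inf_eq_left.2 hij.le, sup_eq_right.2 hij.le]
  have hall : ∀ i j, φ ⁅e i, e j⁆ = k i j := by
    intro i j
    by_cases h : G.Adj i j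
    · rcases lt_or_gt_of_ne h.ne with hij | hij
      · exact hlt i j hij h
      · rw [← lie_skew, map_neg, hlt j i hij h.symm, ← hskew]
    · rw [hb.lie_eq_zero_of_not_adj h, hsupp i j h, map_zero]
  refine ⟨φ, fun x y => ?_⟩
  rw [hb.lie_eq_sum, map_sum]
  refine Finset.sum_congr rfl fun i _ => ?_
  rw [map_sum]
  refine Finset.sum_congr rfl fun j _ => ?_
  rw [map_smul, hall, smul_eq_mul, mul_comm]

theorem exists_functional_of_adj (hb : IsStandardBasis G e zb) {u v : Fin n} (h : G.Adj u v) :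
    ∃ φ : N →ₗ[ℝ] ℝ, ∀ x y,
      φ ⁅x, y⁆ = hb.coord u x * hb.coord v y - hb.coord v x * hb.coord u y := by
  obtain ⟨φ, hφ⟩ := hb.exists_functional
    (fun i j => (if i = u ∧ j = v then 1 else 0) - (if i = v ∧ j = u then 1 else 0))
    (fun i j => by simp [and_comm])
    (fun i j hij => by
      rw [if_neg, if_neg, sub_zero]
      · rintro ⟨rfl, rfl⟩; exact hij h.symm
      · rintro ⟨rfl, rfl⟩; exact hij h)
  refine ⟨φ, fun x y => ?_⟩
  rw [hφ]
  simp [sub_mul, ite_and, Finset.sum_sub_distrib]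

theorem span_zb (hb : IsStandardBasis G e zb) :
    Submodule.span ℝ (Set.range zb) = Submodule.span ℝ {m : N | ∃ x y : N, ⁅x, y⁆ = m} := by
  apply le_antisymm
  · refine Submodule.span_mono ?_
    rintro _ ⟨α, rfl⟩
    exact ⟨_, _, (hb.zb_eq_lie α).symm⟩
  · rw [Submodule.span_le]
    rintro _ ⟨x, y, rfl⟩
    rw [hb.lie_eq_sum]
    refine Submodule.sum_mem _ fun i _ => Submodule.sum_mem _ fun j _ =>
      Submodule.smul_mem _ _ ?_
    by_cases h : G.Adj i j
    · rcases lt_or_gt_of_ne h.ne with hij | hij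
      · rw [hb.2.1 i j hij h]
        exact Submodule.subset_span ⟨_, rfl⟩
      · rw [← lie_skew, hb.2.1 j i hij h.symm]
        exact Submodule.neg_mem _ (Submodule.subset_span ⟨_, rfl⟩)
    · rw [hb.lie_eq_zero_of_not_adj h]
      exact Submodule.zero_mem _

theorem lie_mem (hb : IsStandardBasis G e zb) (x y : N) :
    ⁅x, y⁆ ∈ Submodule.span ℝ (Set.range zb) := by
  rw [hb.span_zb]
  exact Submodule.subset_span ⟨x, y, rfl⟩

theorem span_e_sup_span_zb (hb : IsStandardBasis G e zb) :
    Submodule.span ℝ (Set.range e) ⊔ Submodule.span ℝ (Set.range zb) = ⊤ := by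
  rw [← Submodule.span_union, ← Set.Sum.elim_range, hb.2.2.2.2]

theorem exists_of_span_sup_eq_top (hb : IsStandardBasis G e zb) (e' : Fin n → N)
    (h0 : ∀ i j, ¬ G.Adj i j → ⁅e' i, e' j⁆ = 0)
    (hs : Submodule.span ℝ (Set.range e') ⊔ Submodule.span ℝ (Set.range zb) = ⊤) :
    ∃ zb' : G.edgeSet → N, IsStandardBasis G e' zb' ∧
      Submodule.span ℝ (Set.range zb') = Submodule.span ℝ (Set.range zb) := by
  classical
  let zb' : G.edgeSet → N := fun α => ⁅e' (α : Sym2 (Fin n)).inf, e' (α : Sym2 (Fin n)).sup⁆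
  have hlt : ∀ i j, i < j → ∀ h : G.Adj i j,
      ⁅e' i, e' j⁆ = zb' ⟨s(i, j), G.mem_edgeSet.mpr h⟩ := by
    intro i j hij h
    simp [zb', inf_eq_left.2 hij.le, sup_eq_right.2 hij.le]
  have hlie : ∀ i j, ⁅e' i, e' j⁆ ∈ Submodule.span ℝ (Set.range zb') := by
    intro i j
    by_cases h : G.Adj i j
    · rcases lt_or_gt_of_ne h.ne with hij | hij
      · rw [hlt i j hij h]
        exact Submodule.subset_span ⟨_, rfl⟩
      · rw [← lie_skew, hlt j i hij h.symm]
        exact Submodule.neg_mem _ (Submodule.subset_span ⟨_, rfl⟩)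
    · rw [h0 i j h]
      exact Submodule.zero_mem _
  have hlie1 : ∀ x ∈ Submodule.span ℝ (Set.range e'), ∀ i,
      ⁅x, e' i⁆ ∈ Submodule.span ℝ (Set.range zb') := by
    intro x hx i
    induction hx using Submodule.span_induction with
    | mem y hy => obtain ⟨j, rfl⟩ := hy; exact hlie j i
    | zero => simp
    | add y w _ _ h1 h2 => rw [add_lie]; exact Submodule.add_mem _ h1 h2
    | smul c y _ h => rw [smul_lie]; exact Submodule.smul_mem _ _ h
  have hlie2 : ∀ x ∈ Submodule.span ℝ (Set.range e'), ∀ y ∈ Submodule.span ℝ (Set.range e'),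
      ⁅x, y⁆ ∈ Submodule.span ℝ (Set.range zb') := by
    intro x hx y hy
    induction hy using Submodule.span_induction with
    | mem y hy => obtain ⟨j, rfl⟩ := hy; exact hlie1 x hx j
    | zero => simp
    | add y w _ _ h1 h2 => rw [lie_add]; exact Submodule.add_mem _ h1 h2
    | smul c y _ h => rw [lie_smul]; exact Submodule.smul_mem _ _ h
  have hspan : Submodule.span ℝ (Set.range zb') = Submodule.span ℝ (Set.range zb) := by
    apply le_antisymm
    · rw [Submodule.span_le]
      rintro _ ⟨α, rfl⟩
      exact hb.lie_mem _ _
    · rw [hb.span_zb, Submodule.span_le]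
      rintro _ ⟨x, y, rfl⟩
      have hx : x ∈ Submodule.span ℝ (Set.range e') ⊔ Submodule.span ℝ (Set.range zb) :=
        hs ▸ Submodule.mem_top
      have hy : y ∈ Submodule.span ℝ (Set.range e') ⊔ Submodule.span ℝ (Set.range zb) :=
        hs ▸ Submodule.mem_top
      obtain ⟨x1, hx1, x2, hx2, rfl⟩ := Submodule.mem_sup.1 hx
      obtain ⟨y1, hy1, y2, hy2, rfl⟩ := Submodule.mem_sup.1 hy
      rw [add_lie, hb.lie_eq_zero_of_mem_left hx2, lie_add, hb.lie_eq_zero_of_mem_right hy2,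
        add_zero, add_zero]
      exact hlie2 _ hx1 _ hy1
  have htop : Submodule.span ℝ (Set.range (Sum.elim e' zb')) = ⊤ := by
    rw [Set.Sum.elim_range, Submodule.span_union, hspan, hs]
  have : Fintype G.edgeSet := Fintype.ofFinite _
  refine ⟨zb', ⟨fun α x => ?_, hlt, fun i j _ h => h0 i j h, ?_, htop⟩, hspan⟩
  · exact hb.lie_eq_zero_of_mem_left (hb.lie_mem _ _) x
  · exact linearIndependent_of_top_le_span_of_card_eq_finrank htop.ge
      (Module.finrank_eq_card_basis hb.basis).symm

theorem coord_derivation_eq_zero (hb : IsStandardBasis G e zb) {D : N →ₗ[ℝ] N}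
    (hD : ∀ x y : N, D ⁅x, y⁆ = ⁅D x, y⁆ + ⁅x, D y⁆) {i k l : Fin n} (hkl : G.Adj k l)
    (hil : ¬ G.Adj i l) (hne : i ≠ l) : hb.coord k (D (e i)) = 0 := by
  obtain ⟨φ, hφ⟩ := hb.exists_functional_of_adj hkl
  have h := hD (e i) (e l)
  rw [hb.lie_eq_zero_of_not_adj hil, map_zero] at h
  have h2 := congrArg φ h
  have hki : i ≠ k := by rintro rfl; exact hil hkl
  simpa [hφ, coord_e, hki, hne, hkl.ne, hkl.ne.symm, eq_comm] using h2

end IsStandardBasis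

/-- The inner product space structure given by a positive definite symmetric bilinear form. -/
abbrev innerProductCoreOfBilin {V : Type*} [AddCommGroup V] [Module ℝ V]
    {P : LinearMap.BilinForm ℝ V} (hPsym : ∀ x y, P x y = P y x)
    (hPpos : ∀ x : V, x ≠ 0 → 0 < P x x) : InnerProductSpace.Core ℝ V :=
  { inner := fun x y => P x y
    conj_inner_symm := fun x y => by simp [hPsym x y]
    re_inner_nonneg := fun x => by
      by_cases hx : x = 0
      · simp [hx]
      · simpa using (hPpos x hx).le
    add_left := fun x y w => by simp
    smul_left := fun x y c => by simp
    definite := fun x hx => by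
      by_contra hne
      exact (hPpos x hne).ne' hx }

theorem exists_orthonormal_of_blocks {V : Type*} [AddCommGroup V] [Module ℝ V]
    {P : LinearMap.BilinForm ℝ V} (hPsym : ∀ x y, P x y = P y x)
    (hPpos : ∀ x : V, x ≠ 0 → 0 < P x x) {n : ℕ} {h : Fin n → V} (hli : LinearIndependent ℝ h)
    {r : Fin n → Fin n → Prop} (hr : Equivalence r)
    (horth : ∀ u v, ¬ r u v → P (h u) (h v) = 0) :
    ∃ g : Fin n → V, (∀ u v, P (g u) (g v) = if u = v then 1 else 0) ∧
      ∀ v, g v ∈ Submodule.span ℝ (h '' {u | r v u}) := by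
  let core := innerProductCoreOfBilin hPsym hPpos
  let _ : NormedAddCommGroup V := core.toNormedAddCommGroup
  let _ : InnerProductSpace ℝ V := InnerProductSpace.ofCore core.toCore
  have hinner : ∀ x y : V, inner ℝ x y = P x y := fun _ _ => rfl
  have hmem : ∀ v, InnerProductSpace.gramSchmidt ℝ h v ∈
      Submodule.span ℝ (h '' {u | r v u}) := by
    intro v
    induction v using WellFoundedLT.induction with
    | ind v ih =>
      rw [InnerProductSpace.gramSchmidt_def]
      refine Submodule.sub_mem _ (Submodule.subset_span ⟨v, hr.refl v, rfl⟩)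
        (Submodule.sum_mem _ fun u hu => ?_)
      have hu' := ih u (Finset.mem_Iio.1 hu)
      by_cases huv : r v u
      · have hset : {w | r u w} = {w | r v w} :=
          Set.ext fun w => ⟨fun hw => hr.trans huv hw, fun hw => hr.trans (hr.symm huv) hw⟩
        rw [hset] at hu'
        rw [Submodule.starProjection_singleton]
        exact Submodule.smul_mem _ _ hu'
      · have hker : Submodule.span ℝ (h '' {w | r u w}) ≤ LinearMap.ker (P.flip (h v)) := by
          rw [Submodule.span_le]
          rintro _ ⟨w, hw, rfl⟩
          exact horth w v fun hwv => huv (hr.symm (hr.trans hw hwv))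
        have h0 : inner ℝ (InnerProductSpace.gramSchmidt ℝ h u) (h v) = 0 := hker hu'
        rw [Submodule.starProjection_singleton, h0]
        simp
  refine ⟨InnerProductSpace.gramSchmidtNormed ℝ h, fun u v => ?_, fun v => ?_⟩
  · rw [← hinner]
    exact orthonormal_iff_ite.1 (InnerProductSpace.gramSchmidtNormed_orthonormal hli) u v
  · exact Submodule.smul_mem _ _ (hmem v)

/-- The geodesic orbit condition, with `𝔷` and its orthogonal complement viewed inside `𝔫`. -/
def IsGeodesicOrbit {N : Type*} [LieRing N] [LieAlgebra ℝ N] (P : LinearMap.BilinForm ℝ N)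
    (z : Submodule ℝ N) : Prop :=
  ∀ X : N, (∀ m ∈ z, P m X = 0) → ∀ Z ∈ z, ∃ D : N →ₗ[ℝ] N,
    (∀ x y : N, D ⁅x, y⁆ = ⁅D x, y⁆ + ⁅x, D y⁆) ∧ (∀ x y : N, P (D x) y = - P x (D y)) ∧
    D Z = 0 ∧ ∀ Y : N, P (D X) Y = P Z ⁅X, Y⁆

namespace IsStandardBasis

variable {n : ℕ} {G : SimpleGraph (Fin n)} {N : Type*} [LieRing N] [LieAlgebra ℝ N]
  {e : Fin n → N} {zb : G.edgeSet → N} {P : LinearMap.BilinForm ℝ N}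

theorem exists_orthogonal_to_center [FiniteDimensional ℝ N] (hb : IsStandardBasis G e zb)
    (hPsym : ∀ x y : N, P x y = P y x) (hPpos : ∀ x : N, x ≠ 0 → 0 < P x x) :
    ∃ (e' : Fin n → N) (zb' : G.edgeSet → N), IsStandardBasis G e' zb' ∧
      Submodule.span ℝ (Set.range zb') = Submodule.span ℝ (Set.range zb) ∧
      ∀ i, ∀ m ∈ Submodule.span ℝ (Set.range zb), P m (e' i) = 0 := by
  choose p hp hpe using fun i => exists_mem_forall_bilin_eq hPpos
    (Submodule.span ℝ (Set.range zb)) (P (e i))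
  obtain ⟨zb', hb', hspan⟩ := hb.exists_of_span_sup_eq_top (fun i => e i - p i)
    (fun i j hij => by
      rw [sub_lie, hb.lie_eq_zero_of_mem_left (hp i), lie_sub,
        hb.lie_eq_zero_of_mem_right (hp j), hb.lie_eq_zero_of_not_adj hij]
      simp)
    (by
      rw [eq_top_iff, ← hb.span_e_sup_span_zb]
      refine sup_le ?_ le_sup_right
      rw [Submodule.span_le]
      rintro _ ⟨i, rfl⟩
      have h1 : e i - p i ∈ Submodule.span ℝ (Set.range fun i => e i - p i) :=
        Submodule.subset_span ⟨i, rfl⟩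
      have h2 := Submodule.add_mem_sup h1 (hp i)
      rwa [sub_add_cancel] at h2)
  refine ⟨_, zb', hb', hspan, fun i m hm => ?_⟩
  rw [map_sub, hPsym m, hPsym m, hpe i m hm, sub_self]

theorem bilin_dual_eq_zero [FiniteDimensional ℝ N] (hb : IsStandardBasis G e zb)
    (hPsym : ∀ x y : N, P x y = P y x) (hPpos : ∀ x : N, x ≠ 0 → 0 < P x x)
    (hGO : IsGeodesicOrbit P (Submodule.span ℝ (Set.range zb)))
    {f : Fin n → N} (hf : ∀ u x, P (f u) x = hb.coord u x)
    {i j k l : Fin n} (hij : G.Adj i j) (hkl : G.Adj k l) (hil : ¬ G.Adj i l) (hne : i ≠ l) :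
    P (f j) (f k) = 0 := by
  obtain ⟨φ, hφ⟩ := hb.exists_functional_of_adj hij
  obtain ⟨Z, hZ, hZφ⟩ := exists_mem_forall_bilin_eq hPpos
    (Submodule.span ℝ (Set.range zb)) φ
  obtain ⟨D, hD, hDskew, -, hDX⟩ := hGO (f k)
    (fun m hm => by rw [hPsym, hf, hb.coord_eq_zero_of_mem k hm]) Z hZ
  have h1 := hb.coord_derivation_eq_zero hD hkl hil hne
  rw [← hf, ← neg_eq_zero, ← hDskew, hDX, hZφ _ (hb.lie_mem _ _), hφ] at h1
  rw [hf]
  simpa [coord_e, hij.ne] using h1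

theorem adj_trans_of_isGeodesicOrbit [FiniteDimensional ℝ N] (hb : IsStandardBasis G e zb)
    (hPsym : ∀ x y : N, P x y = P y x) (hPpos : ∀ x : N, x ≠ 0 → 0 < P x x)
    (hGO : IsGeodesicOrbit P (Submodule.span ℝ (Set.range zb)))
    {i j k : Fin n} (hij : G.Adj i j) (hjk : G.Adj j k) (hik : i ≠ k) : G.Adj i k := by
  by_contra h
  choose f hf using fun u => exists_forall_bilin_eq hPpos (hb.coord u)
  have h0 := hb.bilin_dual_eq_zero hPsym hPpos hGO hf hij hjk h hik
  have hfj : f j = 0 := by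
    by_contra hne
    exact (hPpos _ hne).ne' h0
  have h1 := hf j (e j)
  simp [hfj, coord_e] at h1

theorem exists_orthonormal_of_isGeodesicOrbit [FiniteDimensional ℝ N]
    (hb : IsStandardBasis G e zb)
    (hPsym : ∀ x y : N, P x y = P y x) (hPpos : ∀ x : N, x ≠ 0 → 0 < P x x)
    (hGO : IsGeodesicOrbit P (Submodule.span ℝ (Set.range zb)))
    (he : ∀ i, ∀ m ∈ Submodule.span ℝ (Set.range zb), P m (e i) = 0) :
    ∃ (e' : Fin n → N) (zb' : G.edgeSet → N), IsStandardBasis G e' zb' ∧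
      Submodule.span ℝ (Set.range zb') = Submodule.span ℝ (Set.range zb) ∧
      (∀ i, ∀ m ∈ Submodule.span ℝ (Set.range zb), P m (e' i) = 0) ∧
      ∀ i j, P (e' i) (e' j) = if i = j then 1 else 0 := by
  classical
  have htrans : ∀ {i j k}, G.Adj i j → G.Adj j k → i ≠ k → G.Adj i k :=
    fun h1 h2 h3 => hb.adj_trans_of_isGeodesicOrbit hPsym hPpos hGO h1 h2 h3
  choose f hf using fun u => exists_forall_bilin_eq hPpos (hb.coord u)
  have hfz : ∀ u, ∀ m ∈ Submodule.span ℝ (Set.range zb), P m (f u) = 0 := fun u m hm => by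
    rw [hPsym, hf, hb.coord_eq_zero_of_mem u hm]
  let iso : Fin n → Prop := fun u => ∀ v, ¬ G.Adj u v
  let h : Fin n → N := fun u => if iso u then e u else f u
  let r : Fin n → Fin n → Prop := fun u v => u = v ∨ G.Adj u v ∨ (iso u ∧ iso v)
  have hr : Equivalence r := by
    refine ⟨fun u => Or.inl rfl, ?_, ?_⟩
    · rintro u v (h | h | h)
      · exact Or.inl h.symm
      · exact Or.inr (Or.inl h.symm)
      · exact Or.inr (Or.inr h.symm)
    · rintro u v w (rfl | h1 | h1) (rfl | h2 | h2)
      · exact Or.inl rfl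
      · exact Or.inr (Or.inl h2)
      · exact Or.inr (Or.inr h2)
      · exact Or.inr (Or.inl h1)
      · by_cases huw : u = w
        · exact Or.inl huw
        · exact Or.inr (Or.inl (htrans h1 h2 huw))
      · exact absurd h1.symm (h2.1 u)
      · exact Or.inr (Or.inr h1)
      · exact absurd h2 (h1.2 w)
      · exact Or.inr (Or.inr ⟨h1.1, h2.2⟩)
  have hhz : ∀ u, ∀ m ∈ Submodule.span ℝ (Set.range zb), P m (h u) = 0 := by
    intro u m hm
    by_cases hu : iso u
    · simp only [h, if_pos hu]; exact he u m hm
    · simp only [h, if_neg hu]; exact hfz u m hm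
  have horth : ∀ u v, ¬ r u v → P (h u) (h v) = 0 := by
    intro u v huv
    have hne : u ≠ v := fun h => huv (Or.inl h)
    have hadj : ¬ G.Adj u v := fun h => huv (Or.inr (Or.inl h))
    by_cases hu : iso u <;> by_cases hv : iso v
    · exact absurd (Or.inr (Or.inr ⟨hu, hv⟩)) huv
    · simp only [h, if_pos hu, if_neg hv]
      rw [hPsym, hf, coord_e, if_neg hne]
    · simp only [h, if_neg hu, if_pos hv]
      rw [hf, coord_e, if_neg hne.symm]
    · simp only [h, if_neg hu, if_neg hv]
      simp only [iso, not_forall, not_not] at hu hv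
      obtain ⟨i, hi⟩ := hu
      obtain ⟨l, hl⟩ := hv
      have hil : i ≠ l := by
        rintro rfl
        exact hadj (htrans hi hl.symm hne)
      refine hb.bilin_dual_eq_zero hPsym hPpos hGO hf hi.symm hl (fun hil' => ?_) hil
      have hul : u ≠ l := by rintro rfl; exact hadj hl.symm
      exact hadj (htrans (htrans hi hil' hul) hl.symm hne)
  have hli : LinearIndependent ℝ h := by
    rw [Fintype.linearIndependent_iff]
    intro c hc
    -- the isolated part and the remaining part of the combination are orthogonal
    have hx : ∑ u, (if iso u then c u else 0) • e u + ∑ u, (if iso u then 0 else c u) • f u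
        = 0 := by
      rw [← hc, ← Finset.sum_add_distrib]
      refine Finset.sum_congr rfl fun u _ => ?_
      by_cases hu : iso u <;> simp [h, hu]
    set x := ∑ u, (if iso u then c u else 0) • e u with hxdef
    set y := ∑ u, (if iso u then 0 else c u) • f u with hydef
    have hPe : ∀ v, P y (e v) = if iso v then 0 else c v := by
      intro v
      simp [hydef, hf, coord_e, -ite_smul]
    have hyx : P y x = 0 := by
      rw [hxdef, map_sum]
      refine Finset.sum_eq_zero fun v _ => ?_
      rw [map_smul, hPe]
      by_cases hv : iso v <;> simp [hv]
    have hyy : y = 0 := by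
      by_contra hne
      have h1 := hPpos y hne
      rw [eq_neg_of_add_eq_zero_left hx, map_neg, neg_eq_zero] at hyx
      exact h1.ne' hyx
    have hxx : x = 0 := by rwa [hyy, add_zero] at hx
    intro v
    by_cases hv : iso v
    · have h1 : hb.coord v x = c v := by simp [hxdef, coord_e, hv, -ite_smul]
      rw [← h1, hxx, map_zero]
    · have h1 := hPe v
      rw [hyy, if_neg hv] at h1
      simpa using h1.symm
  obtain ⟨g, hg, hgmem⟩ := exists_orthonormal_of_blocks hPsym hPpos hli hr horth
  have hgz : ∀ i, ∀ m ∈ Submodule.span ℝ (Set.range zb), P m (g i) = 0 := by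
    intro i m hm
    have hle : Submodule.span ℝ (h '' {u | r i u}) ≤ LinearMap.ker (P m) := by
      rw [Submodule.span_le]
      rintro _ ⟨u, -, rfl⟩
      exact hhz u m hm
    exact hle (hgmem i)
  have hcoord : ∀ u v i, G.Adj u v → ¬ r i u → hb.coord u (g i) = 0 := by
    intro u v i huv hiu
    have hle : Submodule.span ℝ (h '' {u | r i u}) ≤ LinearMap.ker (P (h u)) := by
      rw [Submodule.span_le]
      rintro _ ⟨w, hw, rfl⟩
      exact horth u w fun huw => hiu (hr.trans hw (hr.symm huw))
    have h1 : P (h u) (g i) = 0 := hle (hgmem i)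
    have hu : ¬ iso u := fun hu => hu v huv
    simp only [h, if_neg hu] at h1
    rwa [hf] at h1
  have h0 : ∀ i j, ¬ G.Adj i j → ⁅g i, g j⁆ = 0 := by
    intro i j hij
    by_cases hne : i = j
    · rw [hne, lie_self]
    refine hb.lie_eq_zero_of_coord fun u v huv => ?_
    have hruv : r u v := Or.inr (Or.inl huv)
    have hcls : ∀ k, r k u → k = u ∨ G.Adj k u := by
      rintro k (hk | hk | hk)
      · exact Or.inl hk
      · exact Or.inr hk
      · exact absurd huv (hk.2 v)
    by_cases hiu : r i u
    · by_cases hju : r j u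
      · rcases hcls i hiu with rfl | h1 <;> rcases hcls j hju with rfl | h2
        · exact absurd rfl hne
        · exact absurd h2.symm hij
        · exact absurd h1 hij
        · exact absurd (htrans h1 h2.symm hne) hij
      · rw [hcoord v u j huv.symm fun hjv => hju (hr.trans hjv (hr.symm hruv)),
          hcoord u v j huv hju, mul_zero, mul_zero]
    · rw [hcoord v u i huv.symm fun hiv => hiu (hr.trans hiv (hr.symm hruv)),
        hcoord u v i huv hiu, zero_mul, zero_mul]
  have hgli : LinearIndependent ℝ g := by
    rw [Fintype.linearIndependent_iff]
    intro c hc i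
    have h1 := congrArg (P (g i)) hc
    simpa [hg] using h1
  have hdisj : Disjoint (Submodule.span ℝ (Set.range g)) (Submodule.span ℝ (Set.range zb)) := by
    rw [Submodule.disjoint_def]
    intro x hxg hxz
    have hle : Submodule.span ℝ (Set.range g) ≤ LinearMap.ker (P x) := by
      rw [Submodule.span_le]
      rintro _ ⟨i, rfl⟩
      exact hgz i x hxz
    by_contra hne
    exact (hPpos x hne).ne' (hle hxg)
  have hzli : LinearIndependent ℝ zb := hb.2.2.2.1.comp Sum.inr Sum.inr_injective
  have : Fintype G.edgeSet := Fintype.ofFinite _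
  have htop := (hgli.sum_type hzli hdisj).span_eq_top_of_card_eq_finrank'
    (Module.finrank_eq_card_basis hb.basis).symm
  rw [Set.Sum.elim_range, Submodule.span_union] at htop
  obtain ⟨zb', hb', hspan⟩ := hb.exists_of_span_sup_eq_top g h0 htop
  exact ⟨g, zb', hb', hspan, hgz, hg⟩

end IsStandardBasis

theorem SimpleGraph.exists_maximal_matching_involution {n : ℕ} (G : SimpleGraph (Fin n))
    {i j : Fin n} (hij : G.Adj i j) :
    ∃ σ : Fin n → Fin n, (∀ u, σ (σ u) = u) ∧ (∀ u, σ u = u ∨ G.Adj u (σ u)) ∧ σ i = j ∧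
      ∀ u v, G.Adj u v → σ u = u → σ v = v → False := by
  classical
  let S : Finset (Fin n → Fin n) := Finset.univ.filter fun σ =>
    (∀ u, σ (σ u) = u) ∧ (∀ u, σ u = u ∨ G.Adj u (σ u)) ∧ σ i = j
  have hS : S.Nonempty := by
    refine ⟨Equiv.swap i j, ?_⟩
    simp only [S, Finset.mem_filter, Finset.mem_univ, true_and]
    refine ⟨fun u => Equiv.swap_apply_self _ _ _, fun u => ?_, Equiv.swap_apply_left i j⟩
    by_cases hi : u = i
    · subst hi; right; simpa using hij
    · by_cases hj : u = j
      · subst hj; right; simpa using hij.symm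
      · exact Or.inl (Equiv.swap_apply_of_ne_of_ne hi hj)
  obtain ⟨σ, hσ, hmax⟩ := S.exists_max_image
    (fun σ => (Finset.univ.filter fun w => σ w ≠ w).card) hS
  simp only [S, Finset.mem_filter, Finset.mem_univ, true_and] at hσ hmax
  obtain ⟨h1, h2, h3⟩ := hσ
  refine ⟨σ, h1, h2, h3, fun u v huv hu hv => ?_⟩
  have hne : u ≠ v := huv.ne
  have hσu : ∀ w, σ w = u → w = u := fun w hw => by rw [← h1 w, hw, hu]
  have hσv : ∀ w, σ w = v → w = v := fun w hw => by rw [← h1 w, hw, hv]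
  have hiu : i ≠ u := by rintro rfl; exact hij.ne (hu.symm.trans h3)
  have hiv : i ≠ v := by rintro rfl; exact hij.ne (hv.symm.trans h3)
  let τ : Fin n → Fin n := fun w => if w = u then v else if w = v then u else σ w
  have hτ := hmax τ ⟨fun w => by grind, fun w => by grind [SimpleGraph.Adj.symm], by
    simp [τ, hiu, hiv, h3]⟩
  have hlt : (Finset.univ.filter fun w => σ w ≠ w).card <
      (Finset.univ.filter fun w => τ w ≠ w).card := by
    apply Finset.card_lt_card
    rw [Finset.ssubset_iff_of_subset]
    · refine ⟨u, ?_, ?_⟩ <;> simp [τ, hu, hne.symm]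
    · intro w hw
      simp only [Finset.mem_filter, Finset.mem_univ, true_and] at hw ⊢
      grind
  omega

/-- The weights of the involution `σ` given by `t`, with opposite signs at the ends of an orbit. -/
noncomputable def orbitWeight {n : ℕ} (σ : Fin n → Fin n) (t : Fin n → ℝ) (u : Fin n) : ℝ :=
  if u < σ u then t u else if σ u < u then - t (σ u) else 0

theorem orbitWeight_apply_involution {n : ℕ} {σ : Fin n → Fin n} (hσ : ∀ u, σ (σ u) = u)
    (t : Fin n → ℝ) (u : Fin n) : orbitWeight σ t (σ u) = - orbitWeight σ t u := by
  simp only [orbitWeight, hσ]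
  rcases lt_trichotomy u (σ u) with h | h | h
  · simp [h, h.not_gt]
  · simp [← h]
  · simp [h, h.not_gt]

theorem orbitWeight_eq_zero {n : ℕ} {σ : Fin n → Fin n} (t : Fin n → ℝ) {u : Fin n}
    (h : σ u = u) : orbitWeight σ t u = 0 := by
  simp [orbitWeight, h]

theorem orbitWeight_sq_ne {n : ℕ} {σ : Fin n → Fin n} (hσ : ∀ u, σ (σ u) = u)
    {t : Fin n → ℝ} (ht : ∀ u, 0 < t u) (hinj : Function.Injective t) {u v : Fin n}
    (hne : u ≠ v) (hσne : v ≠ σ u) (hfix : σ u = u → σ v = v → False) :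
    orbitWeight σ t u ^ 2 ≠ orbitWeight σ t v ^ 2 := by
  have hsq : ∀ a b, t a ^ 2 = t b ^ 2 → a = b := fun a b h =>
    hinj ((sq_eq_sq₀ (ht a).le (ht b).le).1 h)
  have hpos : ∀ a, t a ^ 2 ≠ 0 := fun a => pow_ne_zero 2 (ht a).ne'
  have huσ : u ≠ σ v := fun h => hσne (by rw [h, hσ])
  intro h
  simp only [orbitWeight] at h
  split_ifs at h with h1 h2 h3 h4 h5 h6 h7 h8
  · exact hne (hsq _ _ h)
  · exact huσ (hsq _ _ (by simpa using h))
  · exact hpos u (by simpa using h)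
  · exact hσne (hsq _ _ (by simpa using h.symm))
  · exact hne (by rw [← hσ u, hsq (σ u) (σ v) (by simpa using h), hσ])
  · exact hpos (σ u) (by simpa using h)
  · exact hpos v (by simpa using h.symm)
  · exact hpos (σ v) (by simpa using h.symm)
  · exact hfix (le_antisymm (not_lt.1 h1) (not_lt.1 h4)) (le_antisymm (not_lt.1 h7) (not_lt.1 h8))

namespace IsStandardBasis

variable {n : ℕ} {G : SimpleGraph (Fin n)} {N : Type*} [LieRing N] [LieAlgebra ℝ N]
  {e : Fin n → N} {zb : G.edgeSet → N} {P : LinearMap.BilinForm ℝ N}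

theorem coord_eq_bilin (hb : IsStandardBasis G e zb)
    (he : ∀ i, ∀ m ∈ Submodule.span ℝ (Set.range zb), P m (e i) = 0)
    (hort : ∀ i j, P (e i) (e j) = if i = j then 1 else 0) (u : Fin n) (x : N) :
    hb.coord u x = P x (e u) := by
  have h := he u _ (hb.sub_sum_coord_mem x)
  simp only [map_sub, LinearMap.sub_apply, map_sum, LinearMap.sum_apply, map_smul,
    LinearMap.smul_apply, hort, smul_eq_mul, mul_ite, mul_one, mul_zero, Finset.sum_ite_eq',
    Finset.mem_univ, if_true] at h
  linarith

theorem eq_of_bilin_lie_eq (hb : IsStandardBasis G e zb) (hPpos : ∀ x : N, x ≠ 0 → 0 < P x x)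
    {Z W : N} (hZ : Z ∈ Submodule.span ℝ (Set.range zb))
    (hW : W ∈ Submodule.span ℝ (Set.range zb)) (h : ∀ u v, P Z ⁅e u, e v⁆ = P W ⁅e u, e v⁆) :
    Z = W := by
  refine eq_of_bilin_eq_of_mem hPpos hZ hW fun x hx => ?_
  rw [hb.span_zb] at hx
  induction hx using Submodule.span_induction with
  | mem x hx => obtain ⟨x, y, rfl⟩ := hx; simp [hb.lie_eq_sum x y, h]
  | zero => simp
  | add x y _ _ h1 h2 => simp [h1, h2]
  | smul c x _ h1 => simp [h1]

theorem eq_half_sum_bilin_lie_smul (hb : IsStandardBasis G e zb)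
    (hPpos : ∀ x : N, x ≠ 0 → 0 < P x x) {E : Fin n → Fin n → N}
    (hE : ∀ i j, G.Adj i j → E i j ∈ Submodule.span ℝ (Set.range zb))
    (hEk : ∀ i j, G.Adj i j → ∀ u v, P (E i j) ⁅e u, e v⁆ =
      (if u = i ∧ v = j then 1 else 0) - (if u = j ∧ v = i then 1 else 0))
    {Z : N} (hZ : Z ∈ Submodule.span ℝ (Set.range zb)) :
    Z = (1 / 2 : ℝ) • ∑ i, ∑ j, P Z ⁅e i, e j⁆ • E i j := by
  have hmem : (1 / 2 : ℝ) • ∑ i, ∑ j, P Z ⁅e i, e j⁆ • E i j ∈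
      Submodule.span ℝ (Set.range zb) := by
    refine Submodule.smul_mem _ _ (Submodule.sum_mem _ fun i _ => Submodule.sum_mem _ fun j _ => ?_)
    by_cases hij : G.Adj i j
    · exact Submodule.smul_mem _ _ (hE i j hij)
    · rw [hb.lie_eq_zero_of_not_adj hij, map_zero, zero_smul]
      exact Submodule.zero_mem _
  refine hb.eq_of_bilin_lie_eq hPpos hZ hmem fun u v => ?_
  have hterm : ∀ i j, P Z ⁅e i, e j⁆ * P (E i j) ⁅e u, e v⁆ =
      P Z ⁅e i, e j⁆ *
        ((if u = i ∧ v = j then 1 else 0) - (if u = j ∧ v = i then 1 else 0)) := by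
    intro i j
    by_cases hij : G.Adj i j
    · rw [hEk i j hij]
    · rw [hb.lie_eq_zero_of_not_adj hij, map_zero, zero_mul, zero_mul]
  simp only [map_smul, map_sum, LinearMap.smul_apply, LinearMap.sum_apply, smul_eq_mul, hterm]
  simp [mul_sub, ite_and, Finset.sum_sub_distrib]
  rw [← lie_skew (e v) (e u), map_neg]
  ring

theorem exists_bilin_lie_eq [FiniteDimensional ℝ N] (hb : IsStandardBasis G e zb)
    (hPpos : ∀ x : N, x ≠ 0 → 0 < P x x) (k : Fin n → Fin n → ℝ)
    (hskew : ∀ i j, k i j = - k j i) (hsupp : ∀ i j, ¬ G.Adj i j → k i j = 0) :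
    ∃ Z ∈ Submodule.span ℝ (Set.range zb), ∀ u v, P Z ⁅e u, e v⁆ = k u v := by
  obtain ⟨φ, hφ⟩ := hb.exists_functional k hskew hsupp
  obtain ⟨Z, hZ, hZφ⟩ := exists_mem_forall_bilin_eq hPpos
    (Submodule.span ℝ (Set.range zb)) φ
  refine ⟨Z, hZ, fun u v => ?_⟩
  rw [hZφ _ (hb.lie_mem _ _), hφ]
  simp [coord_e]

/-- The vectors `Z` for which some skew-symmetric derivation induces `J_Z` modulo the part of `𝔞`
spanned by the isolated vertices. -/
def skewDerivationSpace (_hb : IsStandardBasis G e zb) (P : LinearMap.BilinForm ℝ N) :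
    Submodule ℝ N where
  carrier := {Z | ∃ D : N →ₗ[ℝ] N, (∀ x y : N, D ⁅x, y⁆ = ⁅D x, y⁆ + ⁅x, D y⁆) ∧
    (∀ x y : N, P (D x) y = - P x (D y)) ∧
    ∀ u v w, G.Adj v w → P (D (e u)) (e v) = P Z ⁅e u, e v⁆}
  add_mem' := by
    rintro Z W ⟨D, h1, h2, h3⟩ ⟨D', h1', h2', h3'⟩
    refine ⟨D + D', fun x y => ?_, fun x y => ?_, fun u v w h => ?_⟩
    · simp only [LinearMap.add_apply, h1, h1', add_lie, lie_add]; abel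
    · simp only [LinearMap.add_apply, map_add, h2, h2']; ring
    · simp only [LinearMap.add_apply, map_add, h3 u v w h, h3' u v w h]
  zero_mem' := ⟨0, by simp, by simp, by simp⟩
  smul_mem' := by
    rintro c Z ⟨D, h1, h2, h3⟩
    refine ⟨c • D, fun x y => ?_, fun x y => ?_, fun u v w h => ?_⟩
    · simp only [LinearMap.smul_apply, h1, smul_lie, lie_smul, smul_add]
    · simp only [LinearMap.smul_apply, map_smul, h2, smul_neg]
    · simp only [LinearMap.smul_apply, map_smul, h3 u v w h]

theorem mem_skewDerivationSpace_of_regular (hb : IsStandardBasis G e zb)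
    (hPsym : ∀ x y : N, P x y = P y x)
    (htrans : ∀ {i j k}, G.Adj i j → G.Adj j k → i ≠ k → G.Adj i k)
    (hGO : IsGeodesicOrbit P (Submodule.span ℝ (Set.range zb)))
    (he : ∀ i, ∀ m ∈ Submodule.span ℝ (Set.range zb), P m (e i) = 0)
    (hort : ∀ i j, P (e i) (e j) = if i = j then 1 else 0)
    {σ : Fin n → Fin n} (hσ : ∀ u, σ (σ u) = u) {κ : Fin n → ℝ} (hκ : ∀ u, κ (σ u) = - κ u)
    (hreg : ∀ u v, G.Adj u v → v ≠ σ u → κ u ^ 2 ≠ κ v ^ 2)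
    {Z : N} (hZ : Z ∈ Submodule.span ℝ (Set.range zb))
    (hZκ : ∀ u v, P Z ⁅e u, e v⁆ = if v = σ u then κ u else 0) :
    Z ∈ hb.skewDerivationSpace P := by
  classical
  obtain ⟨D, hD, hDskew, hDZ, hDX⟩ := hGO (∑ u, e u)
    (fun m hm => by rw [map_sum]; exact Finset.sum_eq_zero fun u _ => he u m hm) Z hZ
  refine ⟨D, hD, hDskew, ?_⟩
  set A : Fin n → Fin n → ℝ := fun u v => P (D (e u)) (e v) with hA
  have hAskew : ∀ u v, A u v = - A v u := fun u v => by
    simp only [hA]; rw [hDskew, hPsym]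
  have hcoord := hb.coord_eq_bilin he hort
  have hleft : ∀ u v, P Z ⁅D (e u), e v⁆ = - (A u (σ v) * κ v) := by
    intro u v
    have hiff : ∀ w, (v = σ w) = (w = σ v) := fun w => by
      apply propext; constructor <;> rintro rfl <;> rw [hσ]
    rw [hb.lie_eq_sum, map_sum]
    simp only [map_sum, map_smul, coord_e, hcoord (_) (D (e u)), hZκ, smul_eq_mul, mul_ite,
      ite_mul, mul_one, mul_zero, zero_mul, Finset.mem_univ, if_true, hiff,
      Finset.sum_ite_eq']
    rw [hκ]
    simp [hA]
  have hcomm : ∀ u v, A u (σ v) * κ v = - (A (σ u) v * κ u) := by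
    intro u v
    have h1 : P Z (D ⁅e u, e v⁆) = 0 := by
      rw [← neg_eq_zero, ← hDskew, hDZ, map_zero, LinearMap.zero_apply]
    rw [hD, map_add, hleft, ← lie_skew, map_neg, hleft, hAskew v] at h1
    linarith
  have hsq : ∀ u v, A u v * (κ u ^ 2 - κ v ^ 2) = 0 := by
    intro u v
    have h1 := hcomm u (σ v)
    have h2 := hcomm (σ u) v
    rw [hσ, hκ] at h1 h2
    linear_combination (-κ u) * h2 + (κ v) * h1
  have hzero : ∀ u v w, G.Adj v w → v ≠ σ u → A u v = 0 := by
    intro u v w hvw hne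
    by_cases huv : u = v
    · subst huv
      have := hAskew u u
      linarith
    by_cases hadj : G.Adj u v
    · exact (mul_eq_zero.1 (hsq u v)).resolve_right (sub_ne_zero.2 (hreg u v hadj hne))
    · have huw : u ≠ w := by rintro rfl; exact hadj hvw.symm
      have := hb.coord_derivation_eq_zero hD hvw
        (fun h => hadj (htrans h hvw.symm huv)) huw
      rwa [hcoord] at this
  intro u v w hvw
  rw [hZκ]
  split_ifs with hv
  · have hiff : ∀ x, x ≠ u → v ≠ σ x := by
      rintro x hx rfl
      exact hx (by rw [← hσ x, hv, hσ])
    have h1 := hDX (e v)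
    simp only [map_sum, LinearMap.sum_apply, sum_lie, hZκ] at h1
    rw [Finset.sum_eq_single u (fun x _ hx => hzero x v w hvw (hiff x hx)) (by simp),
      Finset.sum_eq_single u (fun x _ hx => if_neg (hiff x hx)) (by simp), if_pos hv] at h1
    exact h1
  · exact hzero u v w hvw hv

theorem le_skewDerivationSpace [FiniteDimensional ℝ N] (hb : IsStandardBasis G e zb)
    (hPsym : ∀ x y : N, P x y = P y x) (hPpos : ∀ x : N, x ≠ 0 → 0 < P x x)
    (htrans : ∀ {i j k}, G.Adj i j → G.Adj j k → i ≠ k → G.Adj i k)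
    (hGO : IsGeodesicOrbit P (Submodule.span ℝ (Set.range zb)))
    (he : ∀ i, ∀ m ∈ Submodule.span ℝ (Set.range zb), P m (e i) = 0)
    (hort : ∀ i j, P (e i) (e j) = if i = j then 1 else 0) :
    Submodule.span ℝ (Set.range zb) ≤ hb.skewDerivationSpace P := by
  classical
  have hlt : ∀ i j, i < j → G.Adj i j →
      ∃ Z ∈ Submodule.span ℝ (Set.range zb) ⊓ hb.skewDerivationSpace P,
      ∀ u v, P Z ⁅e u, e v⁆ =
        (if u = i ∧ v = j then 1 else 0) - (if u = j ∧ v = i then 1 else 0) := by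
    intro i j hij hadj
    obtain ⟨σ, hσ, hσadj, hσij, hσfix⟩ := G.exists_maximal_matching_involution hadj
    have hσji : σ j = i := by rw [← hσij, hσ]
    have hex : ∀ t : Fin n → ℝ, (∀ u, 0 < t u) → Function.Injective t →
        ∃ Z ∈ Submodule.span ℝ (Set.range zb) ⊓ hb.skewDerivationSpace P,
          ∀ u v, P Z ⁅e u, e v⁆ = if v = σ u then orbitWeight σ t u else 0 := by
      intro t ht hinj
      have hκ := orbitWeight_apply_involution hσ t
      obtain ⟨Z, hZ, hZκ⟩ := hb.exists_bilin_lie_eq hPpos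
        (fun u v => if v = σ u then orbitWeight σ t u else 0)
        (fun u v => by
          by_cases h : v = σ u
          · rw [if_pos h, if_pos (by rw [h, hσ]), h, hκ, neg_neg]
          · rw [if_neg h, if_neg (by rintro rfl; exact h (hσ v).symm), neg_zero])
        (fun u v huv => by
          split_ifs with h
          · subst h
            exact orbitWeight_eq_zero t ((hσadj u).resolve_right huv)
          · rfl)
      exact ⟨Z, ⟨hZ, hb.mem_skewDerivationSpace_of_regular hPsym htrans hGO he hort hσ hκ
        (fun u v huv hne => orbitWeight_sq_ne hσ ht hinj huv.ne hne (hσfix u v huv)) hZ hZκ⟩, hZκ⟩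
    obtain ⟨Z, hZ, hZκ⟩ := hex (fun u => (u : ℝ) + 1) (fun u => by positivity)
      (fun u v h => by simpa [Fin.ext_iff] using h)
    obtain ⟨W, hW, hWκ⟩ := hex (Function.update (fun u => (u : ℝ) + 1) i ((n : ℝ) + 1))
      (fun u => by
        by_cases h : u = i
        · subst h; simp; positivity
        · simp [h]; positivity)
      (fun u v h => by
        by_cases h1 : u = i <;> by_cases h2 : v = i
        · rw [h1, h2]
        · simp [h1, h2] at h; omega
        · simp [h1, h2] at h; omega
        · simpa [h1, h2, Fin.ext_iff] using h)
    have hi : (i : ℝ) < n := by exact_mod_cast i.2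
    have hc : (i : ℝ) - n ≠ 0 := by linarith
    refine ⟨((i : ℝ) - n)⁻¹ • (Z - W), Submodule.smul_mem _ _ (Submodule.sub_mem _ hZ hW),
      fun u v => ?_⟩
    rw [map_smul, map_sub, LinearMap.smul_apply, LinearMap.sub_apply, hZκ, hWκ, smul_eq_mul,
      inv_mul_eq_iff_eq_mul₀ hc]
    by_cases hui : u = i
    · subst hui
      rw [hσij]
      by_cases hv : v = j
      · simp [orbitWeight, hσij, hij, hv, hij.ne]
      · simp [hv, hij.ne]
    by_cases huj : u = j
    · subst huj
      rw [hσji]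
      by_cases hv : v = i
      · simp [orbitWeight, hσji, hij, hv, hij.ne', hij.not_gt]
        ring
      · simp [hv, hij.ne']
    · have hσu : σ u ≠ i := by rintro h; exact huj (by rw [← hσ u, h, hσij])
      simp [orbitWeight, hui, huj, hσu]
  have hE : ∀ i j, G.Adj i j →
      ∃ Z ∈ Submodule.span ℝ (Set.range zb) ⊓ hb.skewDerivationSpace P,
      ∀ u v, P Z ⁅e u, e v⁆ =
        (if u = i ∧ v = j then 1 else 0) - (if u = j ∧ v = i then 1 else 0) := by
    intro i j hadj
    rcases lt_or_gt_of_ne hadj.ne with hij | hij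
    · exact hlt i j hij hadj
    · obtain ⟨Z, hZ, h⟩ := hlt j i hij hadj.symm
      refine ⟨-Z, Submodule.neg_mem _ hZ, fun u v => ?_⟩
      rw [map_neg, LinearMap.neg_apply, h, neg_sub]
  choose! E hE hEk using hE
  intro Z hZ
  rw [hb.eq_half_sum_bilin_lie_smul hPpos (fun i j hij => (hE i j hij).1) hEk hZ]
  refine Submodule.smul_mem _ _ (Submodule.sum_mem _ fun i _ => Submodule.sum_mem _ fun j _ => ?_)
  by_cases hij : G.Adj i j
  · exact Submodule.smul_mem _ _ (hE i j hij).2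
  · rw [hb.lie_eq_zero_of_not_adj hij, map_zero, zero_smul]
    exact Submodule.zero_mem _

end IsStandardBasis

namespace IsStandardBasis

variable {n : ℕ} {G : SimpleGraph (Fin n)} {N : Type*} [LieRing N] [LieAlgebra ℝ N]
  {e : Fin n → N} {zb : G.edgeSet → N} {P : LinearMap.BilinForm ℝ N}

theorem isCompl_span (hb : IsStandardBasis G e zb) :
    IsCompl (Submodule.span ℝ (Set.range e)) (Submodule.span ℝ (Set.range zb)) := by
  refine ⟨Submodule.disjoint_def.2 fun x hx hx' => ?_, codisjoint_iff.2 hb.span_e_sup_span_zb⟩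
  have h : ∀ i, hb.coord i x = 0 := fun i => hb.coord_eq_zero_of_mem i hx'
  have hsum : ∀ x ∈ Submodule.span ℝ (Set.range e), x = ∑ i, hb.coord i x • e i := by
    intro x hx
    induction hx using Submodule.span_induction with
    | mem x hx => obtain ⟨j, rfl⟩ := hx; simp [hb.coord_e]
    | zero => simp
    | add x y _ _ h1 h2 => simp only [map_add, add_smul, Finset.sum_add_distrib, ← h1, ← h2]
    | smul c x _ h1 =>
      simp only [map_smul, smul_eq_mul, mul_smul, ← Finset.smul_sum, ← h1]
  rw [hsum x hx]
  simp [h]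

theorem span_e_eq_orthogonal (hb : IsStandardBasis G e zb)
    (hPpos : ∀ x : N, x ≠ 0 → 0 < P x x)
    (he : ∀ i, ∀ m ∈ Submodule.span ℝ (Set.range zb), P m (e i) = 0) :
    Submodule.span ℝ (Set.range e) = P.orthogonal (Submodule.span ℝ (Set.range zb)) := by
  have hle : Submodule.span ℝ (Set.range e) ≤
      P.orthogonal (Submodule.span ℝ (Set.range zb)) := by
    rw [Submodule.span_le]
    rintro _ ⟨i, rfl⟩
    exact fun m hm => he i m hm
  refine le_antisymm hle fun x hx => ?_
  obtain ⟨y, hy, m, hm, rfl⟩ := Submodule.mem_sup.1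
    (hb.span_e_sup_span_zb ▸ Submodule.mem_top : x ∈ _)
  have h1 : P m (y + m) = 0 := hx m hm
  have h2 : P m y = 0 := hle hy m hm
  have : m = 0 := by
    by_contra h
    have := hPpos m h
    rw [map_add, h2] at h1
    linarith
  rw [this, add_zero]
  exact hy

variable {a z : Submodule ℝ N}

theorem ext_bilin_lie (hb : IsStandardBasis G e zb) (hPpos : ∀ x : N, x ≠ 0 → 0 < P x x)
    (hz : z = Submodule.span ℝ (Set.range zb)) (haz : a ⊔ z = ⊤) {Z W : z}
    (h : ∀ X Y : a, P (Z : N) ⁅(X : N), (Y : N)⁆ = P (W : N) ⁅(X : N), (Y : N)⁆) : Z = W := by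
  subst hz
  refine Subtype.ext (eq_of_bilin_eq_of_mem hPpos Z.2 W.2 fun x hx => ?_)
  rw [hb.span_zb] at hx
  induction hx using Submodule.span_induction with
  | mem x hx =>
    obtain ⟨x, y, rfl⟩ := hx
    obtain ⟨x, hx, m, hm, rfl⟩ := Submodule.mem_sup.1 (haz ▸ Submodule.mem_top : x ∈ _)
    obtain ⟨y, hy, m', hm', rfl⟩ := Submodule.mem_sup.1 (haz ▸ Submodule.mem_top : y ∈ _)
    simp only [add_lie, lie_add, hb.lie_eq_zero_of_mem_left hm, hb.lie_eq_zero_of_mem_right hm',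
      add_zero]
    exact h ⟨x, hx⟩ ⟨y, hy⟩
  | zero => simp
  | add x y _ _ h1 h2 => simp [h1, h2]
  | smul c x _ h1 => simp [h1]

end IsStandardBasis

section NaturallyReductive

variable {n : ℕ} {G : SimpleGraph (Fin n)} {N : Type*} [LieRing N] [LieAlgebra ℝ N]
  {e : Fin n → N} {zb : G.edgeSet → N} {P : LinearMap.BilinForm ℝ N} {a z : Submodule ℝ N}
  {J : z →ₗ[ℝ] (a →ₗ[ℝ] a)}

theorem bilin_apply_eq_neg (hPsym : ∀ x y : N, P x y = P y x)
    (hJ : ∀ (Z : z) (X Y : a), P (J Z X : N) (Y : N) = P (Z : N) ⁅(X : N), (Y : N)⁆)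
    (Z : z) (X Y : a) : P (J Z X : N) (Y : N) = - P (X : N) (J Z Y : N) := by
  rw [hJ, hPsym (X : N), hJ, ← lie_skew, map_neg]

theorem isGeodesicOrbit_of_exists_derivation (hPsym : ∀ x y : N, P x y = P y x)
    (hcenter : ∀ (x : N), ∀ m ∈ z, ⁅x, m⁆ = 0) (haz : a ⊔ z = ⊤) (ha : a = P.orthogonal z)
    (hJ : ∀ (Z : z) (X Y : a), P (J Z X : N) (Y : N) = P (Z : N) ⁅(X : N), (Y : N)⁆)
    (h : ∀ (X : a) (Z : z), ∃ D : N →ₗ[ℝ] N,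
        (∀ x y : N, D ⁅x, y⁆ = ⁅D x, y⁆ + ⁅x, D y⁆) ∧
        (∀ x y : N, P (D x) y = - P x (D y)) ∧
        D (Z : N) = 0 ∧ D (X : N) = (J Z X : N)) : IsGeodesicOrbit P z := by
  intro X hX Z hZ
  have hXa : X ∈ a := by rw [ha]; exact fun m hm => hX m hm
  obtain ⟨D, h1, h2, h3, h4⟩ := h ⟨X, hXa⟩ ⟨Z, hZ⟩
  refine ⟨D, h1, h2, h3, fun Y => ?_⟩
  obtain ⟨y, hy, m, hm, rfl⟩ := Submodule.mem_sup.1 (haz ▸ Submodule.mem_top : Y ∈ _)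
  have h0 : P (J ⟨Z, hZ⟩ ⟨X, hXa⟩ : N) m = 0 := by
    rw [hPsym]
    exact ha.le (J ⟨Z, hZ⟩ ⟨X, hXa⟩).2 m hm
  have h5 := hJ ⟨Z, hZ⟩ ⟨X, hXa⟩ ⟨y, hy⟩
  simp only at h4 h5
  rw [h4, map_add, h0, add_zero, lie_add, hcenter X m hm, add_zero, h5]

theorem exists_skew_derivation_of_naturallyReductive (hPsym : ∀ x y : N, P x y = P y x)
    (hPpos : ∀ x : N, x ≠ 0 → 0 < P x x) (hb : IsStandardBasis G e zb)
    (hz : z = Submodule.span ℝ (Set.range zb)) (haz : IsCompl a z) (ha : a = P.orthogonal z)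
    (hJ : ∀ (Z : z) (X Y : a), P (J Z X : N) (Y : N) = P (Z : N) ⁅(X : N), (Y : N)⁆)
    (hT : ∀ Z : z, ∃ T : z →ₗ[ℝ] z,
      (∀ W : z, J (T W) = (J Z) ∘ₗ (J W) - (J W) ∘ₗ (J Z)) ∧
      (∀ W W' : z, P (T W : N) (W' : N) = - P (W : N) (T W' : N)))
    (X : a) (Z : z) : ∃ D : N →ₗ[ℝ] N,
        (∀ x y : N, D ⁅x, y⁆ = ⁅D x, y⁆ + ⁅x, D y⁆) ∧
        (∀ x y : N, P (D x) y = - P x (D y)) ∧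
        D (Z : N) = 0 ∧ D (X : N) = (J Z X : N) := by
  obtain ⟨T, hTJ, hTskew⟩ := hT Z
  have hsup : a ⊔ z = ⊤ := haz.sup_eq_top
  have hdec : ∀ x : N, ∃ (y : a) (m : z), x = y + m := fun x => by
    obtain ⟨y, hy, m, hm, rfl⟩ := Submodule.mem_sup.1 (hsup ▸ Submodule.mem_top : x ∈ _)
    exact ⟨⟨y, hy⟩, ⟨m, hm⟩, rfl⟩
  have hort : ∀ (y : a) (m : z), P (m : N) (y : N) = 0 := fun y m =>
    ha.le y.2 m m.2
  have hort' : ∀ (y : a) (m : z), P (y : N) (m : N) = 0 := fun y m => by rw [hPsym, hort]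
  have hl : ∀ (m : z) (x : N), ⁅(m : N), x⁆ = 0 := fun m x =>
    hb.lie_eq_zero_of_mem_left (hz.le m.2) x
  have hr : ∀ (x : N) (m : z), ⁅x, (m : N)⁆ = 0 := fun x m =>
    hb.lie_eq_zero_of_mem_right (hz.le m.2) x
  have hmem : ∀ x y : N, ⁅x, y⁆ ∈ z := fun x y => hz ▸ hb.lie_mem x y
  let D : N →ₗ[ℝ] N := LinearMap.ofIsCompl haz (a.subtype ∘ₗ J Z) (z.subtype ∘ₗ T)
  have hDa : ∀ y : a, D y = (J Z y : N) := fun y => LinearMap.ofIsCompl_apply_left haz y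
  have hDz : ∀ m : z, D m = (T m : N) := fun m => LinearMap.ofIsCompl_apply_right haz m
  have hTZ : T Z = 0 := by
    refine hb.ext_bilin_lie hPpos hz hsup fun X Y => ?_
    rw [← hJ, ← hJ, hTJ, sub_self, map_zero]
  refine ⟨D, fun x y => ?_, fun x y => ?_, by rw [hDz, hTZ]; rfl, hDa X⟩
  · obtain ⟨x, m, rfl⟩ := hdec x
    obtain ⟨y, m', rfl⟩ := hdec y
    simp only [map_add, hDa, hDz, add_lie, lie_add, hl, hr, add_zero]
    have h1 : D ⁅(x : N), (y : N)⁆ = T ⟨⁅(x : N), (y : N)⁆, hmem _ _⟩ := hDz ⟨_, hmem _ _⟩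
    rw [h1]
    refine eq_of_bilin_eq_of_mem hPpos (Subtype.prop _) (z.add_mem (hmem _ _) (hmem _ _))
      fun W hW => ?_
    have h2 := hJ (T ⟨W, hW⟩) x y
    rw [hTJ, LinearMap.sub_apply, LinearMap.comp_apply, LinearMap.comp_apply, Submodule.coe_sub,
      map_sub, LinearMap.sub_apply, bilin_apply_eq_neg hPsym hJ, hJ, hJ] at h2
    have h3 := hTskew ⟨⁅(x : N), (y : N)⁆, hmem _ _⟩ ⟨W, hW⟩
    simp only at h2 h3
    rw [h3, hPsym, ← h2, map_add, LinearMap.add_apply, hPsym _ W, hPsym _ W]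
    ring
  · obtain ⟨x, m, rfl⟩ := hdec x
    obtain ⟨y, m', rfl⟩ := hdec y
    simp only [map_add, hDa, hDz, LinearMap.add_apply, hort, hort', add_zero, zero_add,
      bilin_apply_eq_neg hPsym hJ, hTskew]
    ring

theorem IsStandardBasis.exists_skew_ad_of_isGeodesicOrbit [FiniteDimensional ℝ N]
    (hb : IsStandardBasis G e zb)
    (hPsym : ∀ x y : N, P x y = P y x) (hPpos : ∀ x : N, x ≠ 0 → 0 < P x x)
    (hGO : IsGeodesicOrbit P z)
    (hz : z = Submodule.span ℝ (Set.range zb)) (ha : a = Submodule.span ℝ (Set.range e))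
    (he : ∀ i, ∀ m ∈ z, P m (e i) = 0)
    (hort : ∀ i j, P (e i) (e j) = if i = j then 1 else 0)
    (hJ : ∀ (Z : z) (X Y : a), P (J Z X : N) (Y : N) = P (Z : N) ⁅(X : N), (Y : N)⁆) (Z : z) :
    ∃ T : z →ₗ[ℝ] z,
      (∀ W : z, J (T W) = (J Z) ∘ₗ (J W) - (J W) ∘ₗ (J Z)) ∧
      (∀ W W' : z, P (T W : N) (W' : N) = - P (W : N) (T W' : N)) := by
  subst hz
  obtain ⟨D, hD, hDskew, hDZ⟩ := hb.le_skewDerivationSpace hPsym hPpos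
    (fun h1 h2 h3 => adj_trans_of_isGeodesicOrbit hb hPsym hPpos hGO h1 h2 h3) hGO he hort Z.2
  have hcoord := hb.coord_eq_bilin he hort
  have hDz : ∀ m ∈ Submodule.span ℝ (Set.range zb), D m ∈ Submodule.span ℝ (Set.range zb) := by
    intro m hm
    have hm' := hm
    rw [hb.span_zb] at hm'
    induction hm' using Submodule.span_induction with
    | mem x hx =>
      obtain ⟨x, y, rfl⟩ := hx
      rw [hD]
      exact Submodule.add_mem _ (hb.lie_mem _ _) (hb.lie_mem _ _)
    | zero => simp
    | add x y h h' h1 h2 =>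
      rw [map_add]
      exact Submodule.add_mem _ (h1 (hb.span_zb ▸ h)) (h2 (hb.span_zb ▸ h'))
    | smul c x h h1 => rw [map_smul]; exact Submodule.smul_mem _ _ (h1 (hb.span_zb ▸ h))
  have hDX : ∀ (X : a) v w, G.Adj v w → P (D X) (e v) = P (Z : N) ⁅(X : N), e v⁆ := by
    rintro ⟨X, hX⟩ v w hvw
    have hX' := hX
    rw [ha] at hX'
    simp only
    clear hX
    induction hX' using Submodule.span_induction with
    | mem x hx => obtain ⟨u, rfl⟩ := hx; exact hDZ u v w hvw
    | zero => simp
    | add x y _ _ h1 h2 => rw [map_add, map_add, LinearMap.add_apply, add_lie, map_add, h1, h2]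
    | smul c x _ h1 => rw [map_smul, map_smul, LinearMap.smul_apply, smul_lie, map_smul, h1]
  have hea : ∀ v, e v ∈ a := fun v => ha ▸ Submodule.subset_span ⟨v, rfl⟩
  have hlie : ∀ X Y : a, ⁅D X, (Y : N)⁆ = ⁅(J Z X : N), (Y : N)⁆ := by
    intro X Y
    rw [← sub_eq_zero, ← sub_lie]
    have h0 : ∀ u v, G.Adj u v → hb.coord u (D X - J Z X) = 0 := by
      intro u v huv
      rw [hcoord, map_sub, LinearMap.sub_apply, hDX X u v huv, hJ Z X ⟨e u, hea u⟩, sub_self]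
    refine hb.lie_eq_zero_of_coord fun u v huv => ?_
    rw [h0 u v huv, h0 v u huv.symm, zero_mul, zero_mul]
  refine ⟨D.restrict hDz, fun W => ?_, fun W W' => hDskew W W'⟩
  ext X
  refine eq_of_bilin_eq_of_mem hPpos (z := a) (Subtype.prop _) (Subtype.prop _) fun Y hY => ?_
  lift Y to a using hY
  rw [hJ, LinearMap.sub_apply, LinearMap.comp_apply, LinearMap.comp_apply, Submodule.coe_sub,
    map_sub, LinearMap.sub_apply, bilin_apply_eq_neg hPsym hJ Z, hJ, hJ]
  have h1 : D ⁅(X : N), (Y : N)⁆ = ⁅(J Z X : N), (Y : N)⁆ + ⁅(X : N), (J Z Y : N)⁆ := by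
    rw [hD, hlie, ← lie_skew (X : N) (D Y), hlie, lie_skew]
  rw [LinearMap.coe_restrict_apply, hDskew, h1, map_add]
  ring

end NaturallyReductive

namespace IsStandardBasis

variable {n : ℕ} {G : SimpleGraph (Fin n)} {N : Type*} [LieRing N] [LieAlgebra ℝ N]
  {e : Fin n → N} {zb : G.edgeSet → N} {P Q : LinearMap.BilinForm ℝ N} {a z : Submodule ℝ N}

theorem exists_standard_bilin (hb : IsStandardBasis G e zb) :
    ∃ Q : LinearMap.BilinForm ℝ N, ∀ s t : Fin n ⊕ G.edgeSet,
      Q (Sum.elim e zb s) (Sum.elim e zb t) = if s = t then 1 else 0 := by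
  classical
  have hbasis : ∀ s, Sum.elim e zb s = hb.basis s := by
    rintro (i | α)
    · exact (hb.basis_inl i).symm
    · exact (hb.basis_inr α).symm
  refine ⟨∑ s, (hb.basis.coord s).smulRight (hb.basis.coord s), fun s t => ?_⟩
  simp only [hbasis, LinearMap.sum_apply, LinearMap.smulRight_apply, LinearMap.smul_apply,
    Module.Basis.coord_apply, Module.Basis.repr_self, smul_eq_mul, Finsupp.single_apply]
  simp

theorem standard_symm (hb : IsStandardBasis G e zb)
    (hQ : ∀ s t : Fin n ⊕ G.edgeSet,
      Q (Sum.elim e zb s) (Sum.elim e zb t) = if s = t then 1 else 0) (x y : N) :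
    Q x y = Q y x := by
  have hbasis : ∀ s, hb.basis s = Sum.elim e zb s := by
    rintro (i | α)
    · exact hb.basis_inl i
    · exact hb.basis_inr α
  have h : Q = Q.flip := LinearMap.BilinForm.ext_basis hb.basis fun s t => by
    change Q _ _ = Q _ _
    rw [hbasis, hbasis, hQ, hQ]
    simp only [eq_comm]
  exact LinearMap.congr_fun₂ h x y

theorem standard_pos (hb : IsStandardBasis G e zb)
    (hQ : ∀ s t : Fin n ⊕ G.edgeSet,
      Q (Sum.elim e zb s) (Sum.elim e zb t) = if s = t then 1 else 0) (x : N) (hx : x ≠ 0) :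
    0 < Q x x := by
  classical
  have hbasis : ∀ s, hb.basis s = Sum.elim e zb s := by
    rintro (i | α)
    · exact hb.basis_inl i
    · exact hb.basis_inr α
  have hsum : Q x x = ∑ s, hb.basis.repr x s ^ 2 := by
    conv_lhs => rw [← hb.basis.sum_repr x]
    simp only [map_sum, LinearMap.sum_apply, map_smul, LinearMap.smul_apply, hbasis, hQ,
      smul_eq_mul]
    simp [sq]
  rw [hsum]
  refine lt_of_le_of_ne (Finset.sum_nonneg fun s _ => sq_nonneg _) fun h => hx ?_
  have h0 := (Finset.sum_eq_zero_iff_of_nonneg fun s _ => sq_nonneg _).1 h.symm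
  refine hb.basis.repr.map_eq_zero_iff.1 (Finsupp.ext fun s => ?_)
  simpa using h0 s (Finset.mem_univ s)

theorem standard_e_e
    (hQ : ∀ s t : Fin n ⊕ G.edgeSet,
      Q (Sum.elim e zb s) (Sum.elim e zb t) = if s = t then 1 else 0) (i j : Fin n) :
    Q (e i) (e j) = if i = j then 1 else 0 := by
  simpa using hQ (Sum.inl i) (Sum.inl j)

theorem standard_zb_e
    (hQ : ∀ s t : Fin n ⊕ G.edgeSet,
      Q (Sum.elim e zb s) (Sum.elim e zb t) = if s = t then 1 else 0) (i : Fin n) :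
    ∀ m ∈ Submodule.span ℝ (Set.range zb), Q m (e i) = 0 := by
  intro m hm
  induction hm using Submodule.span_induction with
  | mem x hx => obtain ⟨α, rfl⟩ := hx; simpa using hQ (Sum.inr α) (Sum.inl i)
  | zero => simp
  | add x y _ _ h1 h2 => simp [h1, h2]
  | smul c x _ h1 => simp [h1]

theorem standard_lie_lie (hb : IsStandardBasis G e zb)
    (hQ : ∀ s t : Fin n ⊕ G.edgeSet,
      Q (Sum.elim e zb s) (Sum.elim e zb t) = if s = t then 1 else 0) {i j : Fin n}
    (hij : G.Adj i j) (u v : Fin n) :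
    Q ⁅e i, e j⁆ ⁅e u, e v⁆ =
      (if u = i ∧ v = j then 1 else 0) - (if u = j ∧ v = i then 1 else 0) := by
  have hzz : ∀ α β, Q (zb α) (zb β) = if α = β then 1 else 0 := fun α β => by
    simpa using hQ (Sum.inr α) (Sum.inr β)
  have hlt : ∀ i j u v, G.Adj i j → i < j → u < v → Q ⁅e i, e j⁆ ⁅e u, e v⁆ =
      if u = i ∧ v = j then 1 else 0 := by
    intro i j u v hij h1 h2
    rw [hb.2.1 i j h1 hij]
    by_cases huv : G.Adj u v
    · rw [hb.2.1 u v h2 huv, hzz]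
      congr 1
      apply propext
      rw [Subtype.mk.injEq, Sym2.eq_iff]
      constructor
      · rintro (⟨rfl, rfl⟩ | ⟨rfl, rfl⟩)
        · exact ⟨rfl, rfl⟩
        · exact absurd h1 h2.not_gt
      · rintro ⟨rfl, rfl⟩; exact Or.inl ⟨rfl, rfl⟩
    · rw [hb.2.2.1 u v h2 huv, map_zero, if_neg]
      rintro ⟨rfl, rfl⟩; exact huv hij
  have hlt' : ∀ i j, G.Adj i j → i < j → Q ⁅e i, e j⁆ ⁅e u, e v⁆ =
      (if u = i ∧ v = j then 1 else 0) - (if u = j ∧ v = i then 1 else 0) := by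
    intro i j hij h1
    rcases lt_trichotomy u v with h | h | h
    · rw [hlt i j u v hij h1 h, if_neg (c := u = j ∧ v = i), sub_zero]
      rintro ⟨rfl, rfl⟩; exact h1.not_gt h
    · subst h
      rw [lie_self, map_zero, if_neg, if_neg, sub_zero]
      · rintro ⟨rfl, rfl⟩; exact h1.ne rfl
      · rintro ⟨rfl, rfl⟩; exact h1.ne rfl
    · rw [← lie_skew (e u) (e v), map_neg, hlt i j v u hij h1 h, if_neg (c := u = i ∧ v = j), zero_sub]
      · simp only [and_comm]
      · rintro ⟨rfl, rfl⟩; exact h1.not_gt h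
  rcases lt_or_gt_of_ne hij.ne with h | h
  · exact hlt' i j hij h
  · rw [← lie_skew, map_neg, LinearMap.neg_apply, hlt' j i hij.symm h, neg_sub]

theorem eq_sum_bilin_smul (hb : IsStandardBasis G e zb)
    (he : ∀ i, ∀ m ∈ Submodule.span ℝ (Set.range zb), P m (e i) = 0)
    (hort : ∀ i j, P (e i) (e j) = if i = j then 1 else 0) {x : N}
    (hx : x ∈ Submodule.span ℝ (Set.range e)) : x = ∑ i, P x (e i) • e i := by
  simp only [← hb.coord_eq_bilin he hort]
  rw [← sub_eq_zero]
  have hmem : x - ∑ i, hb.coord i x • e i ∈ Submodule.span ℝ (Set.range e) :=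
    Submodule.sub_mem _ hx (Submodule.sum_mem _ fun i _ =>
      Submodule.smul_mem _ _ (Submodule.subset_span ⟨i, rfl⟩))
  exact Submodule.disjoint_def.1 hb.isCompl_span.disjoint _ hmem (hb.sub_sum_coord_mem x)

theorem exists_J (hb : IsStandardBasis G e zb)
    (ha : a = Submodule.span ℝ (Set.range e))
    (hort : ∀ i j, P (e i) (e j) = if i = j then 1 else 0)
    (he : ∀ i, ∀ m ∈ Submodule.span ℝ (Set.range zb), P m (e i) = 0)
    (hPsym : ∀ x y : N, P x y = P y x) :
    ∃ J : z →ₗ[ℝ] (a →ₗ[ℝ] a),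
      ∀ (Z : z) (X Y : a), P (J Z X : N) (Y : N) = P (Z : N) ⁅(X : N), (Y : N)⁆ := by
  have hea : ∀ v, e v ∈ a := fun v => ha.symm.le (Submodule.subset_span ⟨v, rfl⟩)
  refine ⟨LinearMap.mk₂ ℝ
    (fun Z X => ∑ j, P (Z : N) ⁅(X : N), e j⁆ • (⟨e j, hea j⟩ : a)) ?_ ?_ ?_ ?_, ?_⟩
  · intro Z W X
    simp only [Submodule.coe_add, map_add, LinearMap.add_apply, add_smul,
      Finset.sum_add_distrib]
  · intro c Z X
    simp [mul_smul, Finset.smul_sum]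
  · intro Z X Y
    simp only [Submodule.coe_add, map_add, add_lie, add_smul,
      Finset.sum_add_distrib]
  · intro c Z X
    simp [mul_smul, Finset.smul_sum]
  · intro Z X Y
    have hY := hb.eq_sum_bilin_smul he hort (ha.le Y.2)
    have h1 : P (Z : N) ⁅(X : N), (Y : N)⁆ = ∑ j, P (Y : N) (e j) * P (Z : N) ⁅(X : N), e j⁆ := by
      conv_lhs => rw [hY]
      simp [lie_sum]
    rw [h1]
    simp only [LinearMap.mk₂_apply, Submodule.coe_sum, Submodule.coe_smul, map_sum,
      LinearMap.sum_apply, map_smul, LinearMap.smul_apply, smul_eq_mul, hPsym (e _) (Y : N)]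
    exact Finset.sum_congr rfl fun j _ => mul_comm _ _

theorem trace_eq_sum (hb : IsStandardBasis G e zb)
    (ha : a = Submodule.span ℝ (Set.range e))
    (he : ∀ i, ∀ m ∈ Submodule.span ℝ (Set.range zb), P m (e i) = 0)
    (hort : ∀ i j, P (e i) (e j) = if i = j then 1 else 0)
    (hea : ∀ v, e v ∈ a) (K : a →ₗ[ℝ] a) :
    LinearMap.trace ℝ a K = ∑ i, P (K ⟨e i, hea i⟩ : N) (e i) := by
  subst ha
  have hli : LinearIndependent ℝ e := by
    simpa [Function.comp_def] using hb.2.2.2.1.comp Sum.inl Sum.inl_injective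
  let b := Module.Basis.span hli
  have hb' : ∀ i, b i = ⟨e i, hea i⟩ := Module.Basis.span_apply hli
  have hrepr : ∀ x i, b.repr x i = P (x : N) (e i) := by
    intro x i
    have h : x = ∑ j, P (x : N) (e j) • b j := by
      apply Subtype.ext
      conv_lhs => rw [hb.eq_sum_bilin_smul he hort x.2]
      simp [hb']
    conv_lhs => rw [h]
    exact b.repr_sum_self _ ▸ rfl
  rw [LinearMap.trace_eq_matrix_trace ℝ b, Matrix.trace]
  refine Finset.sum_congr rfl fun i _ => ?_
  rw [Matrix.diag_apply, LinearMap.toMatrix_apply, hrepr, hb']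

theorem traceForm_apply_J (hb : IsStandardBasis G e zb)
    (hQ : ∀ s t : Fin n ⊕ G.edgeSet,
      Q (Sum.elim e zb s) (Sum.elim e zb t) = if s = t then 1 else 0)
    (ha : a = Submodule.span ℝ (Set.range e)) (hz : z = Submodule.span ℝ (Set.range zb))
    {J0 : z →ₗ[ℝ] (a →ₗ[ℝ] a)}
    (hJ0 : ∀ (Z : z) (X Y : a), Q (J0 Z X : N) (Y : N) = Q (Z : N) ⁅(X : N), (Y : N)⁆)
    {φ : N →ₗ[ℝ] ℝ} {K : a →ₗ[ℝ] a} (hK : ∀ X Y : a, Q (K X : N) Y = φ ⁅(X : N), (Y : N)⁆)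
    (W : z) : traceForm K (J0 W) = φ W := by
  have hea : ∀ v, e v ∈ a := fun v => ha.symm.le (Submodule.subset_span ⟨v, rfl⟩)
  have hJe : ∀ i, (J0 W ⟨e i, hea i⟩ : N) = ∑ j, Q (W : N) ⁅e i, e j⁆ • e j := by
    intro i
    rw [hb.eq_sum_bilin_smul (standard_zb_e hQ) (standard_e_e hQ) (ha.le (Subtype.prop _))]
    exact Finset.sum_congr rfl fun j _ => by rw [hJ0 W ⟨e i, hea i⟩ ⟨e j, hea j⟩]
  rw [traceForm, hb.trace_eq_sum ha (standard_zb_e hQ) (standard_e_e hQ) hea]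
  have h1 : ∀ i, Q ((K ∘ₗ J0 W) ⟨e i, hea i⟩ : N) (e i) =
      - ∑ j, Q (W : N) ⁅e i, e j⁆ * φ ⁅e i, e j⁆ := by
    intro i
    rw [LinearMap.comp_apply, hK _ ⟨e i, hea i⟩, hJe, sum_lie, map_sum, ← Finset.sum_neg_distrib]
    refine Finset.sum_congr rfl fun j _ => ?_
    rw [smul_lie, map_smul, ← lie_skew (e i) (e j), map_neg, smul_eq_mul, map_neg]
    ring
  conv_rhs => rw [hb.eq_half_sum_bilin_lie_smul (hb.standard_pos hQ)
    (fun i j _ => hb.lie_mem (e i) (e j)) (fun i j hij => hb.standard_lie_lie hQ hij)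
    (hz.le W.2)]
  simp only [h1, map_smul, map_sum, smul_eq_mul, Finset.sum_neg_distrib]
  ring

theorem exists_J_eq [FiniteDimensional ℝ N] (hb : IsStandardBasis G e zb)
    (hPpos : ∀ x : N, x ≠ 0 → 0 < P x x)
    (he : ∀ i, ∀ m ∈ Submodule.span ℝ (Set.range zb), P m (e i) = 0)
    (hort : ∀ i j, P (e i) (e j) = if i = j then 1 else 0)
    (ha : a = Submodule.span ℝ (Set.range e)) (hz : z = Submodule.span ℝ (Set.range zb))
    (hea : ∀ v, e v ∈ a) {J : z →ₗ[ℝ] (a →ₗ[ℝ] a)}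
    (hJ : ∀ (Z : z) (X Y : a), P (J Z X : N) (Y : N) = P (Z : N) ⁅(X : N), (Y : N)⁆)
    (K : a →ₗ[ℝ] a)
    (hskew : ∀ u v, P (K ⟨e u, hea u⟩ : N) (e v) = - P (K ⟨e v, hea v⟩ : N) (e u))
    (hsupp : ∀ u v, ¬ G.Adj u v → P (K ⟨e u, hea u⟩ : N) (e v) = 0) :
    ∃ Z, J Z = K := by
  obtain ⟨Z, hZ, hZk⟩ := hb.exists_bilin_lie_eq hPpos
    (fun u v => P (K ⟨e u, hea u⟩ : N) (e v)) hskew hsupp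
  have hJe : ∀ u, J ⟨Z, hz.symm.le hZ⟩ ⟨e u, hea u⟩ = K ⟨e u, hea u⟩ := by
    intro u
    apply Subtype.ext
    rw [hb.eq_sum_bilin_smul he hort (ha.le (J _ _).2),
      hb.eq_sum_bilin_smul he hort (ha.le (K _).2)]
    exact Finset.sum_congr rfl fun v _ => by rw [hJ _ _ ⟨e v, hea v⟩, hZk]
  refine ⟨⟨Z, hz.symm.le hZ⟩, LinearMap.ext fun X => ?_⟩
  have hX : X = ∑ i, P (X : N) (e i) • (⟨e i, hea i⟩ : a) := by
    apply Subtype.ext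
    conv_lhs => rw [hb.eq_sum_bilin_smul he hort (ha.le X.2)]
    simp
  rw [hX, map_sum, map_sum]
  exact Finset.sum_congr rfl fun i _ => by rw [map_smul, map_smul, hJe]

end IsStandardBasis

theorem iSup_eigenspace_eq_top_of_bilin {V : Type*} [AddCommGroup V] [Module ℝ V]
    [FiniteDimensional ℝ V] {Q : LinearMap.BilinForm ℝ V} (hQsym : ∀ x y, Q x y = Q y x)
    (hQpos : ∀ x : V, x ≠ 0 → 0 < Q x x) {S : Module.End ℝ V}
    (hS : ∀ x y, Q (S x) y = Q x (S y)) :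
    ⨆ μ : S.Eigenvalues, S.eigenspace μ = ⊤ := by
  let core := innerProductCoreOfBilin hQsym hQpos
  let _ : NormedAddCommGroup V := core.toNormedAddCommGroup
  let _ : InnerProductSpace ℝ V := InnerProductSpace.ofCore core.toCore
  have hsymm : LinearMap.IsSymmetric S := fun x y => hS x y
  exact (Submodule.orthogonal_eq_bot_iff).1 hsymm.orthogonalComplement_iSup_eigenspaces_eq_bot'

section TraceForm

variable {a : Type*} [AddCommGroup a] [Module ℝ a]

theorem traceForm_commutator (A B C : a →ₗ[ℝ] a) :
    traceForm (A ∘ₗ B - B ∘ₗ A) C = - traceForm B (A ∘ₗ C - C ∘ₗ A) := by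
  have h : LinearMap.trace ℝ a ((A ∘ₗ B) ∘ₗ C) = LinearMap.trace ℝ a ((B ∘ₗ C) ∘ₗ A) := by
    rw [LinearMap.comp_assoc]
    exact LinearMap.trace_mul_comm ℝ A (B ∘ₗ C)
  simp only [traceForm, LinearMap.sub_comp, LinearMap.comp_sub, map_sub, h,
    ← LinearMap.comp_assoc]
  ring

/-- A combination of the projections onto ideals commutes with the adjoint action. -/
theorem map_commutator_of_ideals {ι : Type*} {R : Submodule ℝ (a →ₗ[ℝ] a)}
    {I : ι → Submodule ℝ (a →ₗ[ℝ] a)} {lam : ι → ℝ}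
    {Φ : (a →ₗ[ℝ] a) →ₗ[ℝ] (a →ₗ[ℝ] a)} (hsup : ⨆ μ, I μ = R)
    (hideal : ∀ μ K L, K ∈ R → L ∈ I μ → K ∘ₗ L - L ∘ₗ K ∈ I μ)
    (hΦ : ∀ μ, ∀ K ∈ I μ, Φ K = lam μ • K) {M K : a →ₗ[ℝ] a} (hM : M ∈ R) (hK : K ∈ R) :
    Φ K ∈ R ∧ M ∘ₗ K - K ∘ₗ M ∈ R ∧ Φ (M ∘ₗ K - K ∘ₗ M) = M ∘ₗ Φ K - Φ K ∘ₗ M := by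
  rw [← hsup] at hK
  have hle : ∀ μ, I μ ≤ R := fun μ => hsup ▸ le_iSup I μ
  induction hK using Submodule.iSup_induction' with
  | mem μ K hK =>
    refine ⟨?_, hle μ (hideal μ M K hM hK), ?_⟩
    · rw [hΦ μ K hK]; exact R.smul_mem _ (hle μ hK)
    · rw [hΦ μ K hK, hΦ μ _ (hideal μ M K hM hK), LinearMap.comp_smul, LinearMap.smul_comp,
        smul_sub]
  | zero => simp
  | add K L _ _ h1 h2 =>
    have h : M ∘ₗ (K + L) - (K + L) ∘ₗ M = (M ∘ₗ K - K ∘ₗ M) + (M ∘ₗ L - L ∘ₗ M) := by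
      rw [LinearMap.comp_add, LinearMap.add_comp]; abel
    rw [h]
    refine ⟨?_, R.add_mem h1.2.1 h2.2.1, ?_⟩
    · rw [map_add]; exact R.add_mem h1.1 h2.1
    · rw [map_add, map_add, h1.2.2, h2.2.2, LinearMap.comp_add, LinearMap.add_comp]; abel

end TraceForm

theorem span_range_coe_eq_range {V W : Type*} [AddCommGroup V] [Module ℝ V] [AddCommGroup W]
    [Module ℝ W] (f : V →ₗ[ℝ] W) :
    Submodule.span ℝ (Set.range fun v => f v) = LinearMap.range f := by
  rw [show (Set.range fun v => f v) = (LinearMap.range f : Set W) from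
    (LinearMap.coe_range f).symm, Submodule.span_eq]

theorem isDisjointUnionOfCompleteGraphs_of_trans {n : ℕ} {G : SimpleGraph (Fin n)}
    (htrans : ∀ {i j k}, G.Adj i j → G.Adj j k → i ≠ k → G.Adj i k) :
    IsDisjointUnionOfCompleteGraphs G := by
  have hnonempty : ∀ i : Fin n, {m : ℕ | ∃ j : Fin n, j.val = m ∧ (i = j ∨ G.Adj i j)}.Nonempty :=
    fun i => ⟨i, i, rfl, Or.inl rfl⟩
  have key : ∀ i j k, G.Adj i j → (i = k ∨ G.Adj i k) → (j = k ∨ G.Adj j k) := by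
    rintro i j k hij (rfl | hik)
    · exact Or.inr hij.symm
    · by_cases h : j = k
      · exact Or.inl h
      · exact Or.inr (htrans hij.symm hik h)
  refine ⟨fun i => sInf {m : ℕ | ∃ j : Fin n, j.val = m ∧ (i = j ∨ G.Adj i j)}, fun i j => ?_⟩
  constructor
  · intro hij
    refine ⟨hij.ne, ?_⟩
    exact congrArg sInf (Set.ext fun m => ⟨fun ⟨k, hk, h⟩ => ⟨k, hk, key i j k hij h⟩,
      fun ⟨k, hk, h⟩ => ⟨k, hk, key j i k hij.symm h⟩⟩)
  · rintro ⟨hne, heq⟩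
    obtain ⟨k, hk, hik⟩ := Nat.sInf_mem (hnonempty i)
    obtain ⟨l, hl, hjl⟩ := Nat.sInf_mem (hnonempty j)
    have hkl : k = l := Fin.ext (hk.trans (heq.trans hl.symm))
    subst hkl
    rcases hik with rfl | hik
    · exact (hjl.resolve_left (Ne.symm hne)).symm
    · rcases hjl with rfl | hjl
      · exact hik
      · exact htrans hik hjl.symm hne

section SemiStandard

variable {n : ℕ} {G : SimpleGraph (Fin n)} {N : Type*} [LieRing N] [LieAlgebra ℝ N]
  [FiniteDimensional ℝ N]
  {e : Fin n → N} {zb : G.edgeSet → N} {P Q : LinearMap.BilinForm ℝ N} {a z : Submodule ℝ N}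

theorem IsStandardBasis.range_le_range (hb : IsStandardBasis G e zb)
    (hPpos : ∀ x : N, x ≠ 0 → 0 < P x x)
    (hePz : ∀ i, ∀ m ∈ Submodule.span ℝ (Set.range zb), P m (e i) = 0)
    (hort : ∀ i j, P (e i) (e j) = if i = j then 1 else 0)
    (ha : a = Submodule.span ℝ (Set.range e)) (hz : z = Submodule.span ℝ (Set.range zb))
    {J J' : z →ₗ[ℝ] (a →ₗ[ℝ] a)} (hPQ : ∀ X Y : a, P (X : N) Y = Q (X : N) Y)
    (hJ : ∀ (Z : z) (X Y : a), P (J Z X : N) (Y : N) = P (Z : N) ⁅(X : N), (Y : N)⁆)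
    (hJ' : ∀ (Z : z) (X Y : a), Q (J' Z X : N) (Y : N) = Q (Z : N) ⁅(X : N), (Y : N)⁆) :
    LinearMap.range J' ≤ LinearMap.range J := by
  have hea : ∀ v, e v ∈ a := fun v => ha.symm.le (Submodule.subset_span ⟨v, rfl⟩)
  have hJe : ∀ Z u v, P (J' Z ⟨e u, hea u⟩ : N) (e v) = Q (Z : N) ⁅e u, e v⁆ := fun Z u v => by
    rw [hPQ _ ⟨e v, hea v⟩, hJ']
  rintro _ ⟨Z, rfl⟩
  refine hb.exists_J_eq hPpos hePz hort ha hz hea hJ _ (fun u v => ?_) fun u v huv => ?_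
  · rw [hJe, hJe, ← lie_skew, map_neg]
  · rw [hJe, hb.lie_eq_zero_of_not_adj huv, map_zero]

theorem IsStandardBasis.isSemiStandard (hb : IsStandardBasis G e zb)
    (hPsym : ∀ x y : N, P x y = P y x) (hPpos : ∀ x : N, x ≠ 0 → 0 < P x x)
    (hePz : ∀ i, ∀ m ∈ Submodule.span ℝ (Set.range zb), P m (e i) = 0)
    (hort : ∀ i j, P (e i) (e j) = if i = j then 1 else 0)
    (ha : a = Submodule.span ℝ (Set.range e)) (hz : z = Submodule.span ℝ (Set.range zb))
    {J : z →ₗ[ℝ] (a →ₗ[ℝ] a)}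
    (hJ : ∀ (Z : z) (X Y : a), P (J Z X : N) (Y : N) = P (Z : N) ⁅(X : N), (Y : N)⁆)
    (hT : ∀ Z : z, ∃ T : z →ₗ[ℝ] z,
      (∀ W : z, J (T W) = (J Z) ∘ₗ (J W) - (J W) ∘ₗ (J Z)) ∧
      (∀ W W' : z, P (T W : N) (W' : N) = - P (W : N) (T W' : N))) :
    IsSemiStandard G P := by
  obtain ⟨Q, hQ⟩ := hb.exists_standard_bilin
  have hQsym := hb.standard_symm hQ
  have hQpos := hb.standard_pos hQ
  have haz : a ⊔ z = ⊤ := by rw [ha, hz]; exact hb.span_e_sup_span_zb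
  have hPQ : ∀ X Y : a, P (X : N) Y = Q (X : N) Y := by
    intro X Y
    rw [hb.eq_sum_bilin_smul hePz hort (ha.le Y.2)]
    simp only [map_sum, map_smul, ← hb.coord_eq_bilin hePz hort,
      ← hb.coord_eq_bilin (standard_zb_e hQ) (standard_e_e hQ)]
  obtain ⟨J0, hJ0⟩ := hb.exists_J ha (standard_e_e hQ) (standard_zb_e hQ) hQsym
  have hJ0inj : Function.Injective J0 := fun Z W h =>
    hb.ext_bilin_lie hQpos hz haz fun X Y => by rw [← hJ0, ← hJ0, h]
  have hJQ : ∀ (Z : z) (X Y : a), Q (J Z X : N) Y = P (Z : N) ⁅(X : N), (Y : N)⁆ :=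
    fun Z X Y => by rw [← hPQ, hJ]
  have htrace0 : ∀ Z W : z, traceForm (J0 Z) (J0 W) = Q (Z : N) W := fun Z W =>
    hb.traceForm_apply_J hQ ha hz hJ0 (hJ0 Z) W
  have htrace : ∀ Z W : z, traceForm (J Z) (J0 W) = P (Z : N) W := fun Z W =>
    hb.traceForm_apply_J hQ ha hz hJ0 (hJQ Z) W
  have hrange : LinearMap.range J0 ≤ LinearMap.range J :=
    hb.range_le_range hPpos hePz hort ha hz hPQ hJ hJ0
  have hrange' : LinearMap.range J ≤ LinearMap.range J0 :=
    hb.range_le_range hQpos (standard_zb_e hQ) (standard_e_e hQ) ha hz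
      (fun X Y => (hPQ X Y).symm) hJ0 hJ
  obtain ⟨L, hL⟩ := J0.exists_leftInverse_of_injective (LinearMap.ker_eq_bot.2 hJ0inj)
  have hLJ0 : ∀ Z, L (J0 Z) = Z := fun Z => LinearMap.congr_fun hL Z
  let S : Module.End ℝ z := L ∘ₗ J
  have hS : ∀ Z, J0 (S Z) = J Z := fun Z => by
    obtain ⟨W, hW⟩ := hrange' ⟨Z, rfl⟩
    change J0 (L (J Z)) = J Z
    rw [← hW, hLJ0]
  have hSQ : ∀ Z W : z, Q (S Z : N) W = P (Z : N) W := fun Z W => by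
    rw [← htrace0, hS, htrace]
  have hSsym : ∀ Z W : z, Q (S Z : N) W = Q (Z : N) (S W) := fun Z W => by
    rw [hSQ, hPsym, ← hSQ, hQsym]
  have htop := iSup_eigenspace_eq_top_of_bilin (Q := Q.restrict z) (S := S)
    (fun x y => hQsym x y)
    (fun x hx => hQpos x fun h => hx (Subtype.ext h)) hSsym
  let ε := Fintype.equivFin S.Eigenvalues
  have hpos : ∀ μ : S.Eigenvalues, 0 < (μ : ℝ) := by
    intro μ
    obtain ⟨Z, hZ, hne⟩ := Module.End.HasEigenvalue.exists_hasEigenvector μ.2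
    have hne' : (Z : N) ≠ 0 := fun h => hne (Subtype.ext h)
    have h1 := hSQ Z Z
    rw [Module.End.mem_eigenspace_iff.1 hZ, Submodule.coe_smul, map_smul, LinearMap.smul_apply,
      smul_eq_mul] at h1
    exact pos_of_mul_pos_left (h1 ▸ hPpos Z hne') (hQpos Z hne').le
  have hideal : ∀ μ : ℝ, ∀ K ∈ LinearMap.range J0, ∀ Z ∈ S.eigenspace μ,
      K ∘ₗ J0 Z - J0 Z ∘ₗ K ∈ (S.eigenspace μ).map J0 := by
    intro μ K hK Z hZ
    obtain ⟨M, rfl⟩ := hrange hK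
    obtain ⟨T, hTJ, hTskew⟩ := hT M
    have hT0 : ∀ W, J M ∘ₗ J0 W - J0 W ∘ₗ J M = J0 (T W) := by
      intro W
      obtain ⟨W', hW'⟩ := hrange ⟨W, rfl⟩
      have h1 : J M ∘ₗ J0 W - J0 W ∘ₗ J M = J0 (S (T W')) := by
        rw [← hW', ← hTJ, hS]
      rw [h1]
      congr 1
      have h2 : ∀ U : z, P (U : N) ((S (T W') - T W : z) : N) = 0 := by
        intro U
        have h3 := traceForm_commutator (J M) (J U) (J0 W)
        rw [← hTJ, htrace, hTskew, h1, ← hS U, htrace0, hSQ] at h3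
        rw [Submodule.coe_sub, map_sub]
        linarith
      by_contra hne
      have hne' : ((S (T W') - T W : z) : N) ≠ 0 := fun h =>
        hne (sub_eq_zero.1 (Subtype.ext h))
      exact (hPpos _ hne').ne' (h2 _)
    refine ⟨T Z, Module.End.mem_eigenspace_iff.2 (hJ0inj ?_), (hT0 Z).symm⟩
    rw [hS, hTJ, map_smul, ← hT0, ← hS Z, Module.End.mem_eigenspace_iff.1 hZ, map_smul,
      LinearMap.comp_smul, LinearMap.smul_comp, smul_sub]
  have horth : ∀ μ ν : S.Eigenvalues, μ ≠ ν → ∀ K ∈ (S.eigenspace μ).map J0,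
      ∀ K' ∈ (S.eigenspace ν).map J0, traceForm K K' = 0 := by
    rintro μ ν hne _ ⟨Z, hZ, rfl⟩ _ ⟨W, hW, rfl⟩
    rw [htrace0]
    have h1 := hSsym Z W
    rw [Module.End.mem_eigenspace_iff.1 hZ, Module.End.mem_eigenspace_iff.1 hW] at h1
    simp only [Submodule.coe_smul, map_smul, LinearMap.smul_apply, smul_eq_mul] at h1
    have h2 : ((μ : ℝ) - (ν : ℝ)) * Q (Z : N) W = 0 := by linarith
    exact (mul_eq_zero.1 h2).resolve_left (sub_ne_zero.2 fun h => hne (Subtype.ext h))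
  have hcross : ∀ (X : a) (Z : z), P (Z : N) (X : N) = 0 := fun X Z =>
    (hb.span_e_eq_orthogonal hPpos hePz).le (ha.le X.2) Z (hz.le Z.2)
  subst ha hz
  refine ⟨e, zb, Q, hb, hQ, J0, hJ0, Fintype.card S.Eigenvalues,
    fun i => (S.eigenspace (ε.symm i)).map J0, fun i => (ε.symm i : ℝ), J ∘ₗ L,
    fun i => hpos _, ?_, fun i => ?_, fun i K K' hK hK' => ?_, fun i j hij => ?_,
    fun i K hK => ?_, fun X Y Z W => ?_⟩
  · rw [← Submodule.map_iSup, ε.symm.iSup_comp (g := fun μ : S.Eigenvalues => S.eigenspace μ),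
      htop, span_range_coe_eq_range, Submodule.map_top]
  · rw [Submodule.disjoint_def]
    rintro _ ⟨Z, hZ, rfl⟩ hZ'
    have h0 : ∀ K ∈ ⨆ ν ∈ {ν | ν ≠ i}, (S.eigenspace (ε.symm ν)).map J0,
        traceForm (J0 Z) K = 0 := by
      have hle : ⨆ ν ∈ {ν | ν ≠ i}, (S.eigenspace (ε.symm ν)).map J0 ≤
          LinearMap.ker ((-(1 / 2) : ℝ) • (LinearMap.trace ℝ _ ∘ₗ
            LinearMap.mulLeft ℝ (J0 Z : Module.End ℝ _))) :=
        iSup₂_le fun ν hν K hK =>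
          horth _ _ (fun h => hν (ε.symm.injective h).symm) _ ⟨Z, hZ, rfl⟩ K hK
      exact fun K hK => hle hK
    have h1 := h0 _ hZ'
    rw [htrace0] at h1
    by_contra hne
    exact (hQpos Z fun h => hne (by rw [show Z = 0 from Subtype.ext h, map_zero])).ne' h1
  · obtain ⟨Z, hZ, rfl⟩ := hK'
    rw [span_range_coe_eq_range] at hK
    exact hideal _ K hK Z hZ
  · exact horth _ _ fun h => hij (ε.symm.injective h)
  · obtain ⟨Z, hZ, rfl⟩ := hK
    rw [LinearMap.comp_apply, hLJ0, ← hS, Module.End.mem_eigenspace_iff.1 hZ, map_smul]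
  · rw [LinearMap.comp_apply, hLJ0, htrace, ← hPQ]
    simp only [map_add, LinearMap.add_apply, hcross, hPsym (X : N) (W : N)]
    ring

theorem IsStandardBasis.commutator_mem_range (hb : IsStandardBasis G e zb)
    (htrans : ∀ {i j k}, G.Adj i j → G.Adj j k → i ≠ k → G.Adj i k)
    (hPsym : ∀ x y : N, P x y = P y x) (hPpos : ∀ x : N, x ≠ 0 → 0 < P x x)
    (hePz : ∀ i, ∀ m ∈ Submodule.span ℝ (Set.range zb), P m (e i) = 0)
    (hort : ∀ i j, P (e i) (e j) = if i = j then 1 else 0)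
    (ha : a = Submodule.span ℝ (Set.range e)) (hz : z = Submodule.span ℝ (Set.range zb))
    {J : z →ₗ[ℝ] (a →ₗ[ℝ] a)}
    (hJ : ∀ (Z : z) (X Y : a), P (J Z X : N) (Y : N) = P (Z : N) ⁅(X : N), (Y : N)⁆)
    (Z W : z) : J Z ∘ₗ J W - J W ∘ₗ J Z ∈ LinearMap.range J := by
  have hea : ∀ v, e v ∈ a := fun v => ha.symm.le (Submodule.subset_span ⟨v, rfl⟩)
  have hentry : ∀ u v, P ((J Z ∘ₗ J W - J W ∘ₗ J Z) ⟨e u, hea u⟩ : N) (e v) =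
      P (J Z ⟨e u, hea u⟩ : N) (J W ⟨e v, hea v⟩ : N) -
        P (J W ⟨e u, hea u⟩ : N) (J Z ⟨e v, hea v⟩ : N) := by
    intro u v
    have h1 := bilin_apply_eq_neg hPsym hJ Z (J W ⟨e u, hea u⟩) ⟨e v, hea v⟩
    have h2 := bilin_apply_eq_neg hPsym hJ W (J Z ⟨e u, hea u⟩) ⟨e v, hea v⟩
    simp only at h1 h2
    rw [LinearMap.sub_apply, LinearMap.comp_apply, LinearMap.comp_apply, Submodule.coe_sub,
      map_sub, LinearMap.sub_apply, h1, h2]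
    ring
  have hzero : ∀ (Z W : z) u v, u ≠ v → ¬ G.Adj u v →
      P (J Z ⟨e u, hea u⟩ : N) (J W ⟨e v, hea v⟩ : N) = 0 := by
    intro Z W u v hne huv
    rw [hb.eq_sum_bilin_smul hePz hort (ha.le (J W _).2), map_sum]
    refine Finset.sum_eq_zero fun w _ => ?_
    rw [map_smul, hJ Z _ ⟨e w, hea w⟩, hJ W _ ⟨e w, hea w⟩, smul_eq_mul]
    by_cases huw : G.Adj u w
    · by_cases hvw : G.Adj v w
      · exact absurd (htrans huw hvw.symm hne) huv
      · rw [hb.lie_eq_zero_of_not_adj hvw, map_zero, zero_mul]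
    · rw [hb.lie_eq_zero_of_not_adj huw, map_zero, mul_zero]
  refine hb.exists_J_eq hPpos hePz hort ha hz hea hJ _ (fun u v => ?_) fun u v huv => ?_
  · rw [hentry, hentry, hPsym (J Z ⟨e v, hea v⟩ : N), hPsym (J W ⟨e v, hea v⟩ : N)]
    ring
  · rw [hentry]
    by_cases hne : u = v
    · subst hne
      rw [hPsym, sub_self]
    · rw [hzero Z W u v hne huv, hzero W Z u v hne huv, sub_self]

theorem IsStandardBasis.exists_skew_ad_of_ideals (hb : IsStandardBasis G e zb)
    (htrans : ∀ {i j k}, G.Adj i j → G.Adj j k → i ≠ k → G.Adj i k)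
    (hPpos : ∀ x : N, x ≠ 0 → 0 < P x x)
    (hQ : ∀ s t : Fin n ⊕ G.edgeSet,
      Q (Sum.elim e zb s) (Sum.elim e zb t) = if s = t then 1 else 0)
    (ha : a = Submodule.span ℝ (Set.range e)) (hz : z = Submodule.span ℝ (Set.range zb))
    {J J0 : z →ₗ[ℝ] (a →ₗ[ℝ] a)}
    (hJ : ∀ (Z : z) (X Y : a), P (J Z X : N) (Y : N) = P (Z : N) ⁅(X : N), (Y : N)⁆)
    (hJ0 : ∀ (Z : z) (X Y : a), Q (J0 Z X : N) (Y : N) = Q (Z : N) ⁅(X : N), (Y : N)⁆)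
    {k : ℕ} {I : Fin k → Submodule ℝ (a →ₗ[ℝ] a)} {lam : Fin k → ℝ}
    {Φ : (a →ₗ[ℝ] a) →ₗ[ℝ] (a →ₗ[ℝ] a)}
    (hsup : ⨆ μ, I μ = Submodule.span ℝ (Set.range fun Z => J0 Z))
    (hideal : ∀ μ K L, K ∈ Submodule.span ℝ (Set.range fun Z => J0 Z) → L ∈ I μ →
      K ∘ₗ L - L ∘ₗ K ∈ I μ)
    (hΦ : ∀ μ, ∀ K ∈ I μ, Φ K = lam μ • K)
    (hP : ∀ (X Y : a) (Z W : z), P ((X : N) + (Z : N)) ((Y : N) + (W : N)) =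
      Q (X : N) (Y : N) + traceForm (Φ (J0 Z)) (J0 W)) (Z : z) :
    ∃ T : z →ₗ[ℝ] z,
      (∀ W : z, J (T W) = (J Z) ∘ₗ (J W) - (J W) ∘ₗ (J Z)) ∧
      (∀ W W' : z, P (T W : N) (W' : N) = - P (W : N) (T W' : N)) := by
  have hQsym := hb.standard_symm hQ
  have hQpos := hb.standard_pos hQ
  have haz : a ⊔ z = ⊤ := by rw [ha, hz]; exact hb.span_e_sup_span_zb
  have hPQ : ∀ X Y : a, P (X : N) Y = Q (X : N) Y := fun X Y => by
    simpa [traceForm] using hP X Y 0 0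
  have hPz : ∀ Z W : z, traceForm (Φ (J0 Z)) (J0 W) = P (Z : N) W := fun Z W => by
    simpa using (hP 0 0 Z W).symm
  have hJ0inj : Function.Injective J0 := fun Z W h =>
    hb.ext_bilin_lie hQpos hz haz fun X Y => by rw [← hJ0, ← hJ0, h]
  rw [span_range_coe_eq_range] at hsup hideal
  have hΦad := fun M hM K hK => map_commutator_of_ideals (M := M) (K := K) hsup hideal hΦ hM hK
  have hJΦ : ∀ Z, J Z = Φ (J0 Z) := by
    intro Z
    obtain ⟨Z', hZ'⟩ := (hΦad _ ⟨Z, rfl⟩ _ ⟨Z, rfl⟩).1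
    rw [← hZ']
    have h1 : ∀ W : z, Q (Z' : N) W = P (Z : N) W := fun W => by
      rw [← hb.traceForm_apply_J hQ ha hz hJ0 (hJ0 Z') W, hZ', hPz]
    refine LinearMap.ext fun X => Subtype.ext ?_
    refine eq_of_bilin_eq_of_mem hPpos (z := a) (Subtype.prop _) (Subtype.prop _) fun Y hY => ?_
    lift Y to a using hY
    rw [hJ, hPQ, hJ0]
    exact (h1 ⟨_, hz.symm.le (hb.lie_mem _ _)⟩).symm
  have hJrange : J Z ∈ LinearMap.range J0 := by
    rw [hJΦ]; exact (hΦad _ ⟨Z, rfl⟩ _ ⟨Z, rfl⟩).1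
  obtain ⟨L, hL⟩ := J0.exists_leftInverse_of_injective (LinearMap.ker_eq_bot.2 hJ0inj)
  let T : z →ₗ[ℝ] z := L ∘ₗ (LinearMap.mulLeft ℝ (J Z : Module.End ℝ a) -
    LinearMap.mulRight ℝ (J Z : Module.End ℝ a)) ∘ₗ J0
  have hT0 : ∀ W, J0 (T W) = J Z ∘ₗ J0 W - J0 W ∘ₗ J Z := by
    intro W
    obtain ⟨M, hM⟩ := hJrange
    obtain ⟨V, hV⟩ := hb.commutator_mem_range htrans hQsym hQpos (standard_zb_e hQ)
      (standard_e_e hQ) ha hz hJ0 M W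
    rw [hM] at hV
    change J0 (L (J Z ∘ₗ J0 W - J0 W ∘ₗ J Z)) = _
    rw [← hV]
    exact congrArg J0 (LinearMap.congr_fun hL V)
  have hTJ : ∀ W, J (T W) = J Z ∘ₗ J W - J W ∘ₗ J Z := fun W => by
    rw [hJΦ (T W), hT0, (hΦad _ hJrange _ ⟨W, rfl⟩).2.2, ← hJΦ W]
  refine ⟨T, hTJ, fun W W' => ?_⟩
  rw [← hPz, ← hPz, ← hJΦ, ← hJΦ, hTJ, hT0, traceForm_commutator]

theorem exists_skew_ad_of_isSemiStandard (hG : IsDisjointUnionOfCompleteGraphs G)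
    (hss : IsSemiStandard G P) (hPpos : ∀ x : N, x ≠ 0 → 0 < P x x)
    (hz : z = Submodule.span ℝ {m : N | ∃ x y : N, ⁅x, y⁆ = m}) (ha : a = P.orthogonal z)
    {J : z →ₗ[ℝ] (a →ₗ[ℝ] a)}
    (hJ : ∀ (Z : z) (X Y : a), P (J Z X : N) (Y : N) = P (Z : N) ⁅(X : N), (Y : N)⁆) (Z : z) :
    ∃ T : z →ₗ[ℝ] z,
      (∀ W : z, J (T W) = (J Z) ∘ₗ (J W) - (J W) ∘ₗ (J Z)) ∧
      (∀ W W' : z, P (T W : N) (W' : N) = - P (W : N) (T W' : N)) := by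
  obtain ⟨col, hcol⟩ := hG
  have htrans : ∀ {i j k}, G.Adj i j → G.Adj j k → i ≠ k → G.Adj i k := fun h1 h2 h3 =>
    (hcol _ _).2 ⟨h3, ((hcol _ _).1 h1).2.trans ((hcol _ _).1 h2).2⟩
  obtain ⟨e, zb, Q, hb, hQ, J0, hJ0, k, I, lam, Φ, -, hsup, -, hideal, -, hΦ, hP⟩ := hss
  have hcross : ∀ i, ∀ m ∈ Submodule.span ℝ (Set.range zb), P m (e i) = 0 := by
    intro i m hm
    have := hP 0 ⟨e i, Submodule.subset_span ⟨i, rfl⟩⟩ ⟨m, hm⟩ 0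
    simpa [traceForm] using this
  obtain rfl : z = Submodule.span ℝ (Set.range zb) := hz.trans hb.span_zb.symm
  obtain rfl : a = Submodule.span ℝ (Set.range e) :=
    ha.trans (hb.span_e_eq_orthogonal hPpos hcross).symm
  exact hb.exists_skew_ad_of_ideals htrans hPpos hQ rfl rfl hJ hJ0 hsup hideal hΦ hP Z

end SemiStandard

/-- **Main Theorem.** Let `𝔫` be the Lie algebra associated with a finite simple
graph `𝒢`, with inner product `(·,·)`; `𝔷 = [𝔫,𝔫]`, `𝔞 = 𝔷^⊥`, `J_Z` defined by
`(J_Z X, Y) = (Z,[X,Y])`. The following are equivalent: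
(i) the geodesic orbit condition: for every `X ∈ 𝔞`, `Z ∈ 𝔷` there is a skew-symmetric
derivation `D` with `DZ = 0`, `DX = J_Z X`;
(ii) the naturally reductive condition: `𝒥 = span{J_Z}` is a Lie subalgebra of `so(𝔞)` and
`J⁻¹ ∘ ad_{J_Z} ∘ J` is skew-symmetric for every `Z ∈ 𝔷`;
(iii) `𝒢` is a disjoint union of complete graphs and `(·,·)` is semi-standard. -/
theorem geodesic_orbit_tfae {n : ℕ} (G : SimpleGraph (Fin n))
    {N : Type*} [LieRing N] [LieAlgebra ℝ N] [FiniteDimensional ℝ N]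
    (e0 : Fin n → N) (zb0 : G.edgeSet → N) (hassoc : IsStandardBasis G e0 zb0)
    (P : LinearMap.BilinForm ℝ N)
    (hPsym : ∀ x y : N, P x y = P y x)
    (hPpos : ∀ x : N, x ≠ 0 → 0 < P x x)
    (z : Submodule ℝ N) (hz : z = Submodule.span ℝ {m : N | ∃ x y : N, ⁅x, y⁆ = m})
    (a : Submodule ℝ N) (ha : a = LinearMap.BilinForm.orthogonal P z)
    (J : z →ₗ[ℝ] (a →ₗ[ℝ] a))
    (hJ : ∀ (Z : z) (X Y : a), P (J Z X : N) (Y : N) = P (Z : N) ⁅(X : N), (Y : N)⁆) :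
    List.TFAE [
      -- (i) the geodesic orbit condition
      (∀ (X : a) (Z : z), ∃ D : N →ₗ[ℝ] N,
        (∀ x y : N, D ⁅x, y⁆ = ⁅D x, y⁆ + ⁅x, D y⁆) ∧
        (∀ x y : N, P (D x) y = - P x (D y)) ∧
        D (Z : N) = 0 ∧ D (X : N) = (J Z X : N)),
      -- (ii) the naturally reductive condition
      (((∀ K ∈ Submodule.span ℝ (Set.range fun Z : z => J Z),
          ∀ x y : a, P (K x : N) (y : N) = - P (x : N) (K y : N)) ∧
        (∀ K L : a →ₗ[ℝ] a, K ∈ Submodule.span ℝ (Set.range fun Z : z => J Z) →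
          L ∈ Submodule.span ℝ (Set.range fun Z : z => J Z) →
          K ∘ₗ L - L ∘ₗ K ∈ Submodule.span ℝ (Set.range fun Z : z => J Z))) ∧
        (∀ Z : z, ∃ T : z →ₗ[ℝ] z,
          (∀ W : z, J (T W) = (J Z) ∘ₗ (J W) - (J W) ∘ₗ (J Z)) ∧
          (∀ W W' : z, P (T W : N) (W' : N) = - P (W : N) (T W' : N)))),
      -- (iii) `𝒢` is a disjoint union of complete graphs and the metric is semi-standard
      (IsDisjointUnionOfCompleteGraphs G ∧ IsSemiStandard G P)
    ] := by
  have hz0 : Submodule.span ℝ (Set.range zb0) = z := hassoc.span_zb.trans hz.symm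
  obtain ⟨e1, zb1, hb1, hspan1, he1⟩ := hassoc.exists_orthogonal_to_center hPsym hPpos
  have hz1 : Submodule.span ℝ (Set.range zb1) = z := hb1.span_zb.trans hz.symm
  rw [hz0, ← hz1] at he1
  have haz : IsCompl a z := by
    rw [ha, ← hz1, ← hb1.span_e_eq_orthogonal hPpos he1]
    exact hb1.isCompl_span
  have hGO : (∀ (X : a) (Z : z), ∃ D : N →ₗ[ℝ] N,
      (∀ x y : N, D ⁅x, y⁆ = ⁅D x, y⁆ + ⁅x, D y⁆) ∧ (∀ x y : N, P (D x) y = - P x (D y)) ∧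
      D (Z : N) = 0 ∧ D (X : N) = (J Z X : N)) → IsGeodesicOrbit P z :=
    isGeodesicOrbit_of_exists_derivation hPsym
      (fun x m hm => hassoc.lie_eq_zero_of_mem_right (hz0 ▸ hm) x) haz.sup_eq_top ha hJ
  have hbasis : IsGeodesicOrbit P z → ∃ (e : Fin n → N) (zb : G.edgeSet → N),
      IsStandardBasis G e zb ∧ z = Submodule.span ℝ (Set.range zb) ∧
      a = Submodule.span ℝ (Set.range e) ∧ (∀ i, ∀ m ∈ z, P m (e i) = 0) ∧
      ∀ i j, P (e i) (e j) = if i = j then 1 else 0 := by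
    intro h
    obtain ⟨e, zb, hb, -, he, hort⟩ :=
      hb1.exists_orthonormal_of_isGeodesicOrbit hPsym hPpos (hz1 ▸ h) he1
    have hzb : Submodule.span ℝ (Set.range zb) = z := hb.span_zb.trans hz.symm
    rw [hz1, ← hzb] at he
    refine ⟨e, zb, hb, hzb.symm, ?_, hzb ▸ he, hort⟩
    rw [ha, ← hzb, hb.span_e_eq_orthogonal hPpos he]
  have hskew : IsGeodesicOrbit P z → ∀ Z : z, ∃ T : z →ₗ[ℝ] z,
      (∀ W : z, J (T W) = (J Z) ∘ₗ (J W) - (J W) ∘ₗ (J Z)) ∧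
      (∀ W W' : z, P (T W : N) (W' : N) = - P (W : N) (T W' : N)) := by
    intro h
    obtain ⟨e, zb, hb, hzb, hae, he, hort⟩ := hbasis h
    exact hb.exists_skew_ad_of_isGeodesicOrbit hPsym hPpos h hzb hae he hort hJ
  have hsubalgebra : (∀ Z : z, ∃ T : z →ₗ[ℝ] z,
      (∀ W : z, J (T W) = (J Z) ∘ₗ (J W) - (J W) ∘ₗ (J Z)) ∧
      (∀ W W' : z, P (T W : N) (W' : N) = - P (W : N) (T W' : N))) →
      (∀ K ∈ Submodule.span ℝ (Set.range fun Z : z => J Z),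
        ∀ x y : a, P (K x : N) (y : N) = - P (x : N) (K y : N)) ∧
      (∀ K L : a →ₗ[ℝ] a, K ∈ Submodule.span ℝ (Set.range fun Z : z => J Z) →
        L ∈ Submodule.span ℝ (Set.range fun Z : z => J Z) →
        K ∘ₗ L - L ∘ₗ K ∈ Submodule.span ℝ (Set.range fun Z : z => J Z)) := by
    intro hT
    rw [span_range_coe_eq_range]
    constructor
    · rintro _ ⟨Z, rfl⟩ x y
      exact bilin_apply_eq_neg hPsym hJ Z x y
    · rintro _ _ ⟨Z, rfl⟩ ⟨W, rfl⟩
      obtain ⟨T, hTJ, -⟩ := hT Z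
      exact ⟨T W, hTJ W⟩
  tfae_have 1 → 2 := fun h => ⟨hsubalgebra (hskew (hGO h)), hskew (hGO h)⟩
  tfae_have 2 → 1 := fun h X Z =>
    exists_skew_derivation_of_naturallyReductive hPsym hPpos hb1 hz1.symm haz ha hJ h.2 X Z
  tfae_have 1 → 3 := by
    intro h
    obtain ⟨e, zb, hb, hzb, hae, he, hort⟩ := hbasis (hGO h)
    exact ⟨isDisjointUnionOfCompleteGraphs_of_trans
        (hb.adj_trans_of_isGeodesicOrbit hPsym hPpos (hzb ▸ hGO h)),
      hb.isSemiStandard hPsym hPpos (hzb ▸ he) hort hae hzb hJ (hskew (hGO h))⟩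
  tfae_have 3 → 2 := by
    rintro ⟨hG, hss⟩
    have hT := exists_skew_ad_of_isSemiStandard hG hss hPpos hz ha hJ
    exact ⟨hsubalgebra hT, hT⟩
  tfae_finish
end

section
/- Let 𝔫 be the Lie algebra associated with a finite simple graph 𝒢, equipped with an inner product (·,·); set 𝔷 = [𝔫,𝔫], 𝔞 = 𝔷^⊥, and define J_Z ∈ so(𝔞) by (J_Z X, Y) = (Z,[X,Y]). Suppose that for every X ∈ 𝔞 and Z ∈ 𝔷 there exists a derivation D of 𝔫, skew-symmetric with respect to (·,·), with DZ = 0 and DX = J_Z X. Then every edge V_iV_j of 𝒢 satisfies i ∼ j, that is, every neighbour of V_i other than V_j is a neighbour of V_j and vice versa. -/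
namespace GraphLie

/-- Orthogonal decomposition with respect to a positive definite symmetric form. -/
lemma exists_add_orthogonal {N : Type*} [AddCommGroup N] [Module ℝ N] [FiniteDimensional ℝ N]
    (P : LinearMap.BilinForm ℝ N) (hPsym : ∀ x y : N, P x y = P y x)
    (hPpos : ∀ x : N, x ≠ 0 → 0 < P x x) (W : Submodule ℝ N) (x : N) :
    ∃ u ∈ W, ∃ v, x = u + v ∧ ∀ w ∈ W, P w v = 0 := by
  have hrefl : P.IsRefl := fun x y h => by rw [hPsym, h]
  have hdisj : Disjoint W (P.orthogonal W) := by
    rw [Submodule.disjoint_def]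
    intro w hw hw'
    by_contra hne
    exact (hPpos w hne).ne' (hw' w hw)
  have hcompl : IsCompl W (P.orthogonal W) :=
    LinearMap.BilinForm.isCompl_orthogonal_iff_disjoint hrefl |>.mpr hdisj
  have hx : x ∈ W ⊔ P.orthogonal W := by rw [hcompl.sup_eq_top]; trivial
  obtain ⟨u, hu, v, hv, rfl⟩ := Submodule.mem_sup.mp hx
  exact ⟨u, hu, v, rfl, hv⟩

lemma neighborSet_subset_insert_trans {V : Type*} (G : SimpleGraph V) {i j k : V}
    (hij : G.neighborSet i ⊆ insert j (G.neighborSet j))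
    (hjk : G.neighborSet j ⊆ insert k (G.neighborSet k)) :
    G.neighborSet i ⊆ insert k (G.neighborSet k) := by
  simp only [Set.subset_def, Set.mem_insert_iff, SimpleGraph.mem_neighborSet] at *
  intro x hx
  have h1 := hij x hx
  have h2 := hjk x
  have h3 := hjk i
  have h4 := hij k
  have hs : ∀ a b, G.Adj a b → G.Adj b a := fun _ _ h => h.symm
  grind

section

variable {n : ℕ} {G : SimpleGraph (Fin n)} {N : Type*} [LieRing N] [LieAlgebra ℝ N]
  {e : Fin n → N} {zb : G.edgeSet → N} {B : Module.Basis (Fin n ⊕ G.edgeSet) ℝ N}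

omit [LieAlgebra ℝ N] in
lemma lie_eq_zero_of_not_adj
    (hnonedge : ∀ (i j : Fin n), i < j → ¬ G.Adj i j → ⁅e i, e j⁆ = 0)
    {i j : Fin n} (h : ¬ G.Adj i j) : ⁅e i, e j⁆ = 0 := by
  rcases lt_trichotomy i j with hij | rfl | hij
  · exact hnonedge i j hij h
  · exact lie_self _
  · rw [← lie_skew, hnonedge j i hij fun h' => h h'.symm, neg_zero]

/-- The edge coordinate of a bracket, for an edge with ordered endpoints. -/
lemma coord_edge_lie (hB : ⇑B = Sum.elim e zb)
    (hcentral : ∀ (α : G.edgeSet) (x : N), ⁅zb α, x⁆ = 0)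
    (hedge : ∀ (i j : Fin n), i < j → ∀ h : G.Adj i j,
      ⁅e i, e j⁆ = zb ⟨s(i, j), G.mem_edgeSet.mpr h⟩)
    (hnonedge : ∀ (i j : Fin n), i < j → ¬ G.Adj i j → ⁅e i, e j⁆ = 0)
    {k l : Fin n} (hkl : k < l) (h : G.Adj k l) (x y : N) :
    B.coord (Sum.inr ⟨s(k, l), G.mem_edgeSet.mpr h⟩) ⁅x, y⁆ =
      B.coord (Sum.inl k) x * B.coord (Sum.inl l) y
        - B.coord (Sum.inl l) x * B.coord (Sum.inl k) y := by
  classical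
  set φ := B.coord (Sum.inr ⟨s(k, l), G.mem_edgeSet.mpr h⟩) with hφ
  have he (p : Fin n) : e p = B (Sum.inl p) := by simp [hB]
  have hz (α : G.edgeSet) : zb α = B (Sum.inr α) := by simp [hB]
  have hlt (p q : Fin n) (hpq : p < q) : φ ⁅e p, e q⁆ =
      B.coord (Sum.inl k) (e p) * B.coord (Sum.inl l) (e q)
        - B.coord (Sum.inl l) (e p) * B.coord (Sum.inl k) (e q) := by
    by_cases hadj : G.Adj p q
    · rw [hedge p q hpq hadj, hz, he, he, hφ]
      simp only [Module.Basis.coord_apply, Module.Basis.repr_self, Finsupp.single_apply,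
        Sum.inl.injEq, Sum.inr.injEq, Subtype.mk.injEq, Sym2.eq_iff]
      grind
    · rw [hnonedge p q hpq hadj, he, he, map_zero]
      simp only [Module.Basis.coord_apply, Module.Basis.repr_self, Finsupp.single_apply,
        Sum.inl.injEq]
      grind
  let L : N →ₗ[ℝ] N →ₗ[ℝ] ℝ := LinearMap.mk₂ ℝ (fun x y => φ ⁅x, y⁆)
    (by simp) (by simp) (by simp) (by simp)
  let R : N →ₗ[ℝ] N →ₗ[ℝ] ℝ := LinearMap.mk₂ ℝ (fun x y =>
      B.coord (Sum.inl k) x * B.coord (Sum.inl l) y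
        - B.coord (Sum.inl l) x * B.coord (Sum.inl k) y)
    (by intros; simp only [map_add]; ring)
    (by intros; simp only [map_smul, smul_eq_mul]; ring)
    (by intros; simp only [map_add]; ring)
    (by intros; simp only [map_smul, smul_eq_mul]; ring)
  suffices hLR : L = R from LinearMap.congr_fun (LinearMap.congr_fun hLR x) y
  refine B.ext fun p => B.ext fun q => ?_
  simp only [L, R, LinearMap.mk₂_apply]
  rcases p with p | α
  · rcases q with q | β
    · rw [← he, ← he]
      rcases lt_trichotomy p q with hpq | rfl | hpq
      · exact hlt p q hpq
      · rw [lie_self, map_zero]; ring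
      · rw [← lie_skew, map_neg, hlt q p hpq]; ring
    · rw [← lie_skew, ← hz, hcentral, neg_zero, map_zero]; simp [hz]
  · rw [← hz, hcentral, map_zero]; simp [hz]

/-- Each edge gives a linear functional that reads off a `2 × 2` minor from brackets. -/
lemma exists_functional_lie (hB : ⇑B = Sum.elim e zb)
    (hcentral : ∀ (α : G.edgeSet) (x : N), ⁅zb α, x⁆ = 0)
    (hedge : ∀ (i j : Fin n), i < j → ∀ h : G.Adj i j,
      ⁅e i, e j⁆ = zb ⟨s(i, j), G.mem_edgeSet.mpr h⟩)
    (hnonedge : ∀ (i j : Fin n), i < j → ¬ G.Adj i j → ⁅e i, e j⁆ = 0)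
    {k l : Fin n} (h : G.Adj k l) :
    ∃ φ : N →ₗ[ℝ] ℝ, ∀ x y : N, φ ⁅x, y⁆ =
      B.coord (Sum.inl k) x * B.coord (Sum.inl l) y
        - B.coord (Sum.inl l) x * B.coord (Sum.inl k) y := by
  rcases lt_trichotomy k l with hkl | rfl | hkl
  · exact ⟨_, coord_edge_lie hB hcentral hedge hnonedge hkl h⟩
  · exact (G.loopless.irrefl _ h).elim
  · refine ⟨-B.coord (Sum.inr ⟨s(l, k), G.mem_edgeSet.mpr h.symm⟩), fun x y => ?_⟩
    rw [LinearMap.neg_apply, coord_edge_lie hB hcentral hedge hnonedge hkl h.symm]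
    ring

omit [LieAlgebra ℝ N] in
/-- Every central basis vector is a bracket of vertex vectors. -/
lemma exists_lie_eq
    (hedge : ∀ (i j : Fin n), i < j → ∀ h : G.Adj i j,
      ⁅e i, e j⁆ = zb ⟨s(i, j), G.mem_edgeSet.mpr h⟩)
    (α : G.edgeSet) : ∃ p q : Fin n, ⁅e p, e q⁆ = zb α := by
  obtain ⟨α, hα⟩ := α
  induction α using Sym2.ind with
  | _ p q =>
    have h : G.Adj p q := hα
    rcases lt_trichotomy p q with hpq | rfl | hpq
    · exact ⟨p, q, hedge p q hpq h⟩
    · exact (G.loopless.irrefl _ h).elim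
    · exact ⟨q, p, (hedge q p hpq h.symm).trans (congrArg zb (Subtype.ext Sym2.eq_swap))⟩

/-- Brackets lie in the span of the central basis vectors. -/
lemma lie_mem_span (hB : ⇑B = Sum.elim e zb)
    (hcentral : ∀ (α : G.edgeSet) (x : N), ⁅zb α, x⁆ = 0)
    (hedge : ∀ (i j : Fin n), i < j → ∀ h : G.Adj i j,
      ⁅e i, e j⁆ = zb ⟨s(i, j), G.mem_edgeSet.mpr h⟩)
    (hnonedge : ∀ (i j : Fin n), i < j → ¬ G.Adj i j → ⁅e i, e j⁆ = 0) (x y : N) :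
    ⁅x, y⁆ ∈ Submodule.span ℝ (Set.range zb) := by
  have hlt (p q : Fin n) (hpq : p < q) : ⁅e p, e q⁆ ∈ Submodule.span ℝ (Set.range zb) := by
    by_cases h : G.Adj p q
    · rw [hedge p q hpq h]
      exact Submodule.subset_span ⟨_, rfl⟩
    · rw [hnonedge p q hpq h]
      exact zero_mem _
  have hx : x ∈ Submodule.span ℝ (Set.range B) := by simp [B.span_eq]
  have hy : y ∈ Submodule.span ℝ (Set.range B) := by simp [B.span_eq]
  induction hx using Submodule.span_induction with
  | zero => simp
  | add u v _ _ hu hv => rw [add_lie]; exact add_mem hu hv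
  | smul c u _ hu => rw [smul_lie]; exact Submodule.smul_mem _ c hu
  | mem u hu =>
    induction hy using Submodule.span_induction with
    | zero => simp
    | add v w _ _ hv hw => rw [lie_add]; exact add_mem hv hw
    | smul c v _ hv => rw [lie_smul]; exact Submodule.smul_mem _ c hv
    | mem v hv =>
      rw [hB] at hu hv
      obtain ⟨p | α, rfl⟩ := hu
      · obtain ⟨q | β, rfl⟩ := hv
        · simp only [Sum.elim_inl]
          rcases lt_trichotomy p q with hpq | rfl | hpq
          · exact hlt p q hpq
          · simp
          · rw [← lie_skew]; exact neg_mem (hlt q p hpq)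
        · rw [← lie_skew, Sum.elim_inr, hcentral]; simp
      · rw [Sum.elim_inr, hcentral]; simp

lemma coord_vertex_eq_zero_of_mem_span (hB : ⇑B = Sum.elim e zb) (l : Fin n) {x : N}
    (hx : x ∈ Submodule.span ℝ (Set.range zb)) : B.coord (Sum.inl l) x = 0 := by
  suffices h : Submodule.span ℝ (Set.range zb) ≤ LinearMap.ker (B.coord (Sum.inl l)) from h hx
  rw [Submodule.span_le]
  rintro _ ⟨α, rfl⟩
  have hz : zb α = B (Sum.inr α) := by simp [hB]
  simp [hz]

/-- A derivation maps `e k` into the span of the `e l` with `l ⪯ k`, modulo the derived algebra. -/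
lemma coord_derivation_vertex (hB : ⇑B = Sum.elim e zb)
    (hcentral : ∀ (α : G.edgeSet) (x : N), ⁅zb α, x⁆ = 0)
    (hedge : ∀ (i j : Fin n), i < j → ∀ h : G.Adj i j,
      ⁅e i, e j⁆ = zb ⟨s(i, j), G.mem_edgeSet.mpr h⟩)
    (hnonedge : ∀ (i j : Fin n), i < j → ¬ G.Adj i j → ⁅e i, e j⁆ = 0)
    {D : N →ₗ[ℝ] N} (hD : ∀ x y : N, D ⁅x, y⁆ = ⁅D x, y⁆ + ⁅x, D y⁆) {k l : Fin n}
    (hlk : ¬ G.neighborSet l ⊆ insert k (G.neighborSet k)) :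
    B.coord (Sum.inl l) (D (e k)) = 0 := by
  classical
  have he (p : Fin n) : e p = B (Sum.inl p) := by simp [hB]
  obtain ⟨m, hlm, hm⟩ := Set.not_subset.mp hlk
  simp only [Set.mem_insert_iff, SimpleGraph.mem_neighborSet, not_or] at hlm hm
  have hne : k ≠ l := by
    rintro rfl
    exact hm.2 hlm
  obtain ⟨φ, hφ⟩ := exists_functional_lie hB hcentral hedge hnonedge hlm
  have h := congrArg φ (hD (e k) (e m))
  rw [lie_eq_zero_of_not_adj hnonedge hm.2, map_zero, map_zero, map_add, hφ, hφ] at h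
  simpa [he, Finsupp.single_apply, hne, Ne.symm hm.1, hlm.ne, hlm.ne'] using h.symm

/-- The span of the derived algebra and of all `e k` with `k ⪯ i`, described by coordinates. -/
def downSpan (B : Module.Basis (Fin n ⊕ G.edgeSet) ℝ N) (i : Fin n) : Submodule ℝ N where
  carrier := {x | ∀ l, ¬ G.neighborSet l ⊆ insert i (G.neighborSet i) → B.coord (Sum.inl l) x = 0}
  zero_mem' := fun l _ => map_zero _
  add_mem' := fun hx hy l hl => by rw [map_add, hx l hl, hy l hl, add_zero]
  smul_mem' := fun c x hx l hl => by rw [map_smul, hx l hl, smul_zero]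

lemma derivation_mem_downSpan (hB : ⇑B = Sum.elim e zb)
    (hcentral : ∀ (α : G.edgeSet) (x : N), ⁅zb α, x⁆ = 0)
    (hedge : ∀ (i j : Fin n), i < j → ∀ h : G.Adj i j,
      ⁅e i, e j⁆ = zb ⟨s(i, j), G.mem_edgeSet.mpr h⟩)
    (hnonedge : ∀ (i j : Fin n), i < j → ¬ G.Adj i j → ⁅e i, e j⁆ = 0)
    {D : N →ₗ[ℝ] N} (hD : ∀ x y : N, D ⁅x, y⁆ = ⁅D x, y⁆ + ⁅x, D y⁆) {i : Fin n} {x : N}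
    (hx : x ∈ downSpan B i) : D x ∈ downSpan B i := by
  classical
  have : Fintype G.edgeSet := Fintype.ofFinite _
  intro l hl
  rw [← B.sum_repr x, map_sum, map_sum]
  refine Finset.sum_eq_zero fun p _ => ?_
  rw [map_smul, map_smul, hB]
  rcases p with k | α
  · by_cases hk : G.neighborSet k ⊆ insert i (G.neighborSet i)
    · rw [Sum.elim_inl, coord_derivation_vertex hB hcentral hedge hnonedge hD
        fun h => hl (neighborSet_subset_insert_trans G h hk), smul_zero]
    · have h := hx k hk
      rw [Module.Basis.coord_apply] at h
      rw [h, zero_smul]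
  · obtain ⟨p, q, hpq⟩ := exists_lie_eq hedge α
    rw [Sum.elim_inr, ← hpq, hD, coord_vertex_eq_zero_of_mem_span hB l (add_mem
      (lie_mem_span hB hcentral hedge hnonedge _ _)
      (lie_mem_span hB hcentral hedge hnonedge _ _)), smul_zero]

lemma mem_downSpan_of_mem_span (hB : ⇑B = Sum.elim e zb) (i : Fin n) {x : N}
    (hx : x ∈ Submodule.span ℝ (Set.range zb)) : x ∈ downSpan B i :=
  fun l _ => coord_vertex_eq_zero_of_mem_span hB l hx

lemma lie_eq_zero_of_mem_span (hcentral : ∀ (α : G.edgeSet) (x : N), ⁅zb α, x⁆ = 0) {x : N}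
    (hx : x ∈ Submodule.span ℝ (Set.range zb)) (y : N) : ⁅x, y⁆ = 0 := by
  induction hx using Submodule.span_induction with
  | zero => simp
  | add u v _ _ hu hv => rw [add_lie, hu, hv, add_zero]
  | smul c u _ hu => rw [smul_lie, hu, smul_zero]
  | mem u hu =>
    obtain ⟨α, rfl⟩ := hu
    exact hcentral α y

end

end GraphLie


/-- Let `𝔫` be the Lie algebra associated with a finite simple graph `𝒢`,
equipped with an inner product `(·,·)`; set `𝔷 = [𝔫,𝔫]`, `𝔞 = 𝔷^⊥`, and define `J_Z ∈ so(𝔞)`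
by `(J_Z X, Y) = (Z,[X,Y])`. Suppose that for every `X ∈ 𝔞` and `Z ∈ 𝔷` there exists a
derivation `D` of `𝔫`, skew-symmetric with respect to `(·,·)`, with `DZ = 0` and `DX = J_Z X`.
Then every edge `V_iV_j` of `𝒢` satisfies `i ∼ j`, i.e. `Ω'_i ⊆ Ω_j` and `Ω'_j ⊆ Ω_i`. -/
theorem adjacent_vertices_equivalent_of_geodesic_orbit {n : ℕ} (G : SimpleGraph (Fin n))
    {N : Type*} [LieRing N] [LieAlgebra ℝ N] [FiniteDimensional ℝ N]
    (e : Fin n → N) (zb : G.edgeSet → N)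
    (hcentral : ∀ (α : G.edgeSet) (x : N), ⁅zb α, x⁆ = 0)
    (hedge : ∀ (i j : Fin n), i < j → ∀ h : G.Adj i j,
      ⁅e i, e j⁆ = zb ⟨s(i, j), G.mem_edgeSet.mpr h⟩)
    (hnonedge : ∀ (i j : Fin n), i < j → ¬ G.Adj i j → ⁅e i, e j⁆ = 0)
    (hindep : LinearIndependent ℝ (Sum.elim e zb))
    (hgen : Submodule.span ℝ (Set.range (Sum.elim e zb)) = ⊤)
    (P : LinearMap.BilinForm ℝ N)
    (hPsym : ∀ x y : N, P x y = P y x)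
    (hPpos : ∀ x : N, x ≠ 0 → 0 < P x x)
    (z : Submodule ℝ N) (hz : z = Submodule.span ℝ {m : N | ∃ x y : N, ⁅x, y⁆ = m})
    (a : Submodule ℝ N) (ha : a = LinearMap.BilinForm.orthogonal P z)
    (J : z →ₗ[ℝ] (a →ₗ[ℝ] a))
    (hJ : ∀ (Z : z) (X Y : a), P (J Z X : N) (Y : N) = P (Z : N) ⁅(X : N), (Y : N)⁆)
    (hGO : ∀ (X : a) (Z : z), ∃ D : N →ₗ[ℝ] N,
      (∀ x y : N, D ⁅x, y⁆ = ⁅D x, y⁆ + ⁅x, D y⁆) ∧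
      (∀ x y : N, P (D x) y = - P x (D y)) ∧
      D (Z : N) = 0 ∧ D (X : N) = (J Z X : N)) :
    ∀ i j : Fin n, G.Adj i j →
      (G.neighborSet i ⊆ insert j (G.neighborSet j) ∧
       G.neighborSet j ⊆ insert i (G.neighborSet i)) := by
  classical
  let B : Module.Basis (Fin n ⊕ G.edgeSet) ℝ N := Module.Basis.mk hindep hgen.ge
  have hB : ⇑B = Sum.elim e zb := Module.Basis.coe_mk _ _
  have he (p : Fin n) : e p = B (Sum.inl p) := by simp [hB]
  have hlie (x y : N) : ⁅x, y⁆ ∈ z := by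
    rw [hz]
    exact Submodule.subset_span ⟨x, y, rfl⟩
  have hzle : z ≤ Submodule.span ℝ (Set.range zb) := by
    rw [hz, Submodule.span_le]
    rintro _ ⟨x, y, rfl⟩
    exact GraphLie.lie_mem_span hB hcentral hedge hnonedge x y
  have hcomm (i : Fin n) (x : N) (hx : x ∈ GraphLie.downSpan B i) (y : N)
      (hy : ∀ w ∈ GraphLie.downSpan B i, P w y = 0) : ⁅x, y⁆ = 0 := by
    have hya : y ∈ a := by
      rw [ha]
      exact fun w hw => hy w (GraphLie.mem_downSpan_of_mem_span hB i (hzle hw))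
    obtain ⟨u, hu, v, rfl, hv⟩ := GraphLie.exists_add_orthogonal P hPsym hPpos z x
    have hva : v ∈ a := by
      rw [ha]
      exact hv
    have hvW : v ∈ GraphLie.downSpan B i := by
      simpa using sub_mem hx (GraphLie.mem_downSpan_of_mem_span hB i (hzle hu))
    rw [add_lie, GraphLie.lie_eq_zero_of_mem_span hcentral (hzle hu), zero_add]
    by_contra hne
    obtain ⟨D, hD, -, -, hDJ⟩ := hGO ⟨v, hva⟩ ⟨⁅v, y⁆, hlie v y⟩
    have h := hJ ⟨⁅v, y⁆, hlie v y⟩ ⟨v, hva⟩ ⟨y, hya⟩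
    rw [← hDJ, hy _ (GraphLie.derivation_mem_downSpan hB hcentral hedge hnonedge hD hvW)] at h
    exact (hPpos _ hne).ne h
  have key (i j : Fin n) (h : G.Adj i j) : G.neighborSet j ⊆ insert i (G.neighborSet i) := by
    by_contra hji
    have hi : e i ∈ GraphLie.downSpan B i := by
      intro l hl
      have hne : i ≠ l := by
        rintro rfl
        exact hl (Set.subset_insert _ _)
      simp [he, hne]
    obtain ⟨u, hu, v, huv, hv⟩ :=
      GraphLie.exists_add_orthogonal P hPsym hPpos (GraphLie.downSpan B i) (e j)
    obtain ⟨φ, hφ⟩ := GraphLie.exists_functional_lie hB hcentral hedge hnonedge h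
    have h1 : ⁅e i, e j⁆ = ⁅e i, u⁆ := by rw [huv, lie_add, hcomm i _ hi v hv, add_zero]
    have h2 := congrArg φ h1
    rw [hφ, hφ, hu j hji] at h2
    simp [he, h.ne] at h2
  exact fun i j h => ⟨key j i h.symm, key i j h⟩
end

section
/- Let 𝒢 be a finite simple graph which is a disjoint union of complete graphs, 𝔫 the Lie algebra associated with 𝒢, and (·,·) a semi-standard inner product on 𝔫. Set 𝔷 = [𝔫,𝔫], 𝔞 = 𝔷^⊥, and define J_Z ∈ so(𝔞) by (J_Z X, Y) = (Z,[X,Y]). Then 𝒥 = span{J_Z : Z ∈ 𝔷} is a Lie subalgebra of so(𝔞, (·,·)) and, for every Z ∈ 𝔷, the operator J^{-1} ∘ ad_{J_Z} ∘ J ∈ End(𝔷) is skew-symmetric with respect to (·,·). -/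
open Classical in
/-- Each edge is `s(i, j)` for exactly two ordered pairs `(i, j)`. -/
lemma sum_ite_mk_eq_edge {n : ℕ} (G : SimpleGraph (Fin n)) (α : G.edgeSet) (c : ℝ) :
    ∑ i : Fin n, ∑ j : Fin n, (if s(i, j) = (α : Sym2 (Fin n)) then c else 0) = 2 * c := by
  obtain ⟨α, hα⟩ := α
  induction α using Sym2.ind with
  | _ u v =>
    have huv : u ≠ v := (G.mem_edgeSet.mp hα).ne
    have key : ∀ p : Fin n × Fin n,
        (if s(p.1, p.2) = s(u, v) then c else 0) =
          (if p = (u, v) then c else 0) + (if p = (v, u) then c else 0) := by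
      rintro ⟨i, j⟩
      by_cases h1 : i = u ∧ j = v
      · simp [h1.1, h1.2, huv]
      · by_cases h2 : i = v ∧ j = u
        · simp [h2.1, h2.2, huv.symm, Sym2.eq_swap]
        · simp [h1, h2]
    rw [← Fintype.sum_prod_type']
    simp only [key, Finset.sum_add_distrib, Finset.sum_ite_eq', Finset.mem_univ, if_true]
    ring

namespace IsStandardBasis

variable {n : ℕ} {G : SimpleGraph (Fin n)} {N : Type*} [LieRing N] [LieAlgebra ℝ N]
  {e : Fin n → N} {zb : G.edgeSet → N}

lemma lie_of_adj (h : IsStandardBasis G e zb) {i j : Fin n} (hij : G.Adj i j) :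
    ⁅e i, e j⁆ = zb ⟨s(i, j), G.mem_edgeSet.mpr hij⟩ ∨
      ⁅e i, e j⁆ = -zb ⟨s(i, j), G.mem_edgeSet.mpr hij⟩ := by
  rcases lt_trichotomy i j with hlt | rfl | hlt
  · exact Or.inl (h.2.1 i j hlt hij)
  · exact absurd hij (G.irrefl)
  · right
    rw [← lie_skew, h.2.1 j i hlt hij.symm]
    simp only [Sym2.eq_swap]

lemma lie_of_not_adj (h : IsStandardBasis G e zb) {i j : Fin n} (hij : ¬ G.Adj i j) :
    ⁅e i, e j⁆ = 0 := by
  rcases lt_trichotomy i j with hlt | rfl | hlt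
  · exact h.2.2.1 i j hlt hij
  · exact lie_self _
  · rw [← lie_skew, h.2.2.1 j i hlt fun hji => hij hji.symm, neg_zero]

lemma lie_mem_span (h : IsStandardBasis G e zb) (x y : N) :
    ⁅x, y⁆ ∈ Submodule.span ℝ (Set.range zb) := by
  have hx : x ∈ Submodule.span ℝ (Set.range (Sum.elim e zb)) := h.2.2.2.2 ▸ Submodule.mem_top
  have hy : y ∈ Submodule.span ℝ (Set.range (Sum.elim e zb)) := h.2.2.2.2 ▸ Submodule.mem_top
  induction hx, hy using Submodule.span_induction₂ with
  | mem_mem x y hx hy =>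
    obtain ⟨s, rfl⟩ := hx
    obtain ⟨t, rfl⟩ := hy
    rcases s with i | α
    · rcases t with j | β
      · by_cases hij : G.Adj i j
        · have hm : zb ⟨s(i, j), G.mem_edgeSet.mpr hij⟩ ∈ Submodule.span ℝ (Set.range zb) :=
            Submodule.subset_span ⟨_, rfl⟩
          rcases h.lie_of_adj hij with hl | hl
          · simpa [hl] using hm
          · simpa [hl] using hm
        · simp [h.lie_of_not_adj hij]
      · have : ⁅e i, zb β⁆ = 0 := by rw [← lie_skew, h.1, neg_zero]
        simp [this]
    · simp [h.1]
  | zero_left y _ => simp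
  | zero_right x _ => simp
  | add_left x y z _ _ _ h1 h2 => rw [add_lie]; exact add_mem h1 h2
  | add_right x y z _ _ _ h1 h2 => rw [lie_add]; exact add_mem h1 h2
  | smul_left r x y _ _ h1 => rw [smul_lie]; exact Submodule.smul_mem _ _ h1
  | smul_right r x y _ _ h1 => rw [lie_smul]; exact Submodule.smul_mem _ _ h1

lemma span_lie_eq (h : IsStandardBasis G e zb) :
    Submodule.span ℝ {m : N | ∃ x y : N, ⁅x, y⁆ = m} = Submodule.span ℝ (Set.range zb) := by
  apply le_antisymm
  · rw [Submodule.span_le]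
    rintro m ⟨x, y, rfl⟩
    exact h.lie_mem_span x y
  · rw [Submodule.span_le]
    rintro m ⟨⟨α, hα⟩, rfl⟩
    induction α using Sym2.ind with
    | _ u v =>
      have hadj : G.Adj u v := hα
      rcases h.lie_of_adj hadj with hl | hl
      · exact Submodule.subset_span ⟨_, _, hl⟩
      · refine Submodule.subset_span ⟨e v, e u, ?_⟩
        rw [← lie_skew, hl, neg_neg]

lemma exists_add (h : IsStandardBasis G e zb) (x : N) :
    ∃ (X : Submodule.span ℝ (Set.range e)) (Z : Submodule.span ℝ (Set.range zb)),
      (X : N) + (Z : N) = x := by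
  have hx : x ∈ Submodule.span ℝ (Set.range (Sum.elim e zb)) := h.2.2.2.2 ▸ Submodule.mem_top
  rw [Set.Sum.elim_range, Submodule.span_union, Submodule.mem_sup] at hx
  obtain ⟨y, hy, w, hw, rfl⟩ := hx
  exact ⟨⟨y, hy⟩, ⟨w, hw⟩, rfl⟩

open Classical in
/-- The standard inner product corresponds to the trace form under `J⁰`. -/
lemma traceForm_eq (h : IsStandardBasis G e zb) {Q : LinearMap.BilinForm ℝ N}
    (hQ : ∀ s t : Fin n ⊕ G.edgeSet,
      Q (Sum.elim e zb s) (Sum.elim e zb t) = if s = t then 1 else 0)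
    {J0 : (Submodule.span ℝ (Set.range zb)) →ₗ[ℝ]
        ((Submodule.span ℝ (Set.range e)) →ₗ[ℝ] (Submodule.span ℝ (Set.range e)))}
    (hJ0 : ∀ (Z : Submodule.span ℝ (Set.range zb)) (X Y : Submodule.span ℝ (Set.range e)),
        Q (J0 Z X : N) (Y : N) = Q (Z : N) ⁅(X : N), (Y : N)⁆)
    (Z W : Submodule.span ℝ (Set.range zb)) :
    traceForm (J0 Z) (J0 W) = Q (Z : N) (W : N) := by
  have hli : LinearIndependent ℝ e := h.2.2.2.1.comp Sum.inl Sum.inl_injective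
  let b := Module.Basis.span hli
  have hb : ∀ i, (b i : N) = e i := fun i => congrArg Subtype.val (Module.Basis.span_apply hli i)
  have hQe : ∀ i j, Q (e i) (e j) = if i = j then 1 else 0 := fun i j => by
    simpa using hQ (Sum.inl i) (Sum.inl j)
  have hQz : ∀ α β, Q (zb α) (zb β) = if α = β then 1 else 0 := fun α β => by
    simpa using hQ (Sum.inr α) (Sum.inr β)
  have hrepr : ∀ (x : Submodule.span ℝ (Set.range e)) i, b.repr x i = Q (x : N) (e i) := by
    intro x i
    conv_rhs => rw [← b.sum_repr x]
    simp only [Submodule.coe_sum, Submodule.coe_smul, hb, map_sum, map_smul,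
      LinearMap.sum_apply, LinearMap.smul_apply, hQe]
    simp
  have hentry : ∀ (V : Submodule.span ℝ (Set.range zb)) i j,
      LinearMap.toMatrix b b (J0 V) i j = Q (V : N) ⁅e j, e i⁆ := by
    intro V i j
    rw [LinearMap.toMatrix_apply, hrepr, ← hb i, hJ0, hb, hb]
  have hsum : ∑ α : G.edgeSet, Q (Z : N) (zb α) * Q (W : N) (zb α) = Q (Z : N) (W : N) := by
    have hW := W.2
    generalize (W : N) = W at hW
    induction hW using Submodule.span_induction with
    | mem x hx =>
      obtain ⟨β, rfl⟩ := hx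
      simp [hQz]
    | zero => simp
    | add x y _ _ hx hy =>
      simp only [map_add, LinearMap.add_apply, mul_add, Finset.sum_add_distrib, hx, hy]
    | smul r x _ hx =>
      simp only [map_smul, LinearMap.smul_apply, smul_eq_mul, mul_left_comm _ r,
        ← Finset.mul_sum, hx]
  have hF : ∀ i j, Q (Z : N) ⁅e i, e j⁆ * Q (W : N) ⁅e i, e j⁆ =
      ∑ α : G.edgeSet, if s(i, j) = (α : Sym2 (Fin n)) then Q Z (zb α) * Q W (zb α) else 0 := by
    intro i j
    by_cases hij : G.Adj i j
    · rw [Finset.sum_eq_single ⟨s(i, j), G.mem_edgeSet.mpr hij⟩]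
      · rcases h.lie_of_adj hij with hl | hl <;> simp [hl]
      · intro β _ hβ
        rw [if_neg]
        rintro hs
        exact hβ (Subtype.ext hs.symm)
      · simp
    · rw [h.lie_of_not_adj hij, Finset.sum_eq_zero]
      · simp
      · rintro ⟨α, hα⟩ _
        rw [if_neg]
        rintro rfl
        exact hij hα
  have htr : LinearMap.trace ℝ _ (J0 Z ∘ₗ J0 W) =
      -∑ i, ∑ j, Q (Z : N) ⁅e i, e j⁆ * Q (W : N) ⁅e i, e j⁆ := by
    rw [LinearMap.trace_eq_matrix_trace ℝ b, LinearMap.toMatrix_comp b b b, Matrix.trace]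
    simp only [Matrix.diag_apply, Matrix.mul_apply, hentry, ← Finset.sum_neg_distrib]
    refine Finset.sum_congr rfl fun i _ => Finset.sum_congr rfl fun j _ => ?_
    rw [← lie_skew (e j) (e i), map_neg, neg_mul]
  have hdouble : ∑ i, ∑ j, Q (Z : N) ⁅e i, e j⁆ * Q (W : N) ⁅e i, e j⁆ =
      2 * Q (Z : N) (W : N) := by
    simp only [hF]
    rw [← hsum, Finset.mul_sum, ← Fintype.sum_prod_type', Finset.sum_comm]
    refine Finset.sum_congr rfl fun α _ => ?_
    rw [Fintype.sum_prod_type, sum_ite_mk_eq_edge]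
  rw [traceForm, htr, hdouble]
  ring

end IsStandardBasis

section traceForm

variable {V : Type*} [AddCommGroup V] [Module ℝ V]

lemma traceForm_comm (K L : V →ₗ[ℝ] V) : traceForm K L = traceForm L K := by
  unfold traceForm
  rw [← Module.End.mul_eq_comp, LinearMap.trace_mul_comm, Module.End.mul_eq_comp]

lemma traceForm_commutator_s2 (K L M : V →ₗ[ℝ] V) :
    traceForm (K ∘ₗ L - L ∘ₗ K) M = -traceForm L (K ∘ₗ M - M ∘ₗ K) := by
  have hcyc := LinearMap.trace_mul_comm ℝ K (L * M)
  simp only [traceForm, ← Module.End.mul_eq_comp, sub_mul, mul_sub, map_sub] at hcyc ⊢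
  simp only [mul_assoc] at hcyc ⊢
  rw [hcyc]
  ring

end traceForm

section ScalarOnIdeals

variable {V ι : Type*} [AddCommGroup V] [Module ℝ V] {I : ι → Submodule ℝ (V →ₗ[ℝ] V)}
  {lam : ι → ℝ} {Φ : (V →ₗ[ℝ] V) →ₗ[ℝ] (V →ₗ[ℝ] V)}

lemma commutator_mem_iSup
    (hI : ∀ μ K L, K ∈ ⨆ ν, I ν → L ∈ I μ → K ∘ₗ L - L ∘ₗ K ∈ I μ)
    {K L : V →ₗ[ℝ] V} (hK : K ∈ ⨆ ν, I ν) (hL : L ∈ ⨆ ν, I ν) :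
    K ∘ₗ L - L ∘ₗ K ∈ ⨆ ν, I ν := by
  induction hL using Submodule.iSup_induction' with
  | mem μ L hL => exact Submodule.mem_iSup_of_mem μ (hI μ K L hK hL)
  | zero => simp
  | add L M _ _ h1 h2 =>
    have : K ∘ₗ (L + M) - (L + M) ∘ₗ K = (K ∘ₗ L - L ∘ₗ K) + (K ∘ₗ M - M ∘ₗ K) := by
      rw [LinearMap.comp_add, LinearMap.add_comp]; abel
    rw [this]
    exact add_mem h1 h2

lemma map_commutator_of_smul_on_ideals
    (hI : ∀ μ K L, K ∈ ⨆ ν, I ν → L ∈ I μ → K ∘ₗ L - L ∘ₗ K ∈ I μ)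
    (hΦ : ∀ μ, ∀ K ∈ I μ, Φ K = lam μ • K)
    {K L : V →ₗ[ℝ] V} (hK : K ∈ ⨆ ν, I ν) (hL : L ∈ ⨆ ν, I ν) :
    Φ (K ∘ₗ L - L ∘ₗ K) = K ∘ₗ Φ L - Φ L ∘ₗ K := by
  induction hL using Submodule.iSup_induction' with
  | mem μ L hL =>
    rw [hΦ μ _ (hI μ K L hK hL), hΦ μ L hL, LinearMap.comp_smul, LinearMap.smul_comp, smul_sub]
  | zero => simp
  | add L M _ _ h1 h2 =>
    have : K ∘ₗ (L + M) - (L + M) ∘ₗ K = (K ∘ₗ L - L ∘ₗ K) + (K ∘ₗ M - M ∘ₗ K) := by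
      rw [LinearMap.comp_add, LinearMap.add_comp]; abel
    rw [this, map_add, h1, h2, map_add, LinearMap.comp_add, LinearMap.add_comp]
    abel

lemma map_iSup_of_smul_on_ideals (hlam : ∀ μ, 0 < lam μ)
    (hΦ : ∀ μ, ∀ K ∈ I μ, Φ K = lam μ • K) :
    (⨆ ν, I ν).map Φ = ⨆ ν, I ν := by
  rw [Submodule.map_iSup]
  congr 1
  funext μ
  ext K
  constructor
  · rintro ⟨L, hL, rfl⟩
    rw [hΦ μ L hL]
    exact Submodule.smul_mem _ _ hL
  · intro hK
    refine ⟨(lam μ)⁻¹ • K, Submodule.smul_mem _ _ hK, ?_⟩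
    rw [map_smul, hΦ μ K hK, smul_smul, inv_mul_cancel₀ (hlam μ).ne', one_smul]

end ScalarOnIdeals

/-- Let `𝒢` be a disjoint union of complete graphs, `𝔫` the associated Lie
algebra and `(·,·)` a semi-standard inner product on `𝔫`; `𝔷 = [𝔫,𝔫]`, `𝔞 = 𝔷^⊥`, `J_Z`
defined by `(J_Z X, Y) = (Z,[X,Y])`. Then `𝒥 = span{J_Z}` is a Lie subalgebra of
`so(𝔞, (·,·))` and for every `Z ∈ 𝔷` the operator `J⁻¹ ∘ ad_{J_Z} ∘ J ∈ End(𝔷)` is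
skew-symmetric with respect to `(·,·)`. -/
theorem semistandard_is_naturally_reductive {n : ℕ} (G : SimpleGraph (Fin n))
    (hG : IsDisjointUnionOfCompleteGraphs G)
    {N : Type*} [LieRing N] [LieAlgebra ℝ N] [FiniteDimensional ℝ N]
    (e0 : Fin n → N) (zb0 : G.edgeSet → N) (hassoc : IsStandardBasis G e0 zb0)
    (P : LinearMap.BilinForm ℝ N)
    (hPsym : ∀ x y : N, P x y = P y x)
    (hPpos : ∀ x : N, x ≠ 0 → 0 < P x x)
    (hss : IsSemiStandard G P)
    (z : Submodule ℝ N) (hz : z = Submodule.span ℝ {m : N | ∃ x y : N, ⁅x, y⁆ = m})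
    (a : Submodule ℝ N) (ha : a = LinearMap.BilinForm.orthogonal P z)
    (J : z →ₗ[ℝ] (a →ₗ[ℝ] a))
    (hJ : ∀ (Z : z) (X Y : a), P (J Z X : N) (Y : N) = P (Z : N) ⁅(X : N), (Y : N)⁆) :
    -- `𝒥` is a Lie subalgebra of `so(𝔞, (·,·))` …
    ((∀ K ∈ Submodule.span ℝ (Set.range fun Z : z => J Z),
        ∀ x y : a, P (K x : N) (y : N) = - P (x : N) (K y : N)) ∧
      (∀ K L : a →ₗ[ℝ] a, K ∈ Submodule.span ℝ (Set.range fun Z : z => J Z) →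
        L ∈ Submodule.span ℝ (Set.range fun Z : z => J Z) →
        K ∘ₗ L - L ∘ₗ K ∈ Submodule.span ℝ (Set.range fun Z : z => J Z))) ∧
    -- … and `J⁻¹ ∘ ad_{J_Z} ∘ J` is skew-symmetric with respect to `(·,·)` for every `Z`
    (∀ Z : z, ∃ T : z →ₗ[ℝ] z,
      (∀ W : z, J (T W) = (J Z) ∘ₗ (J W) - (J W) ∘ₗ (J Z)) ∧
      (∀ W W' : z, P (T W : N) (W' : N) = - P (W : N) (T W' : N))) := by
  obtain ⟨e, zb, Q, hstd, hQ, J0, hJ0, k, I, lam, Φ, hlam, hsup, -, hI, -, hΦ, hP⟩ := hss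
  have hspan : Submodule.span ℝ (Set.range fun Z => J0 Z) = LinearMap.range J0 := by
    rw [← LinearMap.coe_range, Submodule.span_eq]
  rw [← hsup] at hI
  rw [hspan] at hsup
  have hPA : ∀ X Y : Submodule.span ℝ (Set.range e), P (X : N) (Y : N) = Q (X : N) (Y : N) := by
    intro X Y
    simpa [traceForm] using hP X Y 0 0
  have hPZ : ∀ Z W : Submodule.span ℝ (Set.range zb),
      P (Z : N) (W : N) = traceForm (Φ (J0 Z)) (J0 W) := by
    intro Z W
    simpa using hP 0 0 Z W
  have hPAZ : ∀ (X : Submodule.span ℝ (Set.range e)) (Z : Submodule.span ℝ (Set.range zb)),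
      P (Z : N) (X : N) = 0 := by
    intro X Z
    simpa [traceForm] using hP 0 X Z 0
  have hP0 : ∀ x : N, P x x = 0 → x = 0 := by
    intro x hx
    by_contra hne
    exact (hPpos x hne).ne' hx
  have hz' : z = Submodule.span ℝ (Set.range zb) := hz.trans hstd.span_lie_eq
  clear hz
  subst hz'
  have ha' : a = Submodule.span ℝ (Set.range e) := by
    rw [ha]
    ext x
    rw [LinearMap.BilinForm.mem_orthogonal_iff]
    constructor
    · intro hx
      obtain ⟨X, Z, rfl⟩ := hstd.exists_add x
      have h1 : P (Z : N) ((X : N) + (Z : N)) = 0 := hx Z Z.2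
      rw [map_add, hPAZ, zero_add] at h1
      rw [hP0 _ h1, add_zero]
      exact X.2
    · intro hx w hw
      exact hPAZ ⟨x, hx⟩ ⟨w, hw⟩
  clear ha
  subst ha'
  have hJΦ : ∀ Z, J Z = Φ (J0 Z) := by
    intro Z
    obtain ⟨Z', hZ'⟩ : Φ (J0 Z) ∈ LinearMap.range J0 := by
      rw [← hsup, ← map_iSup_of_smul_on_ideals hlam hΦ, hsup]
      exact ⟨_, ⟨Z, rfl⟩, rfl⟩
    have key : ∀ X Y : Submodule.span ℝ (Set.range e), P (J Z X : N) (Y : N) = P (Φ (J0 Z) X : N) (Y : N) := by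
      intro X Y
      rw [hJ, hPZ Z ⟨_, hstd.lie_mem_span X Y⟩, ← hZ', hstd.traceForm_eq hQ hJ0, hPA, hJ0]
    ext X
    rw [← sub_eq_zero]
    apply hP0
    rw [map_sub P, LinearMap.sub_apply, sub_eq_zero]
    exact key X (J Z X - Φ (J0 Z) X)
  have hJrange : LinearMap.range J = ⨆ μ, I μ := by
    have : J = Φ ∘ₗ J0 := LinearMap.ext hJΦ
    rw [this, LinearMap.range_comp, ← hsup, map_iSup_of_smul_on_ideals hlam hΦ]
  have hspanJ : Submodule.span ℝ (Set.range fun Z => J Z) = ⨆ μ, I μ := by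
    rw [← hJrange, ← LinearMap.coe_range, Submodule.span_eq]
  have hJinj : Function.Injective J := by
    rw [injective_iff_map_eq_zero]
    intro W hW
    apply Subtype.ext
    apply hP0
    rw [hPZ, ← hJΦ, hW]
    simp [traceForm]
  have hJmem : ∀ Z, J Z ∈ ⨆ μ, I μ := fun Z => hJrange ▸ LinearMap.mem_range_self J Z
  have hJ0mem : ∀ Z, J0 Z ∈ ⨆ μ, I μ := fun Z => hsup ▸ LinearMap.mem_range_self J0 Z
  refine ⟨⟨?_, ?_⟩, ?_⟩
  · intro K hK x y
    rw [hspanJ, ← hJrange] at hK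
    obtain ⟨Z, rfl⟩ := hK
    rw [hPsym x, hJ, hJ, ← lie_skew, map_neg]
  · intro K L hK hL
    rw [hspanJ] at hK hL ⊢
    exact commutator_mem_iSup hI hK hL
  · intro Z
    have hcomm : ∀ W, J Z ∘ₗ J W - J W ∘ₗ J Z ∈ LinearMap.range J := fun W =>
      hJrange ▸ commutator_mem_iSup hI (hJmem Z) (hJmem W)
    let adJ := (LinearMap.mulLeft ℝ (J Z) - LinearMap.mulRight ℝ (J Z)) ∘ₗ J
    let T := (LinearEquiv.ofInjective J hJinj).symm.toLinearMap ∘ₗ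
      adJ.codRestrict (LinearMap.range J) hcomm
    have hT : ∀ W, J (T W) = J Z ∘ₗ J W - J W ∘ₗ J Z := fun W =>
      congrArg Subtype.val ((LinearEquiv.ofInjective J hJinj).apply_symm_apply
        (adJ.codRestrict (LinearMap.range J) hcomm W))
    refine ⟨T, hT, fun W W' => ?_⟩
    have hsymm : ∀ K L, K ∈ ⨆ μ, I μ → L ∈ ⨆ μ, I μ → traceForm (Φ K) L = traceForm K (Φ L) := by
      intro K L hK hL
      rw [hsup] at hK hL
      obtain ⟨A, rfl⟩ := hK
      obtain ⟨B, rfl⟩ := hL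
      rw [← hPZ, hPsym, hPZ, traceForm_comm]
    calc P (T W : N) (W' : N)
        = traceForm (J Z ∘ₗ Φ (J0 W) - Φ (J0 W) ∘ₗ J Z) (J0 W') := by
          rw [hPZ, ← hJΦ, hT, hJΦ W]
      _ = traceForm (J Z ∘ₗ J0 W - J0 W ∘ₗ J Z) (Φ (J0 W')) := by
          rw [← map_commutator_of_smul_on_ideals hI hΦ (hJmem Z) (hJ0mem W),
            hsymm _ _ (commutator_mem_iSup hI (hJmem Z) (hJ0mem W)) (hJ0mem W')]
      _ = -traceForm (J0 W) (J (T W')) := by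
          rw [traceForm_commutator_s2, hT, hJΦ W']
      _ = -P (W : N) (T W' : N) := by
          rw [hPsym, hPZ, ← hJΦ, traceForm_comm]
end

section
/- Let (𝔫, (·,·)) be a finite-dimensional real two-step nilpotent metric Lie algebra, 𝔷 = [𝔫,𝔫], 𝔞 = 𝔷^⊥, and let J_Z ∈ so(𝔞) be defined by (J_Z X, Y) = (Z,[X,Y]). Let D ∈ End(𝔫) be skew-symmetric with respect to (·,·). Then D is a derivation of 𝔫 if and only if both 𝔞 and 𝔷 are D-invariant and, for every Z ∈ 𝔷, J_{DZ} = [D_𝔞, J_Z], where D_𝔞 denotes the restriction of D to 𝔞. -/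
/-- Let `(𝔫, (·,·))` be a finite-dimensional real two-step nilpotent metric Lie
algebra, `𝔷 = [𝔫,𝔫]`, `𝔞 = 𝔷^⊥`, `J_Z` defined by `(J_Z X, Y) = (Z,[X,Y])`, and let
`D ∈ End(𝔫)` be skew-symmetric with respect to `(·,·)`. Then `D` is a derivation of `𝔫` if and
only if both `𝔞` and `𝔷` are `D`-invariant and, for every `Z ∈ 𝔷`,
`J_{DZ} = [D_𝔞, J_Z]`, where `D_𝔞` is the restriction of `D` to `𝔞`. -/
theorem skew_derivation_iff_bracket_identity {N : Type*} [LieRing N] [LieAlgebra ℝ N]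
    [FiniteDimensional ℝ N]
    (htwostep : ∀ x y w : N, ⁅x, ⁅y, w⁆⁆ = 0)
    (P : LinearMap.BilinForm ℝ N)
    (hPsym : ∀ x y : N, P x y = P y x)
    (hPpos : ∀ x : N, x ≠ 0 → 0 < P x x)
    (z : Submodule ℝ N) (hz : z = Submodule.span ℝ {m : N | ∃ x y : N, ⁅x, y⁆ = m})
    (a : Submodule ℝ N) (ha : a = LinearMap.BilinForm.orthogonal P z)
    (J : z →ₗ[ℝ] (a →ₗ[ℝ] a))
    (hJ : ∀ (Z : z) (X Y : a), P (J Z X : N) (Y : N) = P (Z : N) ⁅(X : N), (Y : N)⁆)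
    (D : N →ₗ[ℝ] N) (hDskew : ∀ x y : N, P (D x) y = - P x (D y)) :
    (∀ x y : N, D ⁅x, y⁆ = ⁅D x, y⁆ + ⁅x, D y⁆) ↔
      ∃ (hinva : ∀ x ∈ a, D x ∈ a) (hinvz : ∀ x ∈ z, D x ∈ z),
        ∀ Z : z, J ⟨D (Z : N), hinvz (Z : N) Z.2⟩ =
          (D.restrict hinva) ∘ₗ (J Z) - (J Z) ∘ₗ (D.restrict hinva) := by
  have eq_zero_of_self : ∀ v : N, P v v = 0 → v = 0 := fun v hv => by
    by_contra hne
    exact (hPpos v hne).ne' hv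
  have mem_a : ∀ x : N, x ∈ a ↔ ∀ n ∈ z, P n x = 0 := fun x => by
    rw [ha]
    exact LinearMap.BilinForm.mem_orthogonal_iff
  have lie_mem : ∀ x y : N, ⁅x, y⁆ ∈ z := fun x y => by
    rw [hz]
    exact Submodule.subset_span ⟨x, y, rfl⟩
  have lie_z : ∀ x : N, ∀ w ∈ z, ⁅x, w⁆ = 0 := fun x w hw => by
    rw [hz] at hw
    induction hw using Submodule.span_induction with
    | mem m hm =>
      obtain ⟨u, v, rfl⟩ := hm
      exact htwostep x u v
    | zero => exact lie_zero x
    | add u v _ _ hu hv => rw [lie_add, hu, hv, add_zero]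
    | smul c u _ hu => rw [lie_smul, hu, smul_zero]
  have z_lie : ∀ w ∈ z, ∀ x : N, ⁅w, x⁆ = 0 := fun w hw x => by
    rw [← lie_skew, lie_z x w hw, neg_zero]
  constructor
  · intro hD
    have hinvz : ∀ x ∈ z, D x ∈ z := fun x hx => by
      have hle : z ≤ z.comap D := by
        conv_lhs => rw [hz]
        rw [Submodule.span_le]
        rintro _ ⟨u, v, rfl⟩
        change D ⁅u, v⁆ ∈ z
        rw [hD]
        exact z.add_mem (lie_mem _ _) (lie_mem _ _)
      exact hle hx
    have hinva : ∀ x ∈ a, D x ∈ a := fun x hx => by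
      rw [mem_a] at hx ⊢
      intro n hn
      have h := hDskew n x
      rw [hx _ (hinvz n hn)] at h
      linarith
    refine ⟨hinva, hinvz, fun Z => ?_⟩
    have hform : ∀ X Y : a, P ((J ⟨D (Z : N), hinvz (Z : N) Z.2⟩ X : a) : N) Y =
        P (D (J Z X : N)) Y - P (J Z (D.restrict hinva X) : N) Y := fun X Y => by
      have h := hJ Z X (D.restrict hinva Y)
      rw [LinearMap.coe_restrict_apply] at h
      rw [hJ, hJ, hDskew, hDskew, hD, map_add, h, LinearMap.coe_restrict_apply]
      ring
    ext X
    rw [← sub_eq_zero]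
    have key : ∀ Y : a, P (((J ⟨D (Z : N), hinvz (Z : N) Z.2⟩ X : a) : N) -
        (D (J Z X : N) - (J Z (D.restrict hinva X) : N))) Y = 0 := fun Y => by
      simp only [map_sub, LinearMap.sub_apply, hform]
      ring
    exact eq_zero_of_self _ (key (J ⟨D (Z : N), hinvz (Z : N) Z.2⟩ X -
      (D.restrict hinva (J Z X) - J Z (D.restrict hinva X))))
  · rintro ⟨hinva, hinvz, hbr⟩
    have on_a : ∀ x ∈ a, ∀ y ∈ a, D ⁅x, y⁆ = ⁅D x, y⁆ + ⁅x, D y⁆ := fun x hx y hy => by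
      have key : ∀ w ∈ z, P w (D ⁅x, y⁆ - (⁅D x, y⁆ + ⁅x, D y⁆)) = 0 := fun w hw => by
        have h := congrArg (fun v : a => P (v : N) y) (LinearMap.congr_fun (hbr ⟨w, hw⟩) ⟨x, hx⟩)
        have h₁ := hJ ⟨D w, hinvz w hw⟩ ⟨x, hx⟩ ⟨y, hy⟩
        have h₂ := hJ ⟨w, hw⟩ ⟨x, hx⟩ ⟨D y, hinva y hy⟩
        have h₃ := hJ ⟨w, hw⟩ ⟨D x, hinva x hx⟩ ⟨y, hy⟩
        have h₄ := hDskew (J ⟨w, hw⟩ ⟨x, hx⟩ : N) y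
        have h₅ := hDskew w ⁅x, y⁆
        change P (J ⟨D w, hinvz w hw⟩ ⟨x, hx⟩ : N) y =
          P (D (J ⟨w, hw⟩ ⟨x, hx⟩ : N) - (J ⟨w, hw⟩ ⟨D x, hinva x hx⟩ : N)) y at h
        simp only [map_sub, map_add, LinearMap.sub_apply] at h h₁ h₂ h₃ ⊢
        linarith
      exact sub_eq_zero.mp (eq_zero_of_self _ (key _ (z.sub_mem (hinvz _ (lie_mem _ _))
        (z.add_mem (lie_mem _ _) (lie_mem _ _)))))
    have hcompl : IsCompl z a := by
      rw [ha]
      refine LinearMap.BilinForm.isCompl_orthogonal_of_restrict_nondegenerate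
        (fun x y h => (hPsym y x).trans h) ?_
      refine ⟨fun x hx => ?_, fun x hx => ?_⟩ <;>
      exact Subtype.ext (eq_zero_of_self _ (hx x))
    have decomp : ∀ x : N, ∃ u ∈ z, ∃ v ∈ a, u + v = x := fun x =>
      Submodule.mem_sup.mp (hcompl.sup_eq_top ▸ Submodule.mem_top)
    intro x y
    obtain ⟨u, hu, v, hv, rfl⟩ := decomp x
    obtain ⟨u', hu', v', hv', rfl⟩ := decomp y
    simp only [map_add, add_lie, lie_add, z_lie u hu, lie_z _ u' hu', z_lie _ (hinvz u hu),
      lie_z _ _ (hinvz u' hu'), zero_add, on_a v hv v' hv']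
end

section
/- Let (V, ⟨·,·⟩) be a finite-dimensional real inner product space and J ∈ so(V) a skew-symmetric operator of rank r all of whose nonzero complex eigenvalues are pairwise distinct. Then the centraliser of J in so(V) is the direct sum Span(J, J^3, …, J^{r−1}) ⊕ { Q ∈ so(V) : QJ = 0 }; that is, a skew-symmetric operator D commutes with J if and only if D = α_1 J + α_3 J^3 + ⋯ + α_{r−1} J^{r−1} + Q for some real coefficients α_i and some Q ∈ so(V) with QJ = 0, and this decomposition is unique. -/
open scoped RealInnerProductSpace

open Polynomial

namespace Module.End

variable {K V : Type*} [Field K] [AddCommGroup V] [Module K V]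

/-- An operator commuting with `J` agrees on a `J`-cyclic range with a polynomial in `J`. -/
theorem exists_mul_eq_aeval_mul_of_commute {J D : Module.End K V} {S : Submodule K K[X]} {w : V}
    (hw : ∀ v : V, ∃ q ∈ S, aeval J q (J w) = J v) (hD : Commute D J) :
    ∃ p ∈ S, D * J = aeval J p * J := by
  obtain ⟨p, hp, hpw⟩ := hw (D w)
  refine ⟨p, hp, LinearMap.ext fun v ↦ ?_⟩
  obtain ⟨q, -, hq⟩ := hw v
  have hDq : Commute D (aeval J q) := by
    refine q.induction_on' (fun a b ha hb ↦ ?_) fun n a ↦ ?_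
    · simpa using ha.add_right hb
    · simpa [aeval_monomial, ← Algebra.smul_def] using (hD.pow_right n).smul_right a
  have hpq : Commute (aeval J p) (aeval J q) := Commute.all p q |>.map (aeval J)
  calc D (J v) = (D * aeval J q) (J w) := by rw [← hq]; rfl
    _ = aeval J q ((D * J) w) := by rw [hDq.eq]; rfl
    _ = aeval J q (aeval J p (J w)) := by rw [hD.eq, hpw]; rfl
    _ = (aeval J p * aeval J q) (J w) := by rw [hpq.eq]; rfl
    _ = aeval J p (J v) := by rw [← hq]; rfl

variable [FiniteDimensional K V]

/-- Every irreducible factor of the characteristic polynomial divides the minimal polynomial. -/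
theorem irreducible_dvd_minpoly_of_dvd_charpoly (J : Module.End K V) {p : K[X]}
    (hp : Irreducible p) (hpJ : p ∣ J.charpoly) : p ∣ minpoly K J := by
  let b := Module.Free.chooseBasis K V
  let L := AlgebraicClosure K
  let A := (LinearMap.toMatrixAlgEquiv b J).map (algebraMap K L)
  obtain ⟨μ, hμ⟩ := IsAlgClosed.exists_aeval_eq_zero L p hp.degree_pos.ne'
  have hroot : A.charpoly.IsRoot μ := by
    have hA : A.charpoly = J.charpoly.map (algebraMap K L) := by
      rw [Matrix.charpoly_map, LinearMap.charpoly_def]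
      rfl
    rw [hA, IsRoot, eval_map_algebraMap]
    exact aeval_eq_zero_of_dvd_aeval_eq_zero hpJ hμ
  have haeval : aeval A (minpoly K J) = 0 := by
    have h : A = (Algebra.ofId K L).mapMatrix (LinearMap.toMatrixAlgEquiv b J) := rfl
    rw [h, aeval_algHom_apply, aeval_algHom_apply, minpoly.aeval, map_zero, map_zero]
  have hmin : aeval μ (minpoly K J) = 0 := by
    by_cases hn : Nonempty (Module.Free.ChooseBasisIndex K V)
    · have h := spectrum.subset_polynomial_aeval A ((minpoly K J).map (algebraMap K L))
        ⟨μ, Matrix.mem_spectrum_of_isRoot_charpoly hroot, rfl⟩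
      simpa [aeval_map_algebraMap, haeval, eval_map_algebraMap] using h
    · rw [not_nonempty_iff] at hn
      simp [Matrix.charpoly] at hroot
  exact (Dvd.intro _ (minpoly.eq_of_irreducible hp hμ)).trans (minpoly.dvd K μ hmin)

theorem dvd_minpoly_of_squarefree_of_dvd_charpoly (J : Module.End K V) {f : K[X]}
    (hf : Squarefree f) (hfJ : f ∣ J.charpoly) : f ∣ minpoly K J := by
  classical
  obtain ⟨h, hh⟩ := EuclideanDomain.gcd_dvd_left f (minpoly K J)
  by_cases hu : IsUnit h
  · have := EuclideanDomain.gcd_dvd_right f (minpoly K J)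
    rw [hh]
    exact hu.mul_right_dvd.2 this
  · have h0 : h ≠ 0 := by
      rintro rfl
      exact hf.ne_zero (by simpa using hh)
    obtain ⟨p, hp, hph⟩ := WfDvdMonoid.exists_irreducible_factor hu h0
    have hpf : p ∣ f := hph.trans ⟨_, hh.trans (mul_comm _ _)⟩
    have hpm := irreducible_dvd_minpoly_of_dvd_charpoly J hp (hpf.trans hfJ)
    have hpg : p * p ∣ f := by
      rw [hh]
      exact mul_dvd_mul (EuclideanDomain.dvd_gcd hpf hpm) hph
    exact absurd (hf p hpg) hp.not_isUnit

/-- Some vector has the minimal polynomial as its annihilator. -/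
theorem exists_forall_aeval_apply_eq_zero_imp_minpoly_dvd (J : Module.End K V) :
    ∃ w : V, ∀ q : K[X], aeval J q w = 0 → minpoly K J ∣ q := by
  obtain ⟨x, hx⟩ := Module.exists_ker_toSpanSingleton_eq_annihilator K[X] (AEval' J)
  obtain ⟨w, rfl⟩ := (AEval'.of J).surjective x
  refine ⟨w, fun q hq ↦ ?_⟩
  have h : q ∈ LinearMap.ker (LinearMap.toSpanSingleton K[X] _ (AEval'.of J w)) := by
    rw [LinearMap.mem_ker, LinearMap.toSpanSingleton_apply]
    have h2 := AEval.of_aeval_smul (R := K) (a := J) q w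
    rw [Module.End.smul_def, hq, map_zero] at h2
    exact h2.symm
  rwa [hx, ← span_minpoly_eq_annihilator, Ideal.mem_span_singleton] at h

/-- If the nonzero part of the characteristic polynomial is squarefree of degree equal to the rank,
then the range of `J` has a cyclic vector. -/
theorem exists_cyclic_vector_range (J : Module.End K V) {r : ℕ}
    (hrank : Module.finrank K (LinearMap.range J) = r) {f : K[X]}
    (hchar : J.charpoly = X ^ (Module.finrank K V - r) * f) (hf0 : f.eval 0 ≠ 0)
    (hf : Squarefree f) :
    ∃ w : V, (∀ q ∈ degreeLT K r, aeval J q (J w) = 0 → q = 0) ∧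
      ∀ v : V, ∃ q ∈ degreeLT K r, aeval J q (J w) = J v := by
  obtain ⟨w, hw⟩ := exists_forall_aeval_apply_eq_zero_imp_minpoly_dvd J
  have hdeg : f.natDegree = r := by
    have h := LinearMap.charpoly_natDegree J
    have hr : r ≤ Module.finrank K V := hrank ▸ J.finrank_range_le
    rw [hchar, natDegree_mul (pow_ne_zero _ X_ne_zero) hf.ne_zero, natDegree_X_pow] at h
    omega
  have hfm := dvd_minpoly_of_squarefree_of_dvd_charpoly J hf ⟨_, hchar.trans (mul_comm _ _)⟩
  have hinj : ∀ q ∈ degreeLT K r, aeval J q (J w) = 0 → q = 0 := by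
    intro q hq h0
    have hfX : f ∣ q * X := hfm.trans (hw _ (by simpa using h0))
    have hcop : IsCoprime f X := by
      refine ((irreducible_X.coprime_iff_not_dvd).2 fun h ↦ hf0 ?_).symm
      rwa [X_dvd_iff, coeff_zero_eq_eval_zero] at h
    refine eq_zero_of_dvd_of_degree_lt (hcop.dvd_of_dvd_mul_right hfX) ?_
    rw [degree_eq_natDegree hf.ne_zero, hdeg]
    exact mem_degreeLT.1 hq
  refine ⟨w, hinj, fun v ↦ ?_⟩
  let φ : degreeLT K r →ₗ[K] LinearMap.range J :=
    { toFun := fun q ↦ ⟨aeval J q.1 (J w), aeval J q.1 w, by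
        simpa using LinearMap.congr_fun (congrArg (aeval J) (mul_comm X q.1)) w⟩
      map_add' := fun p q ↦ by ext; simp
      map_smul' := fun c q ↦ by ext; simp }
  have hφ : Function.Injective φ := by
    rw [injective_iff_map_eq_zero]
    intro q hq
    exact Subtype.ext (hinj q.1 q.2 (congrArg Subtype.val hq))
  have hfin : Module.finrank K (degreeLT K r) = Module.finrank K (LinearMap.range J) := by
    rw [hrank, (degreeLTEquiv K r).finrank_eq, Module.finrank_fin_fun]
  have : FiniteDimensional K (degreeLT K r) := Module.Finite.equiv (degreeLTEquiv K r).symm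
  obtain ⟨q, hq⟩ := (LinearMap.injective_iff_surjective_of_finrank_eq_finrank hfin).1 hφ
    ⟨J v, v, rfl⟩
  exact ⟨q.1, q.2, congrArg Subtype.val hq⟩

end Module.End

theorem Finset.sum_range_eq_sum_odd_add_sum_even {M : Type*} [AddCommMonoid M] (g : ℕ → M)
    (n : ℕ) : ∑ i ∈ Finset.range n, g i =
      ∑ k ∈ Finset.range (n / 2), g (2 * k + 1) + ∑ k ∈ Finset.range ((n + 1) / 2), g (2 * k) := by
  induction n with
  | zero => simp
  | succ n ih =>
    rw [Finset.sum_range_succ, ih]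
    obtain ⟨m, rfl | rfl⟩ := n.even_or_odd'
    · rw [show (2 * m + 1 + 1) / 2 = m + 1 by omega, show (2 * m + 1) / 2 = m by omega,
        show 2 * m / 2 = m by omega, Finset.sum_range_succ _ m, add_assoc]
    · rw [show (2 * m + 1 + 1 + 1) / 2 = m + 1 by omega, show (2 * m + 1 + 1) / 2 = m + 1 by omega,
        show (2 * m + 1) / 2 = m by omega, Finset.sum_range_succ (fun k ↦ g (2 * k + 1)) m]
      abel

section Skew

variable {V : Type*} [NormedAddCommGroup V] [InnerProductSpace ℝ V] {J : Module.End ℝ V}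

theorem inner_pow_apply_of_skew (hskew : ∀ x y : V, ⟪J x, y⟫ = - ⟪x, J y⟫) (n : ℕ) (x y : V) :
    ⟪(J ^ n) x, y⟫ = (-1) ^ n * ⟪x, (J ^ n) y⟫ := by
  induction n generalizing x with
  | zero => simp
  | succ n ih =>
    rw [pow_succ, Module.End.mul_apply, ih, hskew, ← Module.End.mul_apply, ← pow_succ', pow_succ,
      ← pow_succ]
    ring

theorem inner_sum_odd_pow_of_skew (hskew : ∀ x y : V, ⟪J x, y⟫ = - ⟪x, J y⟫) {ι : Type*}
    (s : Finset ι) (c : ι → ℝ) (d : ι → ℕ) (x y : V) :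
    ⟪(∑ k ∈ s, c k • J ^ (2 * d k + 1)) x, y⟫ = - ⟪x, (∑ k ∈ s, c k • J ^ (2 * d k + 1)) y⟫ := by
  simp only [LinearMap.sum_apply, LinearMap.smul_apply, sum_inner, inner_sum, inner_smul_left,
    inner_smul_right, inner_pow_apply_of_skew hskew, ← Finset.sum_neg_distrib]
  exact Finset.sum_congr rfl fun k _ ↦ by simp [pow_succ, pow_mul]

theorem inner_sum_even_pow_of_skew (hskew : ∀ x y : V, ⟪J x, y⟫ = - ⟪x, J y⟫) {ι : Type*}
    (s : Finset ι) (c : ι → ℝ) (d : ι → ℕ) (x y : V) :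
    ⟪(∑ k ∈ s, c k • J ^ (2 * d k)) x, y⟫ = ⟪x, (∑ k ∈ s, c k • J ^ (2 * d k)) y⟫ := by
  simp only [LinearMap.sum_apply, LinearMap.smul_apply, sum_inner, inner_sum, inner_smul_left,
    inner_smul_right, inner_pow_apply_of_skew hskew]
  exact Finset.sum_congr rfl fun k _ ↦ by simp [pow_mul]

theorem mul_eq_zero_comm_of_skew (hskew : ∀ x y : V, ⟪J x, y⟫ = - ⟪x, J y⟫) {Q : Module.End ℝ V}
    (hQ : ∀ x y : V, ⟪Q x, y⟫ = - ⟪x, Q y⟫) (hQJ : Q * J = 0) : J * Q = 0 := by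
  refine LinearMap.ext fun x ↦ ext_inner_right ℝ fun y ↦ ?_
  rw [Module.End.mul_apply, hskew, hQ, ← Module.End.mul_apply, hQJ]
  simp

/-- If `S` is skew and `G` symmetric, both commuting with the skew operator `J`, then `S * J` is
symmetric and `G * J` is skew, so they can only agree by vanishing. -/
theorem mul_eq_zero_of_skew_of_symmetric (hskew : ∀ x y : V, ⟪J x, y⟫ = - ⟪x, J y⟫)
    {S G : Module.End ℝ V} (hS : ∀ x y : V, ⟪S x, y⟫ = - ⟪x, S y⟫)
    (hG : ∀ x y : V, ⟪G x, y⟫ = ⟪x, G y⟫) (hSJ : Commute S J) (hGJ : Commute G J)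
    (h : S * J = G * J) : S * J = 0 := by
  refine LinearMap.ext fun x ↦ ext_inner_right ℝ fun y ↦ ?_
  have h1 : ⟪(S * J) x, y⟫ = ⟪x, (S * J) y⟫ := by
    rw [Module.End.mul_apply, hS, hskew, neg_neg, hSJ.eq]
    rfl
  have h2 : ⟪(G * J) x, y⟫ = - ⟪x, (G * J) y⟫ := by
    rw [Module.End.mul_apply, hG, hskew, hGJ.eq]
    rfl
  rw [← h] at h2
  rw [LinearMap.zero_apply, inner_zero_left]
  linarith

end Skew

/-- Let `(V, ⟪·,·⟫)` be a finite-dimensional real inner product space and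
`J ∈ so(V)` skew-symmetric of rank `r` all of whose nonzero complex eigenvalues are pairwise
distinct. Then the centraliser of `J` in `so(V)` is `Span(J, J³, …, J^{r−1}) ⊕ {Q ∈ so(V) : QJ = 0}`:
a skew-symmetric `D` commutes with `J` iff `D = Σ αₖ J^{2k+1} + Q` with `Q ∈ so(V)`, `QJ = 0`,
and this decomposition is unique. -/
theorem centralizer_of_generic_skew {V : Type*}
    [NormedAddCommGroup V] [InnerProductSpace ℝ V] [FiniteDimensional ℝ V]
    (J : Module.End ℝ V)
    (hskew : ∀ x y : V, ⟪J x, y⟫ = - ⟪x, J y⟫)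
    (r : ℕ)
    (hrank : Module.finrank ℝ (LinearMap.range J) = r)
    (hchar : ∃ f : Polynomial ℝ,
      J.charpoly = Polynomial.X ^ (Module.finrank ℝ V - r) * f ∧ f.eval 0 ≠ 0 ∧ Squarefree f)
    (D : Module.End ℝ V)
    (hDskew : ∀ x y : V, ⟪D x, y⟫ = - ⟪x, D y⟫) :
    D * J = J * D ↔
      ∃! p : (Fin (r / 2) → ℝ) × Module.End ℝ V,
        ((∀ x y : V, ⟪p.2 x, y⟫ = - ⟪x, p.2 y⟫) ∧ p.2 * J = 0) ∧
        D = (∑ k : Fin (r / 2), p.1 k • J ^ (2 * (k : ℕ) + 1)) + p.2 := by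
  obtain ⟨f, hf, hf0, hsq⟩ := hchar
  obtain ⟨w, hinj, hsurj⟩ := Module.End.exists_cyclic_vector_range J hrank hf hf0 hsq
  have hodd : ∀ c : Fin (r / 2) → ℝ,
      Commute (∑ k : Fin (r / 2), c k • J ^ (2 * (k : ℕ) + 1)) J := fun c ↦
    Commute.sum_left _ _ _ fun k _ ↦ ((Commute.refl J).pow_left _).smul_left _
  constructor
  · intro hDJ
    obtain ⟨p, hp, hpJ⟩ := Module.End.exists_mul_eq_aeval_mul_of_commute hsurj hDJ
    let c : Fin (r / 2) → ℝ := fun k ↦ p.coeff (2 * k + 1)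
    let E := ∑ k : Fin (r / 2), c k • J ^ (2 * (k : ℕ) + 1)
    let G := ∑ k ∈ Finset.range ((r + 1) / 2), p.coeff (2 * k) • J ^ (2 * k)
    have hsplit : aeval J p = E + G := by
      have hE : E = ∑ k ∈ Finset.range (r / 2), p.coeff (2 * k + 1) • J ^ (2 * k + 1) :=
        Fin.sum_univ_eq_sum_range (fun k ↦ p.coeff (2 * k + 1) • J ^ (2 * k + 1)) (r / 2)
      rw [hE, ← Finset.sum_range_eq_sum_odd_add_sum_even (fun i ↦ p.coeff i • J ^ i), aeval_def,
        eval₂_eq_sum, sum_def]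
      simp only [← Algebra.smul_def]
      refine Finset.sum_subset (fun i hi ↦ ?_) fun i _ hi ↦ by
        rw [notMem_support_iff.1 hi, zero_smul]
      rw [Finset.mem_range]
      by_contra! hri
      exact mem_support_iff.1 hi
        (coeff_eq_zero_of_degree_lt ((mem_degreeLT.1 hp).trans_le (Nat.cast_le.2 hri)))
    have hEskew := inner_sum_odd_pow_of_skew hskew Finset.univ c (fun k ↦ (k : ℕ))
    have hS : ∀ x y : V, ⟪(D - E) x, y⟫ = - ⟪x, (D - E) y⟫ := fun x y ↦ by
      rw [LinearMap.sub_apply, LinearMap.sub_apply, inner_sub_left, inner_sub_right, hDskew,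
        hEskew]
      ring
    have hSJ : (D - E) * J = 0 :=
      mul_eq_zero_of_skew_of_symmetric (G := G) hskew hS
        (inner_sum_even_pow_of_skew hskew _ _ fun k ↦ k)
        (Commute.sub_left hDJ (hodd c))
        (Commute.sum_left _ _ _ fun k _ ↦ ((Commute.refl J).pow_left _).smul_left _)
        (by rw [sub_mul, hpJ, hsplit, add_mul, add_sub_cancel_left])
    refine ⟨(c, D - E), ⟨⟨hS, hSJ⟩, (add_sub_cancel E D).symm⟩, ?_⟩
    rintro ⟨c', Q⟩ ⟨⟨-, hQJ⟩, hDQ⟩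
    dsimp only at hQJ hDQ
    let q : ℝ[X] := ∑ k : Fin (r / 2), monomial (2 * (k : ℕ) + 1) (c' k - c k)
    have hqJ : aeval J q = ∑ k : Fin (r / 2), c' k • J ^ (2 * (k : ℕ) + 1) - E := by
      simp [q, E, aeval_monomial, ← Algebra.smul_def, Finset.sum_sub_distrib]
    have hq : q ∈ degreeLT ℝ r := Submodule.sum_mem _ fun k _ ↦
      mem_degreeLT.2 ((degree_monomial_le _ _).trans_lt (Nat.cast_lt.2 (by omega)))
    have hq0 : q = 0 := by
      refine hinj q hq ?_
      have h : aeval J q * J = 0 := by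
        rw [hqJ, eq_sub_of_add_eq hDQ.symm, sub_right_comm, sub_mul, hSJ, hQJ, sub_zero]
      exact LinearMap.congr_fun h w
    have hc : c' = c := by
      funext j
      have h := congrArg (fun g ↦ coeff g (2 * (j : ℕ) + 1)) hq0
      simpa [q, finsetSum_coeff, coeff_monomial, Fin.val_inj, sub_eq_zero] using h
    subst hc
    rw [Prod.mk.injEq]
    exact ⟨rfl, eq_sub_of_add_eq' hDQ.symm⟩
  · rintro ⟨⟨c, Q⟩, ⟨⟨hQ, hQJ⟩, hD⟩, -⟩
    dsimp only at hQ hQJ hD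
    rw [hD, add_mul, mul_add, hQJ, mul_eq_zero_comm_of_skew hskew hQ hQJ, (hodd c).eq]
end

section
/- Let (V, ⟨·,·⟩) be a finite-dimensional real inner product space and J ∈ so(V) a skew-symmetric operator of rank r all of whose nonzero complex eigenvalues are pairwise distinct. Then the set of X ∈ V for which the r/2 vectors J X, J^3 X, …, J^{r−1} X are linearly independent is open and dense in V. -/
open scoped RealInnerProductSpace
open Polynomial UniqueFactorizationMonoid

/-- An irreducible factor of the characteristic polynomial divides every annihilating
polynomial. -/
theorem Irreducible.dvd_of_dvd_charpoly_of_aeval_eq_zero {K V : Type*} [Field K]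
    [AddCommGroup V] [Module K V] [FiniteDimensional K V] {J : Module.End K V} {p g : K[X]}
    (hp : Irreducible p) (hpJ : p ∣ J.charpoly) (hg : aeval J g = 0) : p ∣ g := by
  have : Fact (Irreducible p) := ⟨hp⟩
  let L := AdjoinRoot p
  let α : L := AdjoinRoot.root p
  have hroot : (LinearMap.baseChange L J).charpoly.IsRoot α := by
    rw [LinearMap.charpoly_baseChange, IsRoot, eval_map_algebraMap, AdjoinRoot.aeval_eq]
    exact AdjoinRoot.mk_eq_zero.2 hpJ
  obtain ⟨v, hv⟩ :=
    ((Module.End.hasEigenvalue_iff_isRoot_charpoly _ _).2 hroot).exists_hasEigenvector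
  have h0 : aeval (LinearMap.baseChange L J) (g.map (algebraMap K L)) = 0 := by
    have h := Polynomial.aeval_algHom_apply (Module.End.baseChangeHom K L V) J g
    rw [hg, map_zero] at h
    rw [aeval_map_algebraMap]
    exact h
  have h1 := Module.End.aeval_apply_of_hasEigenvector (p := g.map (algebraMap K L)) hv
  rw [h0, LinearMap.zero_apply, eq_comm, smul_eq_zero, or_iff_left hv.2, eval_map_algebraMap,
    AdjoinRoot.aeval_eq] at h1
  exact AdjoinRoot.mk_eq_zero.1 h1

/-- A vector annihilated by `(X * f)(J)` but by no `(X * (f / p))(J)`, for `p` a monic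
irreducible factor of `f`, is annihilated by no `(X * q)(J)` with `q` nonzero of
degree less than that of `f`. -/
theorem Polynomial.eq_zero_of_aeval_X_mul_apply_eq_zero {K V : Type*} [Field K]
    [AddCommGroup V] [Module K V] {J : Module.End K V} {f q : K[X]} {v : V}
    (hf0 : f ≠ 0) (hf : aeval J (X * f) v = 0)
    (hv : ∀ p : K[X], Irreducible p → p.Monic → p ∣ f → aeval J (X * (f / p)) v ≠ 0)
    (hq : aeval J (X * q) v = 0) (hdeg : q.degree < f.degree) : q = 0 := by
  classical
  let d := EuclideanDomain.gcd q f
  have hd (c : K[X]) : aeval J (X * (d * c)) v = 0 := by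
    have : X * (d * c) = (c * EuclideanDomain.gcdA q f) * (X * q) +
        (c * EuclideanDomain.gcdB q f) * (X * f) := by
      rw [show d = _ from EuclideanDomain.gcd_eq_gcd_ab q f]
      ring
    rw [this, map_add, LinearMap.add_apply, map_mul _ _ (X * q), map_mul _ _ (X * f),
      Module.End.mul_apply, Module.End.mul_apply, hq, hf, map_zero, map_zero, add_zero]
  obtain ⟨e, he⟩ : d ∣ f := EuclideanDomain.gcd_dvd_right q f
  by_cases hu : IsUnit e
  · refine eq_zero_of_dvd_of_degree_lt ?_ hdeg
    have : f ∣ d := by rw [he]; exact (associated_mul_unit_left d e hu).dvd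
    exact this.trans (EuclideanDomain.gcd_dvd_left q f)
  · have he0 : e ≠ 0 := by
      rintro rfl
      exact hf0 (by simpa using he)
    obtain ⟨p, hp⟩ := exists_mem_normalizedFactors he0 hu
    obtain ⟨hirr, hmonic, e', rfl⟩ := (Polynomial.mem_normalizedFactors_iff he0).1 hp
    refine absurd (hd e') ?_
    have hfp : f = p * (d * e') := by rw [he]; ring
    have := hv p hirr hmonic ⟨_, hfp⟩
    rwa [hfp, mul_div_cancel_left₀ _ hirr.ne_zero] at this

/-- The kernel of a power of a skew-symmetric operator is contained in its kernel. -/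
theorem apply_eq_zero_of_skew_of_pow_apply_eq_zero {V : Type*} [NormedAddCommGroup V]
    [InnerProductSpace ℝ V] {J : Module.End ℝ V} (hskew : ∀ x y : V, ⟪J x, y⟫ = - ⟪x, J y⟫)
    (n : ℕ) {w : V} (hw : (J ^ n) w = 0) : J w = 0 := by
  induction n generalizing w with
  | zero => simp_all
  | succ n ih =>
    rw [pow_succ, Module.End.mul_apply] at hw
    have h := hskew w (J w)
    rwa [ih hw, inner_zero_right, neg_zero, inner_self_eq_zero] at h

theorem Submodule.dense_compl_of_ne_top {V : Type*} [NormedAddCommGroup V] [NormedSpace ℝ V]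
    {W : Submodule ℝ V} (hW : W ≠ ⊤) : Dense (W : Set V)ᶜ := by
  rw [← interior_eq_empty_iff_dense_compl, ← Set.not_nonempty_iff_eq_empty]
  exact fun h => hW (Submodule.eq_top_of_nonempty_interior' W h)

/-- Let `(V, ⟪·,·⟫)` be a finite-dimensional real inner product space and
`J ∈ so(V)` skew-symmetric of rank `r` all of whose nonzero complex eigenvalues are pairwise
distinct (the characteristic polynomial is `X^(dim V − r)·f` with `f(0) ≠ 0`, `f` squarefree).
Then the set of `X ∈ V` for which the `r/2` vectors `J X, J³ X, …, J^{r−1} X` are linearly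
independent is open and dense in `V`. -/
theorem odd_powers_linearIndependent_set_open_dense {V : Type*}
    [NormedAddCommGroup V] [InnerProductSpace ℝ V] [FiniteDimensional ℝ V]
    (J : Module.End ℝ V)
    (hskew : ∀ x y : V, ⟪J x, y⟫ = - ⟪x, J y⟫)
    (r : ℕ)
    (hrank : Module.finrank ℝ (LinearMap.range J) = r)
    (hchar : ∃ f : Polynomial ℝ,
      J.charpoly = Polynomial.X ^ (Module.finrank ℝ V - r) * f ∧ f.eval 0 ≠ 0 ∧ Squarefree f) :
    IsOpen {X : V | LinearIndependent ℝ (fun k : Fin (r / 2) => (J ^ (2 * (k : ℕ) + 1)) X)} ∧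
    Dense {X : V | LinearIndependent ℝ (fun k : Fin (r / 2) => (J ^ (2 * (k : ℕ) + 1)) X)} := by
  classical
  have : CompleteSpace V := FiniteDimensional.complete ℝ V
  obtain ⟨f, hJf, hf0, hsq⟩ := hchar
  have hf : f ≠ 0 := hsq.ne_zero
  constructor
  · refine isOpen_setOfPred_linearIndependent.preimage
      (f := fun (x : V) (k : Fin (r / 2)) => (J ^ (2 * (k : ℕ) + 1)) x) ?_
    exact continuous_pi fun k => LinearMap.continuous_of_finiteDimensional _
  · have hdeg : f.natDegree = r := by
      have h := congrArg natDegree hJf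
      rw [LinearMap.charpoly_natDegree, natDegree_mul (pow_ne_zero _ X_ne_zero) hf,
        natDegree_X_pow] at h
      have := LinearMap.finrank_range_le J
      omega
    have hXf (v : V) : aeval J (X * f) v = 0 := by
      have h := congrArg (fun g => aeval J g v) hJf
      simp only [LinearMap.aeval_self_charpoly, map_mul, map_pow, aeval_X, Module.End.mul_apply,
        LinearMap.zero_apply] at h
      rw [map_mul, aeval_X, Module.End.mul_apply]
      exact apply_eq_zero_of_skew_of_pow_apply_eq_zero hskew _ h.symm
    let W (p : ℝ[X]) : Submodule ℝ V := LinearMap.ker (aeval J (X * (f / p)))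
    have hW (p : ℝ[X]) (hp : p ∈ (normalizedFactors f).toFinset) : W p ≠ ⊤ := by
      rw [Multiset.mem_toFinset] at hp
      have hirr := irreducible_of_normalized_factor p hp
      have hpf := dvd_of_mem_normalizedFactors hp
      intro h
      have hdvd := hirr.dvd_of_dvd_charpoly_of_aeval_eq_zero (hJf ▸ hpf.mul_left _)
        (LinearMap.ker_eq_top.1 h)
      obtain ⟨c, hc⟩ := hpf
      rw [hc, mul_div_cancel_left₀ _ hirr.ne_zero] at hdvd
      rcases hirr.prime.dvd_or_dvd hdvd with h | h
      · have hXp := (hirr.associated_of_dvd irreducible_X h).symm.dvd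
        rw [X_dvd_iff, coeff_zero_eq_eval_zero] at hXp
        exact hf0 (by rw [hc, eval_mul, hXp, zero_mul])
      · exact hirr.not_isUnit (hsq p (hc ▸ mul_dvd_mul_left p h))
    have hdense : Dense (⋂ p ∈ ((normalizedFactors f).toFinset : Set ℝ[X]), (W p : Set V)ᶜ) :=
      dense_biInter_of_isOpen
        (fun p _ => (Submodule.closed_of_finiteDimensional (W p)).isOpen_compl)
        (Finset.countable_toSet _) (fun p hp => Submodule.dense_compl_of_ne_top (hW p hp))
    refine hdense.mono fun v hv => ?_
    rw [Set.mem_ofPred_eq, Fintype.linearIndependent_iff]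
    intro c hc k
    let q : ℝ[X] := ∑ i : Fin (r / 2), monomial (2 * (i : ℕ)) (c i)
    have hq : q = 0 := by
      refine eq_zero_of_aeval_X_mul_apply_eq_zero hf (hXf v) ?_ ?_ ?_ (v := v)
      · intro p hp hmonic hpf hzero
        have hmem : p ∈ normalizedFactors f :=
          (Polynomial.mem_normalizedFactors_iff hf).2 ⟨hp, hmonic, hpf⟩
        exact Set.mem_iInter₂.1 hv p (Multiset.mem_toFinset.2 hmem) hzero
      · rw [← hc]
        simp [q, Finset.mul_sum, X_mul_monomial, aeval_monomial, map_sum, LinearMap.sum_apply,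
          Algebra.algebraMap_eq_smul_one]
      · rw [degree_eq_natDegree hf, hdeg, degree_lt_iff_coeff_zero]
        intro m hm
        simp only [q, finsetSum_coeff, coeff_monomial]
        exact Finset.sum_eq_zero fun i _ => if_neg (by omega)
    have hk := congrArg (fun g => coeff g (2 * (k : ℕ))) hq
    simpa [q, coeff_monomial, ← Fin.ext_iff] using hk
end

section
/- Let 𝔤 be a finite-dimensional real Lie algebra equipped with a nondegenerate symmetric invariant bilinear form B (invariant meaning B([X,Y],Z) = B(X,[Y,Z]) for all X,Y,Z), and let Φ ∈ End(𝔤) be symmetric with respect to B and satisfy [K, ΦK] = 0 for every K ∈ 𝔤. Then Φ commutes with ad_K for every K ∈ 𝔤 (i.e. Φ[K,L] = [K, ΦL] for all K, L); consequently every eigenspace of Φ is an ideal of 𝔤, and eigenspaces corresponding to distinct eigenvalues are B-orthogonal. -/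
/-- Let `𝔤` be a finite-dimensional real Lie algebra with a nondegenerate
symmetric invariant bilinear form `B`, and let `Φ ∈ End(𝔤)` be `B`-symmetric with
`⁅K, Φ K⁆ = 0` for all `K`. Then `Φ` commutes with every `ad_K`, every eigenspace of `Φ` is an
ideal of `𝔤`, and eigenspaces for distinct eigenvalues are `B`-orthogonal. -/
theorem phi_commutes_with_ad_and_eigenspaces_are_ideals
    {g : Type*} [LieRing g] [LieAlgebra ℝ g] [FiniteDimensional ℝ g]
    (B : g →ₗ[ℝ] g →ₗ[ℝ] ℝ)
    (hBsym : ∀ X Y : g, B X Y = B Y X)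
    (hBnondeg : ∀ X : g, (∀ Y : g, B X Y = 0) → X = 0)
    (hBinv : ∀ X Y Z : g, B ⁅X, Y⁆ Z = B X ⁅Y, Z⁆)
    (Φ : g →ₗ[ℝ] g)
    (hΦsym : ∀ X Y : g, B (Φ X) Y = B X (Φ Y))
    (hΦ : ∀ K : g, ⁅K, Φ K⁆ = 0) :
    (∀ K L : g, Φ ⁅K, L⁆ = ⁅K, Φ L⁆) ∧
    (∀ (c : ℝ) (x : g), x ∈ Module.End.eigenspace (Φ : Module.End ℝ g) c →
      ∀ y : g, ⁅y, x⁆ ∈ Module.End.eigenspace (Φ : Module.End ℝ g) c) ∧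
    (∀ c c' : ℝ, c ≠ c' →
      ∀ x ∈ Module.End.eigenspace (Φ : Module.End ℝ g) c,
      ∀ y ∈ Module.End.eigenspace (Φ : Module.End ℝ g) c', B x y = 0) := by
  have polar (K L : g) : ⁅K, Φ L⁆ = ⁅Φ K, L⁆ := by
    have h := hΦ (K + L)
    simp only [map_add, add_lie, lie_add, hΦ, zero_add, add_zero] at h
    rw [← lie_skew (Φ K) L, eq_neg_iff_add_eq_zero, add_comm]
    simpa [add_comm] using h
  have comm (K L : g) : Φ ⁅K, L⁆ = ⁅K, Φ L⁆ := by
    refine sub_eq_zero.mp (hBnondeg _ fun Z ↦ ?_)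
    rw [map_sub, LinearMap.sub_apply, hΦsym, hBinv, hBinv, polar, sub_self]
  refine ⟨comm, fun c x hx y ↦ ?_, fun c c' hne x hx y hy ↦ ?_⟩
  · rw [Module.End.mem_eigenspace_iff] at hx ⊢
    rw [comm, hx, lie_smul]
  · rw [Module.End.mem_eigenspace_iff] at hx hy
    have h := hΦsym x y
    rw [hx, hy, map_smul, LinearMap.smul_apply, map_smul, smul_eq_mul, smul_eq_mul] at h
    exact (mul_eq_mul_right_iff.mp h).resolve_left hne
end
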